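/- The 26 ω-reflections in the roots of the diagram D generate the reflection group R(L) of the Lorentzian complex Leech lattice L. -/

import Mathlib

noncomputable section

open ComplexConjugate

namespace Bimonster

/-- The primitive cube root of unity `ω = e^{2πi/3}`. -/
def ω : ℂ := Complex.exp (2 * (Real.pi : ℂ) * Complex.I / 3)

/-- `θ = ω - ω̄ = √-3`. -/
def θ : ℂ := ω - conj ω

/-- `ξ = e^{-πi/6}`. -/
def ξ : ℂ := Complex.exp (-((Real.pi : ℂ) * Complex.I) / 6)

/-- Membership in the ring of Eisenstein integers `ℰ = ℤ[ω] ⊆ ℂ`. -/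
def EisP (z : ℂ) : Prop := ∃ a b : ℤ, z = (a : ℂ) + (b : ℂ) * ω

/-- The units of the ring of Eisenstein integers. -/
def EisUnit (z : ℂ) : Prop :=
  z = 1 ∨ z = -1 ∨ z = ω ∨ z = -ω ∨ z = ω ^ 2 ∨ z = -ω ^ 2

/-- The underlying 14-dimensional complex vector space of `L = 3E₈ ⊕ H`. -/
abbrev V : Type := Fin 14 → ℂ

/-- The Hermitian form of `L = 3E₈ ⊕ H`: negative definite standard form on the twelve
`E₈`-coordinates, and the hyperbolic cell with Gram matrix `[[0, θ̄], [θ, 0]]` on the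
last two coordinates.  It is conjugate-linear in the first variable. -/
def herm (u v : V) : ℂ :=
  -(∑ i : Fin 12, conj (u (Fin.castLE (by norm_num) i)) * v (Fin.castLE (by norm_num) i)) +
    conj (u 12) * conj θ * v 13 + conj (u 13) * θ * v 12

/-- First generator of the ternary tetracode `𝒞₄ ⊆ 𝔽₃⁴`. -/
def tet1 : Fin 4 → ℤ := ![1, 1, -1, 0]

/-- Second generator of the ternary tetracode `𝒞₄ ⊆ 𝔽₃⁴`. -/
def tet2 : Fin 4 → ℤ := ![0, 1, 1, 1]

/-- The complex `E₈` lattice: vectors of `ℰ⁴` whose reduction mod `θ` lies in the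
ternary tetracode. -/
def inE8 (w : Fin 4 → ℂ) : Prop :=
  (∀ i, EisP (w i)) ∧
    ∃ s t : ℤ, ∀ i : Fin 4, ∃ a b : ℤ,
      w i - ((tet1 i * s + tet2 i * t : ℤ) : ℂ) = θ * ((a : ℂ) + (b : ℂ) * ω)

/-- The lattice `L = 3E₈ ⊕ H` as a subset of `ℂ¹⁴`. -/
def Lset : Set V :=
  {v | (∀ k : Fin 3,
      inE8 fun i : Fin 4 =>
        v ⟨4 * (k : ℕ) + (i : ℕ), by have hk := k.isLt; have hi := i.isLt; omega⟩) ∧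
    EisP (v 12) ∧ EisP (v 13)}

/-- A root of `L`: a primitive lattice vector of norm `-3`. -/
def IsRoot (r : V) : Prop :=
  r ∈ Lset ∧ herm r r = -3 ∧
    ∀ α : ℂ, EisP α → ∀ y ∈ Lset, r = α • y → EisUnit α

/-- The `μ`-reflection in a vector `r`: `v ↦ v − (1−μ)·r·⟨r,v⟩/|r|²`. -/
def reflMap (μ : ℂ) (r v : V) : V := v - ((1 - μ) * herm r v / herm r r) • r

/-- The automorphism group of the lattice `L`: invertible `ℂ`-linear maps preserving
the lattice and the Hermitian form. -/
def AutL : Subgroup (V ≃ₗ[ℂ] V) where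
  carrier := {g | (∀ v : V, v ∈ Lset ↔ g v ∈ Lset) ∧ ∀ u v : V, herm (g u) (g v) = herm u v}
  one_mem' := ⟨fun _ => Iff.rfl, fun _ _ => rfl⟩
  mul_mem' := by
    rintro f g ⟨hf1, hf2⟩ ⟨hg1, hg2⟩
    refine ⟨fun v => ?_, fun u v => ?_⟩
    · exact (hg1 v).trans (hf1 (g v))
    · exact (hf2 (g u) (g v)).trans (hg2 u v)
  inv_mem' := by
    rintro g ⟨hg1, hg2⟩
    refine ⟨fun v => ?_, fun u v => ?_⟩
    · have h := hg1 (g.symm v)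
      have hv : g (g.symm v) = v := g.apply_symm_apply v
      rw [hv] at h
      exact h.symm
    · have h := hg2 (g.symm u) (g.symm v)
      have hu : g (g.symm u) = u := g.apply_symm_apply u
      have hv : g (g.symm v) = v := g.apply_symm_apply v
      rw [hu, hv] at h
      exact h.symm

/-- The set of elements of `Aut(L)` acting as the `ω`-reflection in some root
belonging to `S`. -/
def ReflAutos (S : Set V) : Set (V ≃ₗ[ℂ] V) :=
  {g | g ∈ AutL ∧ ∃ r ∈ S, ∀ v, g v = reflMap ω r v}

/-- The reflection group `R(L)`: the subgroup of `Aut(L)` generated by the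
`ω`-reflections in all roots of `L`. -/
def RL : Subgroup (V ≃ₗ[ℂ] V) := Subgroup.closure (ReflAutos {r | IsRoot r})

/-- Two roots are adjacent when `|⟨a,b⟩| = √3`, i.e. when their `ω`-reflections braid. -/
def Adj (a b : V) : Prop := ‖herm a b‖ = Real.sqrt 3

/-- A set of roots is connected if the graph given by adjacency on it is connected. -/
def ConnectedSet (Φ : Set V) : Prop :=
  ∀ a ∈ Φ, ∀ b ∈ Φ, Relation.ReflTransGen (fun x y => x ∈ Φ ∧ y ∈ Φ ∧ Adj x y) a b

/-- `Rad Φ` is the radical of a set `Φ` of roots: the closure of `Φ` under reflecting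
members of the set in each other (and identification of unit multiples). -/
inductive Rad (Φ : Set V) : V → Prop
  | base {r : V} : r ∈ Φ → Rad Φ r
  | refl {a b : V} : Rad Φ a → Rad Φ b → Rad Φ (reflMap ω a b)
  | inv {a b : V} : Rad Φ a → Rad Φ b → Rad Φ (reflMap (conj ω) a b)
  | unit {u : ℂ} {r : V} : EisUnit u → Rad Φ r → Rad Φ (u • r)

/-- Shorthand for the entry `-θω²` occurring in the coordinates of the 26 roots. -/
def qc : ℂ := -(θ * ω ^ 2)

/- The 26 roots of the diagram `D` in the coordinate system `3E₈ ⊕ H`. -/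

def rA : V := ![0, 0, 0, 0, 0, 0, 0, 0, 0, 0, 0, 0, 1, ω ^ 2]
def rC1 : V := ![qc, 0, 0, 0, 0, 0, 0, 0, 0, 0, 0, 0, 0, 0]
def rC2 : V := ![0, 0, 0, 0, qc, 0, 0, 0, 0, 0, 0, 0, 0, 0]
def rC3 : V := ![0, 0, 0, 0, 0, 0, 0, 0, qc, 0, 0, 0, 0, 0]
def rE1 : V := ![0, qc, 0, 0, 0, 0, 0, 0, 0, 0, 0, 0, 0, 0]
def rE2 : V := ![0, 0, 0, 0, 0, qc, 0, 0, 0, 0, 0, 0, 0, 0]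
def rE3 : V := ![0, 0, 0, 0, 0, 0, 0, 0, 0, qc, 0, 0, 0, 0]
def rA1 : V := ![0, 0, 0, 0, 0, 0, 0, qc, 0, 0, 0, qc, ω, ω ^ 2]
def rA2 : V := ![0, 0, 0, qc, 0, 0, 0, 0, 0, 0, 0, qc, ω, ω ^ 2]
def rA3 : V := ![0, 0, 0, qc, 0, 0, 0, qc, 0, 0, 0, 0, ω, ω ^ 2]
def rG1 : V := ![0, 0, 0, qc, 0, 0, -qc, qc, 0, 0, -qc, qc, 2 * ω, 2 * ω ^ 2]
def rG2 : V := ![0, 0, -qc, qc, 0, 0, 0, qc, 0, 0, -qc, qc, 2 * ω, 2 * ω ^ 2]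
def rG3 : V := ![0, 0, -qc, qc, 0, 0, -qc, qc, 0, 0, 0, qc, 2 * ω, 2 * ω ^ 2]
def rF : V := ![0, 1, 1, -2, 0, 1, 1, -2, 0, 1, 1, -2, -2 + ω, -θ]
def rB1 : V := ![1, 0, 1, -1, 0, 0, 0, 0, 0, 0, 0, 0, -1, 0]
def rB2 : V := ![0, 0, 0, 0, 1, 0, 1, -1, 0, 0, 0, 0, -1, 0]
def rB3 : V := ![0, 0, 0, 0, 0, 0, 0, 0, 1, 0, 1, -1, -1, 0]
def rD1 : V := ![1, 1, -1, 0, 0, 0, 0, 0, 0, 0, 0, 0, 0, 0]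
def rD2 : V := ![0, 0, 0, 0, 1, 1, -1, 0, 0, 0, 0, 0, 0, 0]
def rD3 : V := ![0, 0, 0, 0, 0, 0, 0, 0, 1, 1, -1, 0, 0, 0]
def rF1 : V := ![0, 1, 1, 1, 0, 0, 0, 0, 0, 0, 0, 0, 0, 0]
def rF2 : V := ![0, 0, 0, 0, 0, 1, 1, 1, 0, 0, 0, 0, 0, 0]
def rF3 : V := ![0, 0, 0, 0, 0, 0, 0, 0, 0, 1, 1, 1, 0, 0]
def rZ1 : V := ![0, 1, 1, -2, 1, 0, 1, -1, 1, 0, 1, -1, qc, -θ]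
def rZ2 : V := ![1, 0, 1, -1, 0, 1, 1, -2, 1, 0, 1, -1, qc, -θ]
def rZ3 : V := ![1, 0, 1, -1, 1, 0, 1, -1, 0, 1, 1, -2, qc, -θ]

/-- The 13 roots of `D` labelled by the points of `P²(𝔽₃)`. -/
def pt : Fin 13 → V :=
  ![rA, rC1, rC2, rC3, rE1, rE2, rE3, rA1, rA2, rA3, rG1, rG2, rG3]

/-- The 13 roots of `D` labelled by the lines of `P²(𝔽₃)`. -/
def lnr : Fin 13 → V :=
  ![rF, rB1, rB2, rB3, rD1, rD2, rD3, rF1, rF2, rF3, rZ1, rZ2, rZ3]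

/-- The 26 roots of the diagram `D` (the incidence graph of `P²(𝔽₃)`). -/
def D26 : Set V := Set.range pt ∪ Set.range lnr

/-- The 16 roots forming the `M₆₆₆` diagram. -/
def M16 : Set V :=
  Set.range
    (![rA, rB1, rB2, rB3, rC1, rC2, rC3, rD1, rD2, rD3, rE1, rE2, rE3, rF1, rF2, rF3] :
      Fin 16 → V)

/-- The 26 vectors `(ρ₁,…,ρ₂₆) = (x₁,…,x₁₃, ξl₁,…,ξl₁₃)`. -/
def ρv : Fin 26 → V := fun i =>
  if h : (i : ℕ) < 13 then pt ⟨(i : ℕ), h⟩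
  else ξ • lnr ⟨(i : ℕ) - 13, by have := i.isLt; omega⟩

/-- The Weyl vector `ρ̄ = (Σ points + ξ Σ lines)/26`. -/
def ρbar : V := (26 : ℂ)⁻¹ • ((∑ i : Fin 13, pt i) + ξ • ∑ i : Fin 13, lnr i)

/-- The height of a root: `ht(r) = |⟨ρ̄, r⟩| / |ρ̄|²`. -/
def ht (r : V) : ℝ := ‖herm ρbar r‖ / ‖herm ρbar ρbar‖

end Bimonster

section
namespace Cov
open MeasureTheory Set Complex

/-- The unit cube with lower corner `m`. -/
def cube {ι : Type*} (m : ι → ℤ) : Set (ι → ℝ) := {x | ∀ i, x i ∈ Ioc (m i : ℝ) (m i + 1)}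

lemma cube_meas {ι : Type*} [Fintype ι] (m : ι → ℤ) : MeasurableSet (cube m) :=
  MeasurableSet.univ_pi' (fun _ => measurableSet_Ioc)

lemma cube_union {ι : Type*} : (⋃ m : ι → ℤ, cube m) = univ := by
  ext x
  simp only [mem_iUnion, mem_univ, iff_true]
  refine ⟨fun i => ⌈x i⌉ - 1, fun i => ?_⟩
  have h1 := Int.ceil_lt_add_one (x i)
  have h2 := Int.le_ceil (x i)
  constructor <;> push_cast <;> linarith

lemma cube_disj {ι : Type*} : Pairwise (Function.onFun Disjoint (cube (ι := ι))) := by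
  intro m n hmn
  rw [Function.onFun, Set.disjoint_left]
  intro x hx hy
  apply hmn
  funext i
  have h1 := hx i
  have h2 := hy i
  simp only [mem_Ioc] at h1 h2
  have a : (m i : ℝ) < n i + 1 := by linarith
  have b : (n i : ℝ) < m i + 1 := by linarith
  have a' : m i < n i + 1 := by exact_mod_cast a
  have b' : n i < m i + 1 := by exact_mod_cast b
  omega

lemma cube_shift {ι : Type*} [Fintype ι] (m : ι → ℤ) (g : (ι → ℝ) → ℂ) :
    ∫ x in cube m, g x = ∫ x in cube (0 : ι → ℤ), g (x + fun i => (m i : ℝ)) := by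
  have := (measurePreserving_add_right (volume : Measure (ι → ℝ))
    (fun i => (m i : ℝ))).setIntegral_preimage_emb
    (MeasurableEquiv.addRight (fun i => (m i : ℝ))).measurableEmbedding g (cube m)
  rw [← this]
  congr 2
  ext x
  simp only [cube, mem_preimage, mem_ofPred_eq, Pi.add_apply, mem_Ioc, Pi.zero_apply]
  refine forall_congr' fun i => ?_
  push_cast
  constructor <;> rintro ⟨h1, h2⟩ <;> constructor <;> linarith

lemma int_eq_tsum {ι : Type*} [Fintype ι] (g : (ι → ℝ) → ℂ) (hg : Integrable g) :
    ∫ x, g x = ∑' m : ι → ℤ, ∫ x in cube (0 : ι → ℤ), g (x + fun i => (m i : ℝ)) := by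
  have h := hasSum_integral_iUnion (μ := (volume : Measure (ι → ℝ))) (f := g)
    (s := cube (ι := ι)) cube_meas cube_disj hg.integrableOn
  rw [cube_union, setIntegral_univ] at h
  rw [← h.tsum_eq]
  exact tsum_congr fun m => cube_shift m g

/-- The character `e(k·x)`. -/
def ee {ι : Type*} [Fintype ι] (k : ι → ℤ) (x : ι → ℝ) : ℂ :=
  cexp (2 * Real.pi * I * ((∑ i, (k i : ℝ) * x i : ℝ) : ℂ))

lemma ee_norm {ι : Type*} [Fintype ι] (k : ι → ℤ) (x : ι → ℝ) : ‖ee k x‖ = 1 := by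
  unfold ee
  rw [show (2 * Real.pi * I * ((∑ i, (k i : ℝ) * x i : ℝ) : ℂ)) =
    ((2 * Real.pi * (∑ i, (k i : ℝ) * x i) : ℝ) : ℂ) * I by push_cast; ring]
  exact Complex.norm_exp_ofReal_mul_I _

lemma ee_cont {ι : Type*} [Fintype ι] (k : ι → ℤ) : Continuous (ee k) := by
  unfold ee
  fun_prop

lemma ee_mF {ι : Type*} [Fintype ι] (k : ι → ℤ) (x : ι → ℝ) :
    UnitAddTorus.mFourier k (fun i => (x i : UnitAddCircle)) = ee k x := by
  simp only [UnitAddTorus.mFourier, ContinuousMap.coe_mk, fourier_coe_apply, ee]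
  rw [← Complex.exp_sum]
  congr 1
  push_cast
  rw [Finset.mul_sum]
  refine Finset.sum_congr rfl fun i _ => ?_
  simp
  ring

lemma ee_shift {ι : Type*} [Fintype ι] (k m : ι → ℤ) (x : ι → ℝ) :
    ee k (x + fun i => (m i : ℝ)) = ee k x := by
  rw [← ee_mF, ← ee_mF]
  congr 1
  funext i
  simp

theorem poisson_pi {ι : Type*} [Fintype ι] (F : (ι → ℝ) → ℂ) (hF : Continuous F)
    (hb : ∀ R : ℝ, ∃ u : (ι → ℤ) → ℝ, Summable u ∧
      ∀ x, ‖x‖ ≤ R → ∀ m, ‖F (x + fun i => (m i : ℝ))‖ ≤ u m)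
    (hIntg : Integrable F)
    (hs : Summable fun k : ι → ℤ => ∫ x, ee (-k) x * F x) (x : ι → ℝ) :
    ∑' m : ι → ℤ, F (x + fun i => (m i : ℝ)) =
      ∑' k : ι → ℤ, (∫ x, ee (-k) x * F x) * ee k x := by
  classical
  set P : (ι → ℝ) → ℂ := fun x => ∑' m : ι → ℤ, F (x + fun i => (m i : ℝ)) with hP
  have hPc : Continuous P := by
    rw [continuous_iff_continuousAt]
    intro x
    obtain ⟨u, hu, hu'⟩ := hb (‖x‖ + 1)
    have : ContinuousOn P (Metric.ball 0 (‖x‖ + 1)) := by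
      refine continuousOn_tsum (u := u) (fun m => ?_) hu fun m y hy => hu' y ?_ m
      · fun_prop
      · simpa using (mem_ball_zero_iff.mp hy).le
    exact this.continuousAt (Metric.isOpen_ball.mem_nhds (by simp))
  have hPp : ∀ x (m : ι → ℤ), P (x + fun i => (m i : ℝ)) = P x := by
    intro x m
    simp only [hP]
    rw [← (Equiv.addLeft m).tsum_eq (fun n : ι → ℤ => F (x + fun i => (n i : ℝ)))]
    refine tsum_congr fun n => ?_
    congr 1
    funext i
    simp
    ring
  let π : (ι → ℝ) → UnitAddTorus ι := Pi.map (fun _ (t : ℝ) => (t : UnitAddCircle))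
  have hq : IsOpenQuotientMap π :=
    IsOpenQuotientMap.piMap fun i => QuotientAddGroup.isOpenQuotientMap_mk
  have hfac : ∀ x y, π x = π y → P x = P y := by
    intro x y hxy
    have : ∀ i, ∃ n : ℤ, x i = y i + n := by
      intro i
      have h := congrFun hxy i
      simp only [π, Pi.map_apply] at h
      have := (QuotientAddGroup.eq_iff_sub_mem).1 h
      obtain ⟨n, hn⟩ := AddSubgroup.mem_zmultiples_iff.1 this
      refine ⟨n, ?_⟩
      simp at hn
      linarith
    choose m hm using this
    rw [show x = y + fun i => (m i : ℝ) from funext hm, hPp]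
  let r : UnitAddTorus ι → (ι → ℝ) := Function.surjInv hq.surjective
  have hr : ∀ t, π (r t) = t := Function.surjInv_eq hq.surjective
  let G : C(UnitAddTorus ι, ℂ) := ⟨fun t => P (r t), by
    rw [hq.isQuotientMap.continuous_iff]
    convert hPc using 1
    funext x
    exact hfac _ _ (hr _)⟩
  have hG : ∀ x, G (π x) = P x := fun x => hfac _ _ (hr _)
  have hco : ∀ k, UnitAddTorus.mFourierCoeff G k = ∫ x, ee (-k) x * F x := by
    intro k
    rw [UnitAddTorus.mFourierCoeff_eq_integral _ _ (0 : ι → ℝ)]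
    have hIntg' : Integrable fun x => ee (-k) x * F x := by
      refine hIntg.bdd_mul (c := 1) (ee_cont _).aestronglyMeasurable ?_
      exact Filter.Eventually.of_forall fun x => (ee_norm _ _).le
    rw [int_eq_tsum _ hIntg']
    have hset : {x : ι → ℝ | ∀ i, x i ∈ Ioc ((0 : ι → ℝ) i) ((0 : ι → ℝ) i + 1)} =
        cube (0 : ι → ℤ) := by
      ext x; simp [cube]
    rw [hset]
    obtain ⟨u, hu, hu'⟩ := hb 1
    have hn1 : ∀ x ∈ cube (0 : ι → ℤ), ‖x‖ ≤ 1 := by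
      intro x hx
      rw [pi_norm_le_iff_of_nonneg zero_le_one]
      intro i
      have := hx i
      simp at this
      rw [Real.norm_eq_abs, abs_of_pos this.1]
      exact this.2
    have hvol : volume (cube (0 : ι → ℤ)) < ⊤ := by
      refine lt_of_le_of_lt (measure_mono (t := Metric.closedBall 0 1) ?_)
        measure_closedBall_lt_top
      intro x hx
      simpa using hn1 x hx
    rw [integral_tsum_of_summable_integral_norm]
    · refine setIntegral_congr_fun (cube_meas _) fun x _ => ?_
      change _ • G (π x) = _
      rw [hG]
      simp only [smul_eq_mul, ee_shift]
      rw [tsum_mul_left, ← ee_mF]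
    · intro m
      have := hIntg'.comp_add_right (fun i => (m i : ℝ))
      exact this.integrableOn
    · refine Summable.of_nonneg_of_le (fun m => integral_nonneg fun x => norm_nonneg _) (fun m => ?_)
        (hu.mul_right ((volume : Measure (ι → ℝ)).real (cube (0 : ι → ℤ))))
      have := norm_setIntegral_le_of_norm_le_const (μ := (volume : Measure (ι → ℝ)))
        (s := cube (0 : ι → ℤ)) (C := u m)
        (f := fun x => ‖ee (-k) (x + fun i => (m i : ℝ)) * F (x + fun i => (m i : ℝ))‖) hvol
        (fun x hx => by
          rw [norm_norm, norm_mul, ee_norm, one_mul]; exact hu' x (hn1 x hx) m)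
      exact (le_abs_self _).trans this
  have := UnitAddTorus.hasSum_mFourier_series_apply_of_summable (f := G)
    (by rw [show UnitAddTorus.mFourierCoeff G = fun k => ∫ x, ee (-k) x * F x from funext hco]
        exact hs) (π x)
  rw [hG] at this
  change P x = _
  rw [← this.tsum_eq]
  refine tsum_congr fun k => ?_
  rw [hco, smul_eq_mul]
  congr 1
  exact ee_mF k x
end Cov

end

section
namespace Cov
open MeasureTheory Set Complex
open scoped RealInnerProductSpace

variable {E : Type*} [NormedAddCommGroup E] [InnerProductSpace ℝ E]

/-- Even unimodular lattices in a Euclidean space. -/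
structure EU (M : Submodule ℤ E) : Prop where
  disc : DiscreteTopology M
  span : Submodule.span ℝ (M : Set E) = ⊤
  even : ∀ v ∈ M, ∃ n : ℤ, ‖v‖ ^ 2 = 2 * n
  dual : ∀ x : E, (∀ v ∈ M, ∃ n : ℤ, ⟪x, v⟫ = n) → x ∈ M

lemma EU.inner_int {M : Submodule ℤ E} (h : EU M) {u v : E} (hu : u ∈ M) (hv : v ∈ M) :
    ∃ n : ℤ, ⟪u, v⟫ = n := by
  obtain ⟨a, ha⟩ := h.even u hu
  obtain ⟨b, hb⟩ := h.even v hv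
  obtain ⟨c, hc⟩ := h.even (u + v) (add_mem hu hv)
  refine ⟨c - a - b, ?_⟩
  have := norm_add_sq_real u v
  push_cast
  linarith

lemma EU.data [FiniteDimensional ℝ E] {n : ℕ} (hn : Module.finrank ℝ E = n)
    {M : Submodule ℤ E} (h : EU M) :
    ∃ b d : Module.Basis (Fin n) ℝ E, (∀ i, b i ∈ M) ∧ (∀ i, d i ∈ M) ∧
      (∀ i j, ⟪d i, b j⟫ = if i = j then (1 : ℝ) else 0) ∧
      (∀ v ∈ M, ∃ m : Fin n → ℤ, v = ∑ i, (m i : ℝ) • b i) := by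
  classical
  have := h.disc
  have : IsZLattice ℝ M := ⟨h.span⟩
  have : Module.Free ℤ M := ZLattice.module_free ℝ M
  have : Module.Finite ℤ M := ZLattice.module_finite ℝ M
  let b0 := Module.Free.chooseBasis ℤ M
  have hc : Fintype.card (Module.Free.ChooseBasisIndex ℤ M) = n := by
    rw [← Module.finrank_eq_card_basis b0, ZLattice.rank ℝ M, hn]
  let e := Fintype.equivFinOfCardEq hc
  let b1 : Module.Basis (Fin n) ℤ M := b0.reindex e
  let b : Module.Basis (Fin n) ℝ E := b1.ofZLatticeBasis ℝ M
  have hb : ∀ i, b i = b1 i := fun i => b1.ofZLatticeBasis_apply ℝ M i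
  let B : LinearMap.BilinForm ℝ E := innerₗ E
  have hB : B.Nondegenerate := by
    constructor
    · intro x hx
      have := hx x
      simpa [B] using this
    · intro x hx
      have := hx x
      simpa [B] using this
  let d := B.dualBasis hB b
  have hd : ∀ i j, ⟪d i, b j⟫ = if i = j then (1 : ℝ) else 0 := by
    intro i j
    have := LinearMap.BilinForm.apply_dualBasis_left (B := B) hB b i j
    rw [← show B (d i) (b j) = ⟪d i, b j⟫ from rfl, this]
    simp [eq_comm]
  have hv : ∀ v ∈ M, ∃ m : Fin n → ℤ, v = ∑ i, (m i : ℝ) • b i := by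
    intro v hv
    refine ⟨fun i => b1.repr ⟨v, hv⟩ i, ?_⟩
    have := congrArg (Subtype.val) (b1.sum_repr ⟨v, hv⟩)
    simp only [Submodule.coe_sum, Submodule.coe_smul] at this
    refine this.symm.trans ?_
    refine Finset.sum_congr rfl fun i _ => ?_
    rw [hb]
    exact (Int.cast_smul_eq_zsmul ℝ _ _).symm
  refine ⟨b, d, fun i => by rw [hb]; exact (b1 i).2, fun i => ?_, hd, hv⟩
  apply h.dual
  intro v hvM
  obtain ⟨m, rfl⟩ := hv v hvM
  refine ⟨m i, ?_⟩
  simp only [inner_sum, inner_smul_right, hd]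
  simp

lemma summable_gauss [FiniteDimensional ℝ E] (M : Submodule ℤ E) (hM : DiscreteTopology M)
    (c : ℝ) (hc : 0 < c) (k : ℕ) :
    Summable fun v : M => ‖(v : E)‖ ^ k * Real.exp (-c * ‖(v : E)‖ ^ 2) := by
  set N := Module.finrank ℤ M + 1 with hN
  have hs := ZLattice.summable_norm_pow_inv M N (by omega)
  -- choose j with 2 j ≥ N + k
  have hs2 : Summable fun v : M => ((N + k).factorial / c ^ (N + k) : ℝ) * ‖v‖⁻¹ ^ N := hs.mul_left _
  refine Summable.of_norm_bounded_eventually hs2 ?_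
  have hfin : {v : M | ¬ (1 ≤ ‖(v : E)‖)}.Finite := by
    have : Set.Finite (Metric.ball (0 : E) 1 ∩ (M : Set E)) := by
      have := Metric.finite_isBounded_inter_isClosed (K := Metric.ball (0 : E) 1)
        (s := (M : Set E)) (isDiscrete_iff_discreteTopology.mpr hM) Metric.isBounded_ball
        (AddSubgroup.isClosed_of_discrete (H := M.toAddSubgroup))
      exact this
    refine Set.Finite.of_finite_image (f := Subtype.val) (this.subset ?_) Subtype.val_injective.injOn
    rintro _ ⟨v, hv, rfl⟩
    refine ⟨?_, v.2⟩
    simpa using hv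
  filter_upwards [hfin.compl_mem_cofinite] with v hv
  have hv1 : 1 ≤ ‖(v : E)‖ := by simpa using hv
  set t := ‖(v : E)‖ with ht
  have ht' : ‖v‖ = t := rfl
  rw [ht', Real.norm_of_nonneg (by positivity), neg_mul, Real.exp_neg]
  have h1 : (c * t ^ 2) ^ (N + k) / (N + k).factorial ≤ Real.exp (c * t ^ 2) :=
    Real.pow_div_factorial_le_exp _ (by positivity) _
  have hpos : 0 < (c * t ^ 2) ^ (N + k) / (N + k).factorial := by positivity
  have h2 : (Real.exp (c * t ^ 2))⁻¹ ≤ ((c * t ^ 2) ^ (N + k) / (N + k).factorial)⁻¹ :=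
    inv_anti₀ hpos h1
  calc t ^ k * (Real.exp (c * t ^ 2))⁻¹ ≤ t ^ k * ((c * t ^ 2) ^ (N + k) / (N + k).factorial)⁻¹ := by
        gcongr
    _ = ((N + k).factorial / c ^ (N + k) : ℝ) * (t ^ k * (t ^ (2 * (N + k)))⁻¹) := by
        rw [mul_pow, ← pow_mul]; field_simp
    _ ≤ ((N + k).factorial / c ^ (N + k) : ℝ) * t⁻¹ ^ N := by
        gcongr
        rw [show 2 * (N + k) = k + (N + (N + k)) by ring, pow_add t k, mul_inv, ← mul_assoc,
          mul_inv_cancel₀ (by positivity), one_mul, pow_add, mul_inv, inv_pow]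
        have : (t ^ (N + k))⁻¹ ≤ 1 := inv_le_one_of_one_le₀ (one_le_pow₀ hv1)
        have h0 : 0 ≤ (t ^ N)⁻¹ := by positivity
        nlinarith

section meas
variable [FiniteDimensional ℝ E] [MeasurableSpace E] [BorelSpace E]

lemma EU.integral_eq {n : ℕ} (hn : Module.finrank ℝ E = n)
    {M : Submodule ℤ E} (h : EU M) (b d : Module.Basis (Fin n) ℝ E)
    (hb : ∀ i, b i ∈ M) (hd : ∀ i, d i ∈ M)
    (hbd : ∀ i j, ⟪d i, b j⟫ = if i = j then (1 : ℝ) else 0) :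
    MeasurePreserving (fun x : Fin n → ℝ => ∑ i, x i • b i) := by
  classical
  let o : OrthonormalBasis (Fin n) ℝ E :=
    (stdOrthonormalBasis ℝ E).reindex (finCongr hn)
  let A : Matrix (Fin n) (Fin n) ℝ := Matrix.of fun i j => ⟪o i, b j⟫
  have hAA : ∀ i j, (A.transpose * A) i j = ⟪b i, b j⟫ := by
    intro i j
    simp only [Matrix.mul_apply, Matrix.transpose_apply, A, Matrix.of_apply]
    rw [← o.sum_inner_mul_inner (b i) (b j)]
    simp [real_inner_comm]
  choose g hg using fun i j => h.inner_int (hb i) (hb j)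
  choose q hq using fun i j => h.inner_int (hd i) (hd j)
  have hexp : ∀ x : E, ∑ j, ⟪d j, x⟫ • b j = x := by
    intro x
    conv_rhs => rw [← b.sum_repr x]
    refine Finset.sum_congr rfl fun j _ => ?_
    congr 1
    have : ⟪d j, ∑ i, b.repr x i • b i⟫ = b.repr x j := by
      simp only [inner_sum, inner_smul_right, hbd]
      simp
    rwa [b.sum_repr] at this
  have hprod : (Matrix.of g) * (Matrix.of q) = (1 : Matrix (Fin n) (Fin n) ℤ) := by
    ext i k
    have : ((((Matrix.of g) * (Matrix.of q)) i k : ℤ) : ℝ) = ⟪b i, d k⟫ := by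
      simp only [Matrix.mul_apply, Matrix.of_apply]
      push_cast
      conv_rhs => rw [← hexp (d k)]
      simp only [inner_sum, inner_smul_right, ← hg, ← hq]
      exact Finset.sum_congr rfl fun j _ => mul_comm _ _
    rw [real_inner_comm, hbd] at this
    rw [Matrix.one_apply]
    have h2 : ((((Matrix.of g) * (Matrix.of q)) i k : ℤ) : ℝ) = ((if i = k then 1 else 0 : ℤ) : ℝ) := by
      rw [this]; by_cases hik : i = k <;> simp [hik, eq_comm]
    exact_mod_cast h2
  have hdetg : (Matrix.of g).det = 1 ∨ (Matrix.of g).det = -1 := by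
    have := congrArg Matrix.det hprod
    rw [Matrix.det_mul, Matrix.det_one] at this
    exact Int.isUnit_iff.1 (IsUnit.of_mul_eq_one _ this)
  have hdetA : |A.det| = 1 := by
    have h1 : (A.transpose * A) = (Matrix.of g).map (Int.cast : ℤ → ℝ) := by
      ext i j
      rw [hAA, hg]; simp
    have h2 := congrArg Matrix.det h1
    rw [Matrix.det_mul, Matrix.det_transpose,
      show ((Matrix.of g).map (Int.cast : ℤ → ℝ)).det = (((Matrix.of g).det : ℤ) : ℝ) from
        ((Int.castRingHom ℝ).map_det (Matrix.of g)).symm] at h2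
    rcases hdetg with h3 | h3
    · rw [h3] at h2
      have : A.det ^ 2 = 1 := by rw [sq, h2]; simp
      rw [← sq_abs] at this
      nlinarith [abs_nonneg A.det]
    · rw [h3] at h2
      push_cast at h2
      nlinarith [mul_self_nonneg A.det]
  have hdet0 : A.det ≠ 0 := by
    intro h0; rw [h0] at hdetA; simp at hdetA
  have m1 : MeasurePreserving (Matrix.toLin' A) := by
    refine ⟨(Matrix.toLin' A).continuous_of_finiteDimensional.measurable, ?_⟩
    rw [Real.map_matrix_volume_pi_eq_smul_volume_pi hdet0, abs_inv, hdetA]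
    simp
  have m2 := (o.repr.symm.measurePreserving).comp
    ((PiLp.volume_preserving_toLp (Fin n)).comp m1)
  convert! m2 using 1
  funext x
  simp only [Function.comp_apply]
  apply o.repr.injective
  ext i
  simp [A, Matrix.mulVec, dotProduct, o.repr_apply_apply, inner_sum, inner_smul_right, mul_comm]
end meas
end Cov

end

section
namespace Cov
open MeasureTheory Set Complex
open scoped RealInnerProductSpace

variable {E : Type*} [NormedAddCommGroup E] [InnerProductSpace ℝ E]
  [FiniteDimensional ℝ E]

lemma norm_gauss (τ : ℂ) (t : ℝ) :
    ‖cexp (Real.pi * I * τ * (t : ℂ))‖ = Real.exp (-(Real.pi * τ.im) * t) := by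
  rw [Complex.norm_exp]
  congr 1
  simp [Complex.mul_re, Complex.mul_im]

theorem theta_shift (hn : Module.finrank ℝ E = 24) {M : Submodule ℤ E} (h : EU M)
    (τ : ℂ) (hτ : 0 < τ.im) (x : E) :
    ∑' v : M, cexp (Real.pi * I * τ * ((‖x + (v : E)‖ ^ 2 : ℝ) : ℂ)) =
      (I / τ) ^ 12 * ∑' v : M, cexp (Real.pi * I * (-1 / τ) * ((‖(v : E)‖ ^ 2 : ℝ) : ℂ)) *
        cexp (2 * Real.pi * I * ((⟪(v : E), x⟫ : ℝ) : ℂ)) := by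
  classical
  borelize E
  have hτ0 : τ ≠ 0 := by rintro rfl; simp at hτ
  obtain ⟨b, d, hb, hd, hbd, hrep⟩ := h.data hn
  have hmp := h.integral_eq hn b d hb hd hbd
  set T : (Fin 24 → ℝ) → E := fun x => ∑ i, x i • b i with hT
  have hTc : Continuous T := by fun_prop
  have hTadd : ∀ x y, T (x + y) = T x + T y := by
    intro x y; simp [hT, add_smul, Finset.sum_add_distrib]
  have hexp : ∀ x : E, T (fun j => ⟪d j, x⟫) = x := by
    intro x
    have h2 : ∀ j, ⟪d j, x⟫ = b.repr x j := by
      intro j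
      have : ⟪d j, ∑ i, b.repr x i • b i⟫ = b.repr x j := by
        simp only [inner_sum, inner_smul_right, hbd]
        simp
      rwa [b.sum_repr] at this
    simp only [hT, h2]
    exact b.sum_repr x
  have hTi : ∀ (k : Fin 24 → ℝ) (y : Fin 24 → ℝ), ⟪∑ i, k i • d i, T y⟫ = ∑ i, k i * y i := by
    intro k y
    simp only [hT, sum_inner, inner_sum, inner_smul_left, inner_smul_right, hbd]
    simp [mul_comm]
  have hdT : ∀ y : Fin 24 → ℝ, ∀ j, ⟪d j, T y⟫ = y j := by
    intro y j
    have := hTi (Pi.single j 1) y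
    simpa [Pi.single_apply] using this
  have hTemb : MeasurableEmbedding T := by
    have hinj : Function.Injective T := by
      intro x y hxy
      funext j
      rw [← hdT x, ← hdT y, hxy]
    exact hTc.measurableEmbedding hinj
  -- parametrizations of M
  let f1 : (Fin 24 → ℤ) → M := fun m => ⟨T (fun i => (m i : ℝ)), by
    refine Submodule.sum_mem _ fun i _ => ?_
    rw [Int.cast_smul_eq_zsmul]
    exact M.smul_mem _ (hb i)⟩
  let f2 : (Fin 24 → ℤ) → M := fun m => ⟨∑ i, (m i : ℝ) • d i, by
    refine Submodule.sum_mem _ fun i _ => ?_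
    rw [Int.cast_smul_eq_zsmul]
    exact M.smul_mem _ (hd i)⟩
  have hf1 : Function.Bijective f1 := by
    constructor
    · intro m m' hm
      funext j
      have := congrArg (fun v : M => ⟪d j, (v : E)⟫) hm
      simp only [f1, hdT] at this
      exact_mod_cast this
    · intro v
      obtain ⟨m, hm⟩ := hrep v v.2
      exact ⟨m, Subtype.ext hm.symm⟩
  have hf2 : Function.Bijective f2 := by
    constructor
    · intro m m' hm
      funext j
      have := congrArg (fun v : M => ⟪(v : E), T (Pi.single j 1)⟫) hm
      simp only [f2, hTi] at this
      simp [Pi.single_apply] at this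
      exact_mod_cast this
    · intro v
      choose m hm using fun i => h.inner_int v.2 (hb i)
      refine ⟨m, Subtype.ext ?_⟩
      simp only [f2, ← hm]
      apply ext_inner_right ℝ
      intro y
      rw [← hexp y, hTi]
      simp only [hT, inner_sum, inner_smul_right]
      exact Finset.sum_congr rfl fun i _ => mul_comm _ _
  let e1 := Equiv.ofBijective f1 hf1
  let e2 := Equiv.ofBijective f2 hf2
  set F : (Fin 24 → ℝ) → ℂ := fun y => cexp (Real.pi * I * τ * ((‖T y‖ ^ 2 : ℝ) : ℂ)) with hF
  have hbb : 0 < (-(Real.pi * I * τ)).re := by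
    simp [Complex.mul_re, Complex.mul_im]
    positivity
  set x' : Fin 24 → ℝ := fun j => ⟪d j, x⟫ with hx'
  have hIntg : ∀ k : Fin 24 → ℤ, ∫ y, ee (-k) y * F y =
      (I / τ) ^ 12 * cexp (Real.pi * I * (-1 / τ) * ((‖(f2 k : E)‖ ^ 2 : ℝ) : ℂ)) := by
    intro k
    have h1 := GaussianFourier.integral_cexp_neg_mul_sq_norm_add hbb (-(2 * Real.pi * I)) (f2 k : E)
    rw [← hmp.integral_comp hTemb, hn] at h1
    have h2 : (Real.pi / (-(Real.pi * I * τ)) : ℂ) = I / τ := by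
      have : (Real.pi : ℂ) ≠ 0 := by exact_mod_cast Real.pi_ne_zero
      field_simp
      simp
    rw [h2, show (((24 : ℕ) : ℂ) / 2) = ((12 : ℕ) : ℂ) by norm_num, Complex.cpow_natCast] at h1
    refine Eq.trans ?_ (h1.trans ?_)
    · congr 1
      funext y
      rw [hF, ee, ← Complex.exp_add]
      congr 1
      simp only [f2, hTi]
      push_cast
      simp only [Pi.neg_apply, Int.cast_neg, neg_mul, Finset.sum_neg_distrib]
      ring
    · congr 2
      have : (Real.pi : ℂ) ≠ 0 := by exact_mod_cast Real.pi_ne_zero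
      push_cast
      field_simp
      ring
  have hFc : Continuous F := by fun_prop
  have hFi : Integrable F := by
    have h1 := GaussianFourier.integrable_cexp_neg_mul_sq_norm_add hbb 0 (0 : E)
    rw [← hmp.integrable_comp_emb hTemb] at h1
    refine h1.congr (Filter.Eventually.of_forall fun y => ?_)
    simp [hF]
  have hbd : ∀ R : ℝ, ∃ u : (Fin 24 → ℤ) → ℝ, Summable u ∧
      ∀ x, ‖x‖ ≤ R → ∀ m, ‖F (x + fun i => (m i : ℝ))‖ ≤ u m := by
    intro R
    obtain ⟨C, hC⟩ := (isCompact_closedBall (0 : Fin 24 → ℝ) R).exists_bound_of_continuousOn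
      hTc.continuousOn
    set c := Real.pi * τ.im with hc
    have hcp : 0 < c := by positivity
    have hs := (summable_gauss M h.disc (c / 2) (by positivity) 0)
    refine ⟨fun m => Real.exp (c * C ^ 2) * Real.exp (-(c / 2) * ‖(f1 m : E)‖ ^ 2), ?_, ?_⟩
    · refine Summable.mul_left _ ?_
      have := (e1.summable_iff).2 hs
      simpa [Function.comp_def, e1] using this
    · intro y hy m
      rw [hF]
      simp only
      rw [norm_gauss, ← Real.exp_add]
      apply Real.exp_le_exp.2
      rw [hTadd]
      have h1 : ‖T y‖ ≤ C := hC y (by simpa using hy)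
      have h2 : ‖(f1 m : E)‖ ≤ ‖T y + (f1 m : E)‖ + ‖T y‖ := by
        have := norm_sub_le (T y + (f1 m : E)) (T y)
        simpa using this
      have h3 : ‖(f1 m : E)‖ ^ 2 ≤ 2 * ‖T y + (f1 m : E)‖ ^ 2 + 2 * C ^ 2 := by
        have := norm_nonneg (f1 m : E)
        have := norm_nonneg (T y)
        have := norm_nonneg (T y + (f1 m : E))
        nlinarith [sq_nonneg (‖T y + (f1 m : E)‖ - ‖T y‖), pow_le_pow_left₀ (norm_nonneg (T y)) h1 2,
          pow_le_pow_left₀ (norm_nonneg (f1 m : E)) h2 2]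
      change -c * ‖T y + (f1 m : E)‖ ^ 2 ≤ _
      nlinarith
  have hsum : Summable fun k : Fin 24 → ℤ => ∫ y, ee (-k) y * F y := by
    simp only [hIntg]
    refine Summable.mul_left _ ?_
    have him : 0 < (-1 / τ).im := by
      have : (-1 / τ).im = τ.im / Complex.normSq τ := by
        rw [div_eq_mul_inv, neg_one_mul, Complex.neg_im, Complex.inv_im]; ring
      rw [this]
      exact div_pos hτ (Complex.normSq_pos.2 hτ0)
    have hs := summable_gauss M h.disc (Real.pi * (-1 / τ).im) (by positivity) 0
    refine Summable.of_norm ?_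
    simp only [norm_gauss]
    have := (e2.summable_iff).2 hs
    simpa [Function.comp_def, e2] using this
  have key := poisson_pi F hFc hbd hFi hsum x'
  rw [← e1.tsum_eq, ← e2.tsum_eq, ← tsum_mul_left]
  refine Eq.trans ?_ (key.trans ?_)
  · refine tsum_congr fun m => ?_
    simp only [hF, hTadd, hx', hexp]
    rfl
  · refine tsum_congr fun k => ?_
    rw [hIntg, mul_assoc]
    congr 2
    rw [ee]
    congr 2
    change _ = ((⟪∑ i, (k i : ℝ) • d i, x⟫ : ℝ) : ℂ)
    rw [← hexp x, hTi]
end Cov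

end

section
namespace Cov
open MeasureTheory Set Complex Filter Topology
open scoped RealInnerProductSpace

variable {E : Type*} [NormedAddCommGroup E] [InnerProductSpace ℝ E]

lemma second_deriv {ι : Type*} (F : ι → ℂ → ℂ) (u : ι → ℝ) (hu : Summable u)
    (hd : ∀ i, Differentiable ℂ (F i)) (hb : ∀ i w, ‖w‖ < 2 → ‖F i w‖ ≤ u i) :
    HasSum (fun i => deriv (deriv (F i)) 0) (deriv (deriv fun w => ∑' i, F i w) 0) := by
  have h1 : ∀ z ∈ Metric.ball (0 : ℂ) 2,
      HasSum (fun i => deriv (F i) z) (deriv (fun w => ∑' i, F i w) z) := fun z hz =>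
    hasSum_deriv_of_summable_norm hu (fun i => (hd i).differentiableOn) Metric.isOpen_ball
      (fun i w hw => hb i w (by simpa using hw)) hz
  have h2 : ∀ i, ∀ w ∈ Metric.ball (0 : ℂ) 1, ‖deriv (F i) w‖ ≤ u i / (1 / 2) := by
    intro i w hw
    refine Complex.norm_deriv_le_of_forall_mem_sphere_norm_le (by norm_num)
      (hd i).diffContOnCl fun z hz => hb i z ?_
    have : ‖z - w‖ = 1 / 2 := by simpa using hz
    have h3 : ‖w‖ < 1 := by simpa using hw
    have := norm_add_le (z - w) w
    simp only [sub_add_cancel] at this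
    linarith
  have h3 := hasSum_deriv_of_summable_norm (F := fun i => deriv (F i)) (hu.div_const (1 / 2))
    (fun i => ((hd i).deriv).differentiableOn) Metric.isOpen_ball h2
    (Metric.mem_ball_self (x := (0 : ℂ)) one_pos)
  have h4 : (fun w => ∑' i, deriv (F i) w) =ᶠ[𝓝 0] deriv (fun w => ∑' i, F i w) := by
    filter_upwards [Metric.ball_mem_nhds (0 : ℂ) two_pos] with z hz
    exact (h1 z hz).tsum_eq
  rwa [h4.deriv_eq] at h3

/-- The shifted Gaussian with complex shift parameter. -/
def Gs (τ a β : ℂ) (y v : E) (s : ℂ) : ℂ :=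
  cexp (Real.pi * I * τ * ((‖v‖ ^ 2 : ℝ) : ℂ) + a * ((⟪v, y⟫ : ℝ) : ℂ) * s + β * s ^ 2)

lemma Gs_deriv (τ a β : ℂ) (y v : E) (s : ℂ) :
    HasDerivAt (Gs τ a β y v) (Gs τ a β y v s * (a * ((⟪v, y⟫ : ℝ) : ℂ) + β * (2 * s))) s := by
  unfold Gs
  refine HasDerivAt.cexp ?_
  have h1 : HasDerivAt (fun s : ℂ => a * ((⟪v, y⟫ : ℝ) : ℂ) * s) (a * ((⟪v, y⟫ : ℝ) : ℂ)) s := by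
    simpa using (hasDerivAt_id s).const_mul (a * ((⟪v, y⟫ : ℝ) : ℂ))
  have h2 : HasDerivAt (fun s : ℂ => β * s ^ 2) (β * (2 * s)) s := by
    simpa using (hasDerivAt_pow 2 s).const_mul β
  have h3 := (h1.const_add (Real.pi * I * τ * ((‖v‖ ^ 2 : ℝ) : ℂ))).add h2
  exact h3

lemma Gs_deriv2 (τ a β : ℂ) (y v : E) :
    deriv (deriv (Gs τ a β y v)) 0 =
      (a ^ 2 * ((⟪v, y⟫ ^ 2 : ℝ) : ℂ) + 2 * β) * cexp (Real.pi * I * τ * ((‖v‖ ^ 2 : ℝ) : ℂ)) := by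
  have h1 : deriv (Gs τ a β y v) =
      fun s => Gs τ a β y v s * (a * ((⟪v, y⟫ : ℝ) : ℂ) + β * (2 * s)) :=
    funext fun s => (Gs_deriv τ a β y v s).deriv
  have h2 : HasDerivAt (fun s : ℂ => a * ((⟪v, y⟫ : ℝ) : ℂ) + β * (2 * s)) (β * 2) 0 := by
    have := (((hasDerivAt_id (0 : ℂ)).const_mul 2).const_mul β).const_add (a * ((⟪v, y⟫ : ℝ) : ℂ))
    simpa using this
  rw [h1, HasDerivAt.deriv (f := fun s => Gs τ a β y v s * (a * ((⟪v, y⟫ : ℝ) : ℂ) + β * (2 * s)))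
    ((Gs_deriv τ a β y v 0).mul h2)]
  simp [Gs]
  ring

lemma Gs_bound (τ a β : ℂ) (y v : E) (hτ : 0 < τ.im) (s : ℂ) (hs : ‖s‖ < 2) :
    ‖Gs τ a β y v s‖ ≤ Real.exp ((2 * ‖a‖ * ‖y‖) ^ 2 / (2 * (Real.pi * τ.im)) + 4 * ‖β‖) *
      Real.exp (-(Real.pi * τ.im / 2) * ‖v‖ ^ 2) := by
  unfold Gs
  rw [add_assoc, Complex.exp_add, norm_mul, norm_gauss, ← Real.exp_add]
  set c := Real.pi * τ.im with hc
  have hcp : 0 < c := by positivity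
  have h1 : ‖cexp (a * ((⟪v, y⟫ : ℝ) : ℂ) * s + β * s ^ 2)‖ ≤
      Real.exp (2 * ‖a‖ * ‖y‖ * ‖v‖ + 4 * ‖β‖) := by
    rw [Complex.norm_exp]
    apply Real.exp_le_exp.2
    refine (Complex.re_le_norm _).trans ((norm_add_le _ _).trans ?_)
    have h2 : ‖((⟪v, y⟫ : ℝ) : ℂ)‖ ≤ ‖v‖ * ‖y‖ := by
      rw [Complex.norm_real]; exact norm_inner_le_norm v y
    rw [norm_mul, norm_mul, norm_mul, norm_pow]
    have h3 : ‖s‖ ^ 2 ≤ 4 := by nlinarith [norm_nonneg s]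
    have h4 : ‖a‖ * ‖((⟪v, y⟫ : ℝ) : ℂ)‖ * ‖s‖ ≤ ‖a‖ * (‖v‖ * ‖y‖) * 2 := by gcongr
    have h5 : ‖β‖ * ‖s‖ ^ 2 ≤ ‖β‖ * 4 := by gcongr
    linarith
  calc _ ≤ Real.exp (-c * ‖v‖ ^ 2) * Real.exp (2 * ‖a‖ * ‖y‖ * ‖v‖ + 4 * ‖β‖) := by gcongr
    _ ≤ _ := by
      rw [← Real.exp_add]
      apply Real.exp_le_exp.2
      have h6 : (2 * ‖a‖ * ‖y‖) * ‖v‖ ≤ (2 * ‖a‖ * ‖y‖) ^ 2 / (2 * c) + c / 2 * ‖v‖ ^ 2 := by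
        have := sq_nonneg ((2 * ‖a‖ * ‖y‖) - c * ‖v‖)
        rw [div_add' _ _ _ (by positivity), le_div_iff₀ (by positivity)]
        nlinarith
      linarith

variable [FiniteDimensional ℝ E]

lemma Gs_summable {M : Submodule ℤ E} (h : EU M) (τ a β : ℂ) (hτ : 0 < τ.im) (y : E) :
    HasSum (fun v : M => (a ^ 2 * ((⟪(v : E), y⟫ ^ 2 : ℝ) : ℂ) + 2 * β) *
      cexp (Real.pi * I * τ * ((‖(v : E)‖ ^ 2 : ℝ) : ℂ)))
      (deriv (deriv fun s => ∑' v : M, Gs τ a β y (v : E) s) 0) ∧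
    AnalyticAt ℂ (fun s => ∑' v : M, Gs τ a β y (v : E) s) 0 := by
  have hs := (summable_gauss M h.disc (Real.pi * τ.im / 2) (by positivity) 0).mul_left
    (Real.exp ((2 * ‖a‖ * ‖y‖) ^ 2 / (2 * (Real.pi * τ.im)) + 4 * ‖β‖))
  simp only [pow_zero, one_mul] at hs
  have hd : ∀ v : M, Differentiable ℂ (Gs τ a β y (v : E)) := fun v s =>
    (Gs_deriv τ a β y v s).differentiableAt
  constructor
  · have := second_deriv (fun v : M => Gs τ a β y (v : E)) _ hs hd
      (fun v s hs => Gs_bound τ a β y v hτ s hs)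
    simpa only [Gs_deriv2] using this
  · have := differentiableOn_tsum_of_summable_norm hs (U := Metric.ball 0 2)
      (fun v => (hd v).differentiableOn) Metric.isOpen_ball
      (fun v s hs => Gs_bound τ a β y v hτ s (by simpa using hs))
    exact this.analyticAt (Metric.ball_mem_nhds _ two_pos)

/-- Theta series. -/
def th0 (M : Submodule ℤ E) (τ : ℂ) : ℂ :=
  ∑' v : M, cexp (Real.pi * I * τ * ((‖(v : E)‖ ^ 2 : ℝ) : ℂ))

/-- Theta series with quadratic weight. -/
def th2 (M : Submodule ℤ E) (y : E) (τ : ℂ) : ℂ :=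
  ∑' v : M, ((⟪(v : E), y⟫ ^ 2 : ℝ) : ℂ) * cexp (Real.pi * I * τ * ((‖(v : E)‖ ^ 2 : ℝ) : ℂ))

lemma th0_summable {M : Submodule ℤ E} (h : EU M) (τ : ℂ) (hτ : 0 < τ.im) :
    Summable fun v : M => cexp (Real.pi * I * τ * ((‖(v : E)‖ ^ 2 : ℝ) : ℂ)) := by
  have := (Gs_summable h τ 0 (1 / 2) hτ 0).1.summable
  simpa using this

lemma th2_summable {M : Submodule ℤ E} (h : EU M) (y : E) (τ : ℂ) (hτ : 0 < τ.im) :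
    Summable fun v : M => ((⟪(v : E), y⟫ ^ 2 : ℝ) : ℂ) *
      cexp (Real.pi * I * τ * ((‖(v : E)‖ ^ 2 : ℝ) : ℂ)) := by
  have := (Gs_summable h τ 1 0 hτ y).1.summable
  simpa using this

lemma im_inv {τ : ℂ} (hτ : 0 < τ.im) : 0 < (-1 / τ).im := by
  have hτ0 : τ ≠ 0 := by rintro rfl; simp at hτ
  have : (-1 / τ).im = τ.im / Complex.normSq τ := by
    rw [div_eq_mul_inv, neg_one_mul, Complex.neg_im, Complex.inv_im]; ring
  rw [this]
  exact div_pos hτ (Complex.normSq_pos.2 hτ0)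

lemma I12 (τ : ℂ) : (I / τ) ^ 12 = (τ ^ 12)⁻¹ := by
  rw [div_pow, show I ^ 12 = (I ^ 2) ^ 6 by ring, I_sq]
  norm_num

theorem th0_S (hn : Module.finrank ℝ E = 24) {M : Submodule ℤ E} (h : EU M)
    (τ : ℂ) (hτ : 0 < τ.im) : th0 M (-1 / τ) = τ ^ 12 * th0 M τ := by
  have hτ0 : τ ≠ 0 := by rintro rfl; simp at hτ
  have := theta_shift hn h τ hτ 0
  simp only [zero_add, inner_zero_right, ofReal_zero, mul_zero, Complex.exp_zero, mul_one] at this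
  change th0 M τ = _ * th0 M (-1 / τ) at this
  rw [this, I12]
  field_simp

theorem th2_S (hn : Module.finrank ℝ E = 24) {M : Submodule ℤ E} (h : EU M) (y : E)
    (τ : ℂ) (hτ : 0 < τ.im) :
    th2 M y (-1 / τ) = τ ^ 14 * th2 M y τ - (I * τ ^ 13 / (2 * Real.pi)) * ‖y‖ ^ 2 * th0 M τ := by
  have hτ0 : τ ≠ 0 := by rintro rfl; simp at hτ
  have hπ : (Real.pi : ℂ) ≠ 0 := by exact_mod_cast Real.pi_ne_zero
  obtain ⟨hL, aL⟩ := Gs_summable h τ (2 * Real.pi * I * τ) (Real.pi * I * τ * ‖y‖ ^ 2) hτ y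
  obtain ⟨hR, aR⟩ := Gs_summable h (-1 / τ) (2 * Real.pi * I) 0 (im_inv hτ) y
  set fL := fun s => ∑' v : M, Gs τ (2 * Real.pi * I * τ) (Real.pi * I * τ * ‖y‖ ^ 2) y (v : E) s
  set fR := fun s => ∑' v : M, Gs (-1 / τ) (2 * Real.pi * I) 0 y (v : E) s
  have hreal : ∀ s : ℝ, fL s = (I / τ) ^ 12 * fR s := by
    intro s
    have := theta_shift hn h τ hτ (s • y)
    refine Eq.trans ?_ (this.trans ?_)
    · refine tsum_congr fun v => ?_
      rw [Gs]
      congr 1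
      have h1 : ‖s • y + (v : E)‖ ^ 2 = ‖(v : E)‖ ^ 2 + 2 * s * ⟪(v : E), y⟫ + s ^ 2 * ‖y‖ ^ 2 := by
        rw [norm_add_sq_real, norm_smul, inner_smul_left, real_inner_comm]
        simp [mul_pow]
        ring
      rw [h1]
      push_cast
      ring
    · congr 1
      refine tsum_congr fun v => ?_
      rw [Gs, ← Complex.exp_add]
      congr 1
      rw [inner_smul_right]
      push_cast
      ring
  have hfreq : ∃ᶠ z in 𝓝[≠] (0 : ℂ), fL z = (I / τ) ^ 12 * fR z := by
    have ht : Tendsto (fun s : ℝ => (s : ℂ)) (𝓝[≠] 0) (𝓝[≠] 0) := by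
      refine tendsto_nhdsWithin_iff.2 ⟨?_, ?_⟩
      · have : Tendsto (fun s : ℝ => (s : ℂ)) (𝓝 0) (𝓝 ((0 : ℝ) : ℂ)) :=
          Complex.continuous_ofReal.tendsto 0
        simp only [ofReal_zero] at this
        exact this.mono_left nhdsWithin_le_nhds
      · filter_upwards [self_mem_nhdsWithin] with s hs
        simpa using hs
    exact ht.frequently (Eventually.of_forall (f := 𝓝[≠] (0 : ℝ)) hreal).frequently
  have hev : fL =ᶠ[𝓝 0] fun z => (I / τ) ^ 12 * fR z :=
    (aL.frequently_eq_iff_eventually_eq (analyticAt_const.mul aR)).1 hfreq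
  have hdd := hev.deriv.deriv_eq
  have hc2 : deriv (deriv fun z => (I / τ) ^ 12 * fR z) 0 = (I / τ) ^ 12 * deriv (deriv fR) 0 := by
    simp only [deriv_const_mul_field']
  rw [hc2, ← hL.tsum_eq, ← hR.tsum_eq] at hdd
  have e1 : ∀ σ : ℂ, 0 < σ.im → ∀ a β : ℂ, ∑' v : M, (a ^ 2 * ((⟪(v : E), y⟫ ^ 2 : ℝ) : ℂ) + 2 * β) *
      cexp (Real.pi * I * σ * ((‖(v : E)‖ ^ 2 : ℝ) : ℂ)) = a ^ 2 * th2 M y σ + 2 * β * th0 M σ := by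
    intro σ hσ a β
    rw [th2, th0, ← tsum_mul_left, ← tsum_mul_left,
      ← ((th2_summable h y σ hσ).mul_left _).tsum_add ((th0_summable h σ hσ).mul_left _)]
    exact tsum_congr fun v => by ring
  rw [e1 τ hτ, e1 (-1 / τ) (im_inv hτ), I12] at hdd
  have hI : I ^ 2 = -1 := I_sq
  generalize th2 M y (-1 / τ) = A' at *
  generalize th0 M (-1 / τ) = B' at *
  have h7 : (Real.pi : ℂ) * (2 * Real.pi) * A' = (Real.pi : ℂ) * (2 * Real.pi) *
      (τ ^ 14 * th2 M y τ - (I * τ ^ 13 / (2 * Real.pi)) * ‖y‖ ^ 2 * th0 M τ) := by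
    have e2 : (Real.pi : ℂ) * (2 * Real.pi) *
      (τ ^ 14 * th2 M y τ - (I * τ ^ 13 / (2 * Real.pi)) * ‖y‖ ^ 2 * th0 M τ) =
      2 * (Real.pi : ℂ) ^ 2 * τ ^ 14 * th2 M y τ - Real.pi * I * τ ^ 13 * ‖y‖ ^ 2 * th0 M τ := by
      have : (Real.pi : ℂ) * (2 * Real.pi) * (I * τ ^ 13 / (2 * Real.pi)) = Real.pi * I * τ ^ 13 := by
        field_simp
      linear_combination (-(‖y‖ : ℂ) ^ 2 * th0 M τ) * this
    have e3 := congrArg (fun z => τ ^ 12 * z) hdd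
    beta_reduce at e3
    rw [mul_inv_cancel_left₀ (pow_ne_zero 12 hτ0)] at e3
    rw [e2]
    linear_combination e3 / 2 + (2 * Real.pi ^ 2 * A' - 2 * Real.pi ^ 2 * τ ^ 14 * th2 M y τ) * hI
  exact mul_left_cancel₀ (by simp [hπ]) h7
end Cov

end

section
namespace Cov
open UpperHalfPlane ModularForm SlashInvariantForm SlashInvariantFormClass ModularFormClass
  MatrixGroups EisensteinSeries Filter
open scoped Topology Manifold

/-- Constructing modular forms of level one out of `q`-expansions. -/
theorem mkMF (f : ℂ → ℂ) (k : ℕ) (c : ℕ → ℂ)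
    (hc : ∀ τ : ℂ, 0 < τ.im → HasSum (fun m => c m * (Function.Periodic.qParam 1 τ) ^ m) (f τ))
    (hS : ∀ τ : ℂ, 0 < τ.im → f (-1 / τ) = τ ^ k * f τ) :
    ∃ F : ModularForm 𝒮ℒ (k : ℤ), ∀ m, (qExpansion 1 F).coeff m = c m := by
  have hsum : ∀ τ : ℍ, HasSum (fun m => c m • (Function.Periodic.qParam 1 τ) ^ m) (f τ) :=
    fun τ => hc τ τ.im_pos
  have hqd : ∀ τ : ℂ, HasSum (fun m => c m * (Function.Periodic.qParam 1 (τ + 1)) ^ m)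
      (f τ) ↔ HasSum (fun m => c m * (Function.Periodic.qParam 1 τ) ^ m) (f τ) := by
    intro τ
    have : Function.Periodic.qParam 1 (τ + 1) = Function.Periodic.qParam 1 τ := by
      have := Complex.exp_periodic (2 * Real.pi * Complex.I * τ)
      simp only [Function.Periodic.qParam, Complex.ofReal_one, div_one]
      rw [← this]
      ring_nf
    rw [this]
  have hT : (fun τ : ℍ => f τ) ∣[(k : ℤ)] ModularGroup.T = fun τ : ℍ => f τ := by
    ext z
    rw [SL_slash_apply, modular_T_smul, show denom (ModularGroup.T : GL (Fin 2) ℝ) z = 1 by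
      rw [ModularGroup.denom_apply, ModularGroup.coe_T]
      simp]
    have h1 : f (z + 1) = f z := by
      have := (hqd z).2 (hc z z.im_pos)
      exact (hc (z + 1) (by simpa using z.im_pos)).unique this
    simp [add_comm, h1] 
  have hS' : (fun τ : ℍ => f τ) ∣[(k : ℤ)] ModularGroup.S = fun τ : ℍ => f τ := by
    ext z
    rw [SL_slash_apply, UpperHalfPlane.modular_S_smul]
    have := hS z z.im_pos
    have hz := z.ne_zero
    rw [neg_div, one_div] at this
    rw [ModularGroup.denom_S]
    simp [this]
    field_simp
  have hb : IsBoundedAtImInfty (fun τ : ℍ => f τ) :=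
    isBoundedAtImInfty_of_hasSum_qExpansion one_pos hsum
  have hg : DifferentiableOn ℂ (fun q : ℂ => ∑' m, c m * q ^ m) (Metric.ball 0 1) := by
    have key : ∀ r : ℝ, 0 < r → r < 1 →
        DifferentiableOn ℂ (fun q : ℂ => ∑' m, c m * q ^ m) (Metric.ball 0 r) := by
      intro r hr0 hr1
      obtain ⟨τ, hτ, hq⟩ : ∃ τ : ℂ, 0 < τ.im ∧ ‖Function.Periodic.qParam 1 τ‖ = r := by
        refine ⟨Complex.I * ((-Real.log r / (2 * Real.pi) : ℝ)), ?_, ?_⟩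
        · rw [Complex.mul_im]
          simp only [Complex.I_re, Complex.I_im, Complex.ofReal_re, Complex.ofReal_im, zero_mul,
            one_mul, zero_add]
          have := Real.log_neg hr0 hr1
          have := Real.pi_pos
          apply div_pos <;> linarith
        · rw [Function.Periodic.norm_qParam, Complex.mul_im]
          simp only [Complex.I_re, Complex.I_im, Complex.ofReal_re, Complex.ofReal_im, zero_mul,
            one_mul, zero_add]
          have := Real.pi_pos
          rw [show -2 * Real.pi * (-Real.log r / (2 * Real.pi)) / 1 = Real.log r by field_simp,
            Real.exp_log hr0]
      have hs := (hc τ hτ).summable.norm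
      simp only [norm_mul, norm_pow, hq] at hs
      refine Complex.differentiableOn_tsum_of_summable_norm hs (fun m => by fun_prop) Metric.isOpen_ball ?_
      intro m w hw
      rw [norm_mul, norm_pow]
      have : ‖w‖ < r := by simpa using hw
      gcongr
    intro q hq
    have hq1 : ‖q‖ < 1 := by simpa using hq
    obtain ⟨r, h1, h2⟩ := exists_between hq1
    have := (key r (lt_of_le_of_lt (norm_nonneg _) h1) h2).differentiableAt
      (Metric.isOpen_ball.mem_nhds (show q ∈ Metric.ball 0 r by simpa using h1))
    exact this.differentiableWithinAt
  have hmd : MDiff (fun τ : ℍ => f τ) := by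
    rw [UpperHalfPlane.mdifferentiable_iff]
    have h1 : DifferentiableOn ℂ (fun z : ℂ => ∑' m, c m * (Function.Periodic.qParam 1 z) ^ m)
        {z | 0 < z.im} := by
      refine hg.comp (t := Metric.ball 0 1) (f := Function.Periodic.qParam 1) ?_ ?_
      · exact (Function.Periodic.differentiable_qParam).differentiableOn
      · intro z hz
        simpa using Function.Periodic.norm_qParam_lt_one one_pos hz
    refine h1.congr fun z hz => ?_
    simp only [Function.comp_apply, ofComplex_apply_of_im_pos hz]
    exact (hc z hz).tsum_eq.symm
  let F : ModularForm 𝒮ℒ (k : ℤ) :=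
    { toFun := fun τ : ℍ => f τ
      slash_action_eq' := by
        intro A hA
        obtain ⟨A, rfl⟩ := hA
        exact slash_action_generators_SL2Z hS' hT A
      holo' := hmd
      bdd_at_cusps' := by
        intro c hc
        rw [Subgroup.IsArithmetic.isCusp_iff_isCusp_SL2Z] at hc
        rw [OnePoint.isBoundedAt_iff_forall_SL2Z hc]
        intro γ _
        rw [slash_action_generators_SL2Z hS' hT]
        exact hb }
  refine ⟨F, fun m => ?_⟩
  exact (ModularFormClass.qExpansion_coeff_unique one_pos one_mem_strictPeriods_SL
    (f := F) hsum m).symm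

theorem weight14 (G : ModularForm 𝒮ℒ ((14 : ℕ) : ℤ)) (h0 : (qExpansion 1 G).coeff 0 = 0) : G = 0 := by
  suffices CuspForm.discriminantEquiv (toCuspForm G h0) = 0 by
    simpa [CuspForm.discriminantEquiv.map_eq_zero_iff, DFunLike.ext_iff]
  have h2 := rank_zero_iff_forall_zero.mp levelOne_weight_two_rank_zero
  rw [← mcast_eq_zero_iff (b := 2) (by norm_num) rfl]
  exact h2 _

theorem weight12 (F : ModularForm 𝒮ℒ ((12 : ℕ) : ℤ)) (h0 : (qExpansion 1 F).coeff 0 = 1)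
    (h1 : (qExpansion 1 F).coeff 1 = 0) :
    (qExpansion 1 F).coeff 2 = 196560 ∧ (qExpansion 1 F).coeff 3 = 16773120 ∧
    (qExpansion 1 F).coeff 4 = 398034000 := by
  let G : ModularForm 𝒮ℒ ((12 : ℕ) : ℤ) :=
    (7 / 12 : ℂ) • ModularForm.mcast (by decide) (E₄.pow 3) +
      (5 / 12 : ℂ) • ModularForm.mcast (by decide) (E₆.pow 2)
  have hG : qExpansion 1 G = (7 / 12 : ℂ) • (qExpansion 1 E₄ * (qExpansion 1 E₄ * qExpansion 1 E₄)) +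
      (5 / 12 : ℂ) • (qExpansion 1 E₆ * qExpansion 1 E₆) := by
    rw [show (G : ℍ → ℂ) = ⇑((7 / 12 : ℂ) • ModularForm.mcast (by decide) (E₄.pow 3) :
      ModularForm 𝒮ℒ ((12 : ℕ) : ℤ)) + ⇑((5 / 12 : ℂ) • ModularForm.mcast (by decide) (E₆.pow 2) :
      ModularForm 𝒮ℒ ((12 : ℕ) : ℤ)) from rfl,
      ModularForm.qExpansion_add one_pos one_mem_strictPeriods_SL]
    simp only [FunLike.coe_smul, 
      ModularForm.qExpansion_smul one_pos one_mem_strictPeriods_SL, coe_mcast,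
      ModularForm.qExpansion_pow one_pos one_mem_strictPeriods_SL]
    ring_nf
  have b4 : bernoulli 4 = -1 / 30 := by decide +kernel
  have b6 : bernoulli 6 = 1 / 42 := by decide +kernel
  have a0 : (qExpansion 1 E₄).coeff 0 = 1 := E_qExpansion_coeff_zero _ ⟨2, rfl⟩
  have a1 : (qExpansion 1 E₄).coeff 1 = 240 := E₄_qExpansion_coeff_one
  have s2 : ArithmeticFunction.sigma 3 2 = 9 := by decide +kernel
  have s3 : ArithmeticFunction.sigma 3 3 = 28 := by decide +kernel
  have s4 : ArithmeticFunction.sigma 3 4 = 73 := by decide +kernel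
  have t2 : ArithmeticFunction.sigma 5 2 = 33 := by decide +kernel
  have t3 : ArithmeticFunction.sigma 5 3 = 244 := by decide +kernel
  have t4 : ArithmeticFunction.sigma 5 4 = 1057 := by decide +kernel
  have a2 : (qExpansion 1 E₄).coeff 2 = 2160 := by norm_num [E_qExpansion_coeff _ ⟨2, rfl⟩, b4, s2]
  have a3 : (qExpansion 1 E₄).coeff 3 = 6720 := by norm_num [E_qExpansion_coeff _ ⟨2, rfl⟩, b4, s3]
  have a4 : (qExpansion 1 E₄).coeff 4 = 17520 := by norm_num [E_qExpansion_coeff _ ⟨2, rfl⟩, b4, s4]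
  have c0 : (qExpansion 1 E₆).coeff 0 = 1 := E_qExpansion_coeff_zero _ ⟨3, rfl⟩
  have c1 : (qExpansion 1 E₆).coeff 1 = -504 := E₆_qExpansion_coeff_one
  have c2 : (qExpansion 1 E₆).coeff 2 = -504 * 33 := by norm_num [E_qExpansion_coeff _ ⟨3, rfl⟩, b6, t2]
  have c3 : (qExpansion 1 E₆).coeff 3 = -504 * 244 := by norm_num [E_qExpansion_coeff _ ⟨3, rfl⟩, b6, t3]
  have c4 : (qExpansion 1 E₆).coeff 4 = -504 * 1057 := by norm_num [E_qExpansion_coeff _ ⟨3, rfl⟩, b6, t4]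
  have e0 : (qExpansion 1 G).coeff 0 = 1 := by
    rw [hG]
    norm_num [PowerSeries.coeff_mul, Finset.Nat.antidiagonal_succ, a0, c0, 
      -PowerSeries.coeff_zero_eq_constantCoeff]
  have e1 : (qExpansion 1 G).coeff 1 = 0 := by
    rw [hG]
    norm_num [PowerSeries.coeff_mul, Finset.Nat.antidiagonal_succ, a0, c0, a1, c1,
      -PowerSeries.coeff_zero_eq_constantCoeff]
  have e2 : (qExpansion 1 G).coeff 2 = 196560 := by
    rw [hG]
    norm_num [PowerSeries.coeff_mul, Finset.Nat.antidiagonal_succ, a0, c0, a1, c1, a2, c2,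
      -PowerSeries.coeff_zero_eq_constantCoeff]
  have e3 : (qExpansion 1 G).coeff 3 = 16773120 := by
    rw [hG]
    norm_num [PowerSeries.coeff_mul, Finset.Nat.antidiagonal_succ, a0, c0, a1, c1, a2, c2, a3, c3,
      -PowerSeries.coeff_zero_eq_constantCoeff]
  have e4 : (qExpansion 1 G).coeff 4 = 398034000 := by
    rw [hG]
    norm_num [PowerSeries.coeff_mul, Finset.Nat.antidiagonal_succ, a0, c0, a1, c1, a2, c2, a3, c3,
      a4, c4, -PowerSeries.coeff_zero_eq_constantCoeff]
  have hFG : F - G = 0 := by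
    apply sturm_bound_levelOne_nat
    have : ∀ i < 2, (qExpansion 1 ⇑(F - G)).coeff i = 0 := by
      intro i hi
      rw [FunLike.coe_sub, ModularForm.qExpansion_sub one_pos one_mem_strictPeriods_SL, map_sub]
      interval_cases i
      · rw [h0, e0, sub_self]
      · rw [h1, e1, sub_self]
    have h2 := PowerSeries.le_order (qExpansion 1 ⇑(F - G)) 2
      (fun i hi => this i (by exact_mod_cast hi))
    refine lt_of_lt_of_le ?_ h2
    norm_num
  rw [sub_eq_zero.1 hFG]
  exact ⟨e2, e3, e4⟩
end Cov

end

section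
namespace Cov
open Complex
open scoped RealInnerProductSpace

variable {E : Type*} [NormedAddCommGroup E] [InnerProductSpace ℝ E]

/-- Half norm of lattice vectors. -/
def hN (M : Submodule ℤ E) (v : M) : ℕ := ⌊‖(v : E)‖ ^ 2 / 2⌋₊

lemma hN_spec {M : Submodule ℤ E} (h : EU M) (v : M) : ‖(v : E)‖ ^ 2 = 2 * (hN M v : ℕ) := by
  obtain ⟨n, hn⟩ := h.even v v.2
  have h0 : 0 ≤ n := by
    have : (0 : ℝ) ≤ n := by nlinarith [sq_nonneg ‖(v : E)‖]
    exact_mod_cast this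
  lift n to ℕ using h0
  have h1 : hN M v = n := by
    unfold hN
    rw [hn, Int.cast_natCast, mul_div_cancel_left₀ _ (two_ne_zero' ℝ), Nat.floor_natCast]
  rw [hn, h1, Int.cast_natCast]

lemma hN_eq {M : Submodule ℤ E} (h : EU M) (v : M) (m : ℕ) : hN M v = m ↔ ‖(v : E)‖ ^ 2 = 2 * m := by
  rw [hN_spec h v]
  constructor
  · rintro rfl; rfl
  · intro h
    have : (hN M v : ℝ) = m := by linarith
    exact_mod_cast this

lemma sphere_finite [FiniteDimensional ℝ E] {M : Submodule ℤ E} (h : EU M) (m : ℝ) :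
    {v : E | v ∈ M ∧ ‖v‖ ^ 2 = m}.Finite := by
  have hs := summable_gauss M h.disc 1 one_pos 0
  have := hs.tendsto_cofinite_zero
  have h1 := (this.eventually (gt_mem_nhds (Real.exp_pos (-1 * m))))
  simp only [pow_zero, one_mul] at h1
  rw [Filter.eventually_cofinite] at h1
  have h2 := h1.image (fun v : M => (v : E))
  refine h2.subset ?_
  rintro v ⟨hv, hm⟩
  refine ⟨⟨v, hv⟩, ?_, rfl⟩
  simp [hm]

lemma ball_finite [FiniteDimensional ℝ E] {M : Submodule ℤ E} (h : EU M) (m : ℝ) :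
    {v : E | v ∈ M ∧ ‖v‖ ^ 2 ≤ m}.Finite := by
  have hs := summable_gauss M h.disc 1 one_pos 0
  have := hs.tendsto_cofinite_zero
  have h1 := (this.eventually (gt_mem_nhds (Real.exp_pos (-1 * m))))
  simp only [pow_zero, one_mul] at h1
  rw [Filter.eventually_cofinite] at h1
  have h2 := h1.image (fun v : M => (v : E))
  refine h2.subset ?_
  rintro v ⟨hv, hm⟩
  refine ⟨⟨v, hv⟩, ?_, rfl⟩
  simp [hm]

lemma theta_fib {M : Submodule ℤ E} (h : EU M) (P : M → ℂ) (τ : ℂ) (s : ℂ)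
    (hs : HasSum (fun v : M => P v * cexp (Real.pi * I * τ * ((‖(v : E)‖ ^ 2 : ℝ) : ℂ))) s) :
    HasSum (fun m : ℕ => (∑' v : (hN M) ⁻¹' {m}, P v) * (Function.Periodic.qParam 1 τ) ^ m) s := by
  have := hs.tsum_fiberwise (hN M)
  refine this.congr_fun ?_ |> fun h => h
  intro m
  rw [← tsum_mul_right]
  refine tsum_congr fun v => ?_
  have hv : ‖((v : M) : E)‖ ^ 2 = 2 * m := (hN_eq h v m).1 v.2
  rw [hv, Function.Periodic.qParam, ← Complex.exp_nat_mul]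
  congr 2
  push_cast
  ring

variable [FiniteDimensional ℝ E]

theorem counts (hn : Module.finrank ℝ E = 24) {M : Submodule ℤ E} (h : EU M)
    (h2 : ∀ v ∈ M, ‖v‖ ^ 2 ≠ 2) :
    Nat.card {v : M // ‖(v : E)‖ ^ 2 = 4} = 196560 ∧ Nat.card {v : M // ‖(v : E)‖ ^ 2 = 6} = 16773120 ∧
    Nat.card {v : M // ‖(v : E)‖ ^ 2 = 8} = 398034000 := by
  obtain ⟨F, hF⟩ := mkMF (th0 M) 12 (fun m => ∑' v : (hN M) ⁻¹' {m}, (1 : ℂ))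
    (fun τ hτ => by
      have := (th0_summable h τ hτ).hasSum
      refine theta_fib h (fun _ => 1) τ _ ?_
      simp only [one_mul]
      exact this)
    (fun τ hτ => th0_S hn h τ hτ)
  have hcard : ∀ m : ℕ, ∀ r : ℝ, r = 2 * m →
      (∑' v : (hN M) ⁻¹' {m}, (1 : ℂ)) = Nat.card {v : M // ‖(v : E)‖ ^ 2 = r} := by
    intro m r hr
    rw [tsum_const, nsmul_eq_mul, mul_one]
    congr 1
    refine Nat.card_congr (Equiv.subtypeEquivRight fun v => ?_)
    rw [hr]
    exact hN_eq h v m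
  have h0 : Nat.card {v : M // ‖(v : E)‖ ^ 2 = 0} = 1 := by
    rw [Nat.card_eq_one_iff_unique]
    refine ⟨⟨fun a b => ?_⟩, ⟨⟨0, by simp⟩⟩⟩
    obtain ⟨⟨a, ha'⟩, ha⟩ := a
    obtain ⟨⟨b, hb'⟩, hb⟩ := b
    simp only [ne_eq, OfNat.ofNat_ne_zero, not_false_eq_true, pow_eq_zero_iff, norm_eq_zero] at ha hb
    subst ha hb
    rfl
  have h1 : Nat.card {v : M // ‖(v : E)‖ ^ 2 = 2} = 0 := by
    rw [Nat.card_eq_zero]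
    exact Or.inl ⟨fun v => h2 v v.1.2 v.2⟩
  obtain ⟨a, b, c⟩ := weight12 F (by rw [hF, hcard 0 0 (by norm_num), h0]; norm_num)
    (by rw [hF, hcard 1 2 (by norm_num), h1]; norm_num)
  rw [hF, hcard 2 4 (by norm_num)] at a
  rw [hF, hcard 3 6 (by norm_num)] at b
  rw [hF, hcard 4 8 (by norm_num)] at c
  exact_mod_cast And.intro a (And.intro b c)

theorem venkov (hn : Module.finrank ℝ E = 24) {M : Submodule ℤ E} (h : EU M) (S : Finset E)
    (hS : ∀ v, v ∈ S ↔ v ∈ M ∧ ‖v‖ ^ 2 = 2) (y : E) :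
    24 * ∑ r ∈ S, ⟪r, y⟫ ^ 2 = 2 * (S.card : ℝ) * ‖y‖ ^ 2 := by
  let o := (stdOrthonormalBasis ℝ E).reindex (finCongr hn)
  let P : M → ℂ := fun v => ((⟪(v : E), y⟫ ^ 2 : ℝ) : ℂ) - ((‖y‖ ^ 2 / 24 : ℝ) : ℂ) *
    ∑ i, ((⟪(v : E), o i⟫ ^ 2 : ℝ) : ℂ)
  have hP : ∀ v : M, P v = ((⟪(v : E), y⟫ ^ 2 - ‖y‖ ^ 2 / 24 * ‖(v : E)‖ ^ 2 : ℝ) : ℂ) := by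
    intro v
    simp only [P]
    rw [← ofReal_sum, ← o.sum_sq_inner_right (v : E)]
    push_cast
    simp only [real_inner_comm]
  obtain ⟨F, hF⟩ := mkMF
    (fun τ => th2 M y τ - ((‖y‖ ^ 2 / 24 : ℝ) : ℂ) * ∑ i, th2 M (o i) τ) 14
    (fun m => ∑' v : (hN M) ⁻¹' {m}, P v)
    (fun τ hτ => by
      refine theta_fib h P τ _ ?_
      have h1 := (th2_summable h y τ hτ).hasSum.sub ((hasSum_sum (s := Finset.univ) fun i _ =>
        (th2_summable h (o i) τ hτ).hasSum).mul_left ((‖y‖ ^ 2 / 24 : ℝ) : ℂ))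
      have e : (fun v : M => P v * cexp (Real.pi * I * τ * ((‖(v : E)‖ ^ 2 : ℝ) : ℂ))) = fun v : M =>
          ((⟪(v : E), y⟫ ^ 2 : ℝ) : ℂ) * cexp (Real.pi * I * τ * ((‖(v : E)‖ ^ 2 : ℝ) : ℂ)) -
          ((‖y‖ ^ 2 / 24 : ℝ) : ℂ) * ∑ i, ((⟪(v : E), o i⟫ ^ 2 : ℝ) : ℂ) *
            cexp (Real.pi * I * τ * ((‖(v : E)‖ ^ 2 : ℝ) : ℂ)) := by
        funext v
        rw [← Finset.sum_mul, ← mul_assoc, ← sub_mul]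
      rw [e]
      exact h1)
    (fun τ hτ => by
      simp only [th2_S hn h _ τ hτ]
      rw [Finset.sum_sub_distrib]
      simp only [o.norm_eq_one]
      rw [Finset.sum_const, Finset.card_univ, Fintype.card_fin, ← Finset.mul_sum]
      push_cast
      ring)
  have hzero := weight14 F (by
    rw [hF]
    have : ∀ v : (hN M) ⁻¹' {0}, P v = 0 := by
      intro v
      have hv := (hN_eq h v 0).1 v.2
      simp only [CharP.cast_eq_zero, mul_zero, ne_eq, OfNat.ofNat_ne_zero, not_false_eq_true,
        pow_eq_zero_iff, norm_eq_zero] at hv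
      rw [hP, hv]
      simp
    simp [this])
  have h1 := hF 1
  rw [hzero] at h1
  have h2 : (∑' v : (hN M) ⁻¹' {1}, P v) = ∑ r ∈ S, ((⟪r, y⟫ ^ 2 - ‖y‖ ^ 2 / 12 : ℝ) : ℂ) := by
    let e : (hN M) ⁻¹' {1} ≃ S :=
      { toFun := fun v => ⟨v.1, (hS _).2 ⟨v.1.2, by simpa using (hN_eq h v 1).1 v.2⟩⟩
        invFun := fun r => ⟨⟨r, ((hS _).1 r.2).1⟩, (hN_eq h _ 1).2 (by simpa using ((hS _).1 r.2).2)⟩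
        left_inv := fun v => rfl
        right_inv := fun v => rfl }
    rw [← Finset.sum_coe_sort, ← tsum_fintype (L := SummationFilter.unconditional _), ← e.tsum_eq]
    refine tsum_congr fun v => ?_
    have hv := (hN_eq h v 1).1 v.2
    rw [hP, hv]
    simp only [e, Equiv.coe_fn_mk]
    congr 1
    push_cast
    ring
  rw [h2] at h1
  have h3 : (0 : ℂ) = ∑ r ∈ S, ((⟪r, y⟫ ^ 2 - ‖y‖ ^ 2 / 12 : ℝ) : ℂ) := by
    rw [← h1]
    simp [UpperHalfPlane.qExpansion_zero]
  rw [← ofReal_sum] at h3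
  have h4 : (0 : ℝ) = ∑ r ∈ S, (⟪r, y⟫ ^ 2 - ‖y‖ ^ 2 / 12) := by exact_mod_cast h3
  rw [Finset.sum_sub_distrib, Finset.sum_const, nsmul_eq_mul] at h4
  linarith
end Cov

end

section
namespace Cov
open scoped RealInnerProductSpace

variable {E : Type*} [NormedAddCommGroup E] [InnerProductSpace ℝ E] [FiniteDimensional ℝ E]

lemma norm_cases {M : Submodule ℤ E} (h : EU M) (h2 : ∀ v ∈ M, ‖v‖ ^ 2 ≠ 2) {v : E} (hv : v ∈ M) :
    v = 0 ∨ 4 ≤ ‖v‖ ^ 2 := by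
  obtain ⟨n, hn⟩ := h.even v hv
  by_cases h0 : v = 0
  · exact Or.inl h0
  · right
    have hp : 0 < ‖v‖ ^ 2 := by positivity
    have h3 := h2 v hv
    have hn0 : 0 < n := by
      have : (0 : ℝ) < n := by linarith
      exact_mod_cast this
    have hn1 : n ≠ 1 := by
      rintro rfl
      exact h3 (by simpa using hn)
    have : (2 : ℝ) ≤ n := by exact_mod_cast (by omega : (2 : ℤ) ≤ n)
    linarith

lemma same_class {M : Submodule ℤ E} (h : EU M) (h2 : ∀ v ∈ M, ‖v‖ ^ 2 ≠ 2) {u v t : E}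
    (hu : u ∈ M) (hv : v ∈ M) (ht : t ∈ M) (huv : u - v = (2 : ℝ) • t) (h8 : ‖u‖ ^ 2 ≤ 8)
    (h8' : ‖v‖ ^ 2 ≤ 8) : u = v ∨ u = -v ∨ (‖u‖ ^ 2 = 8 ∧ ‖v‖ ^ 2 = 8 ∧ ⟪u, v⟫ = 0) := by
  have e1 : ‖u - v‖ ^ 2 = 4 * ‖t‖ ^ 2 := by
    rw [huv, norm_smul]; norm_num; ring
  have e2 : ‖u + v‖ ^ 2 = 4 * ‖t + v‖ ^ 2 := by
    rw [show u + v = (2 : ℝ) • (t + v) by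
      rw [smul_add, ← huv, two_smul]; abel, norm_smul]
    norm_num; ring
  have f1 := norm_sub_sq_real u v
  have f2 := norm_add_sq_real u v
  rcases norm_cases h h2 ht with h3 | h3
  · left
    rw [h3, smul_zero] at huv
    exact sub_eq_zero.1 huv
  rcases norm_cases h h2 (add_mem ht hv) with h4 | h4
  · right; left
    have : ‖u + v‖ ^ 2 = 0 := by rw [e2, h4]; simp
    have : u + v = 0 := by simpa using this
    exact eq_neg_of_add_eq_zero_left this
  right; right
  refine ⟨?_, ?_, ?_⟩ <;> linarith

lemma orth_card (hn : Module.finrank ℝ E = 24) (T : Finset E) (h0 : ∀ u ∈ T, u ≠ 0)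
    (hT : ∀ u ∈ T, ∀ v ∈ T, u = v ∨ u = -v ∨ ⟪u, v⟫ = 0) : T.card ≤ 48 := by
  classical
  let O := T.powerset.filter fun S => ∀ u ∈ S, ∀ v ∈ S, u ≠ v → ⟪u, v⟫ = 0
  have hO : O.Nonempty := ⟨∅, by simp [O]⟩
  obtain ⟨S, hS, hmax⟩ := O.exists_max_image Finset.card hO
  have hS' : S ⊆ T ∧ ∀ u ∈ S, ∀ v ∈ S, u ≠ v → ⟪u, v⟫ = 0 := by simpa [O] using hS
  obtain ⟨hST, hSo⟩ := hS'
  have hcard : S.card ≤ 24 := by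
    have hli : LinearIndependent ℝ (fun u : S => (u : E)) := by
      apply linearIndependent_of_ne_zero_of_inner_eq_zero
      · exact fun u => h0 _ (hST u.2)
      · intro u v huv
        exact hSo u u.2 v v.2 (fun h => huv (Subtype.ext h))
    have := hli.fintype_card_le_finrank
    rw [hn, Fintype.card_coe] at this
    exact this
  have hsub : T ⊆ S ∪ S.image (fun u => -u) := by
    intro u hu
    by_contra hc
    simp only [Finset.mem_union, Finset.mem_image, not_or, not_exists, not_and] at hc
    have hor : ∀ v ∈ S, ⟪u, v⟫ = 0 := by
      intro v hv
      rcases hT u hu v (hST hv) with h | h | h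
      · exact absurd (h ▸ hv) hc.1
      · exact absurd h.symm (hc.2 v hv)
      · exact h
    have hins : insert u S ∈ O := by
      simp only [O, Finset.mem_filter, Finset.mem_powerset]
      refine ⟨Finset.insert_subset hu hST, ?_⟩
      intro a ha b hb hab
      rw [Finset.mem_insert] at ha hb
      rcases ha with rfl | ha <;> rcases hb with rfl | hb
      · exact absurd rfl hab
      · exact hor b hb
      · rw [real_inner_comm]; exact hor a ha
      · exact hSo a ha b hb hab
    have := hmax _ hins
    rw [Finset.card_insert_of_notMem hc.1] at this
    omega
  have h1 := Finset.card_le_card hsub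
  have h2 := Finset.card_union_le S (S.image fun u => -u)
  have h3 := Finset.card_image_le (s := S) (f := fun u => -u)
  omega

theorem mod2 (hn : Module.finrank ℝ E = 24) {M : Submodule ℤ E} (h : EU M)
    (h2 : ∀ v ∈ M, ‖v‖ ^ 2 ≠ 2) (d : E) (hd : d ∈ M) :
    ∃ s ∈ M, ∃ t ∈ M, d = s + (2 : ℝ) • t ∧ ‖s‖ ^ 2 ≤ 8 := by
  classical
  obtain ⟨c4, c6, c8⟩ := counts hn h h2
  obtain ⟨b, -, hb, -, -, hm⟩ := EU.data hn h
  choose! m hm using hm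
  let cl : E → (Fin 24 → ZMod 2) := fun v i => (m v i : ZMod 2)
  have hcl : ∀ u ∈ M, ∀ v ∈ M, cl u = cl v → ∃ t ∈ M, u - v = (2 : ℝ) • t := by
    intro u hu v hv huv
    have h1 : ∀ i, ∃ k : ℤ, m u i - m v i = 2 * k := by
      intro i
      have := congrFun huv i
      simp only [cl] at this
      rw [ZMod.intCast_eq_intCast_iff_dvd_sub] at this
      obtain ⟨k, hk⟩ := this
      exact ⟨-k, by push_cast at hk; linarith⟩
    choose k hk using h1
    refine ⟨∑ i, k i • b i, Submodule.sum_mem _ fun i _ => M.smul_mem _ (hb i), ?_⟩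
    conv_lhs => rw [hm u hu, hm v hv]
    rw [← Finset.sum_sub_distrib, Finset.smul_sum]
    refine Finset.sum_congr rfl fun i _ => ?_
    rw [← sub_smul, ← Int.cast_smul_eq_zsmul ℝ (k i), smul_smul]
    congr 1
    exact_mod_cast hk i
  let A : Finset E := (ball_finite h 8).toFinset
  have hA : ∀ v, v ∈ A ↔ v ∈ M ∧ ‖v‖ ^ 2 ≤ 8 := by intro v; simp [A]
  have hcard : ∀ r : ℝ, r ≤ 8 → (A.filter fun v => ‖v‖ ^ 2 = r).card =
      Nat.card {v : M // ‖(v : E)‖ ^ 2 = r} := by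
    intro r hr
    rw [← Fintype.card_coe, ← Nat.card_eq_fintype_card]
    refine Nat.card_congr ?_
    exact
      { toFun := fun v => ⟨⟨v.1, ((hA _).1 (Finset.mem_filter.1 v.2).1).1⟩, (Finset.mem_filter.1 v.2).2⟩
        invFun := fun v => ⟨v.1.1, Finset.mem_filter.2 ⟨(hA _).2 ⟨v.1.2, by rw [v.2]; exact hr⟩, v.2⟩⟩
        left_inv := fun v => rfl
        right_inv := fun v => rfl }
  have c0 : Nat.card {v : M // ‖(v : E)‖ ^ 2 = 0} = 1 := by
    rw [Nat.card_eq_one_iff_unique]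
    refine ⟨⟨fun a b => ?_⟩, ⟨⟨0, by simp⟩⟩⟩
    obtain ⟨⟨a, ha'⟩, ha⟩ := a
    obtain ⟨⟨b, hb'⟩, hb⟩ := b
    simp only [ne_eq, OfNat.ofNat_ne_zero, not_false_eq_true, pow_eq_zero_iff, norm_eq_zero] at ha hb
    subst ha hb
    rfl
  let wt : E → ℝ := fun v => (if ‖v‖ ^ 2 = 0 then 1 else 0) + (if ‖v‖ ^ 2 = 4 then 1 / 2 else 0) +
    (if ‖v‖ ^ 2 = 6 then 1 / 2 else 0) + (if ‖v‖ ^ 2 = 8 then 1 / 48 else 0)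
  have htot : ∑ v ∈ A, wt v = 2 ^ 24 := by
    simp only [wt]
    rw [Finset.sum_add_distrib, Finset.sum_add_distrib, Finset.sum_add_distrib]
    simp only [← Finset.sum_filter, Finset.sum_const, nsmul_eq_mul]
    rw [hcard 0 (by norm_num), hcard 4 (by norm_num), hcard 6 (by norm_num), hcard 8 (by norm_num),
      c0, c4, c6, c8]
    norm_num
  have hfib : ∀ c, ∑ v ∈ A.filter (fun v => cl v = c), wt v ≤ 1 := by
    intro c
    set T := A.filter (fun v => cl v = c) with hT
    have hmem : ∀ v ∈ T, v ∈ M ∧ ‖v‖ ^ 2 ≤ 8 ∧ cl v = c := by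
      intro v hv
      rw [hT, Finset.mem_filter, hA] at hv
      exact ⟨hv.1.1, hv.1.2, hv.2⟩
    have hpair : ∀ u ∈ T, ∀ v ∈ T, u = v ∨ u = -v ∨ (‖u‖ ^ 2 = 8 ∧ ‖v‖ ^ 2 = 8 ∧ ⟪u, v⟫ = 0) := by
      intro u hu v hv
      obtain ⟨a1, a2, a3⟩ := hmem u hu
      obtain ⟨b1, b2, b3⟩ := hmem v hv
      obtain ⟨t, ht, he⟩ := hcl u a1 v b1 (a3.trans b3.symm)
      exact same_class h h2 a1 b1 ht he a2 b2
    by_cases hall : ∀ v ∈ T, ‖v‖ ^ 2 = 8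
    · have h48 : T.card ≤ 48 := by
        refine orth_card hn T ?_ ?_
        · intro u hu h0
          have := hall u hu
          rw [h0] at this
          norm_num at this
        · intro u hu v hv
          rcases hpair u hu v hv with h | h | h
          · exact Or.inl h
          · exact Or.inr (Or.inl h)
          · exact Or.inr (Or.inr h.2.2)
      have : ∀ v ∈ T, wt v = 1 / 48 := by
        intro v hv
        simp only [wt, hall v hv]
        norm_num
      rw [Finset.sum_congr rfl this, Finset.sum_const, nsmul_eq_mul]
      have : (T.card : ℝ) ≤ 48 := by exact_mod_cast h48
      linarith
    · push Not at hall
      obtain ⟨u, hu, hu8⟩ := hall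
      have hsub : ∀ v ∈ T, v = u ∨ v = -u := by
        intro v hv
        rcases hpair v hv u hu with h | h | h
        · exact Or.inl h
        · exact Or.inr h
        · exact absurd h.2.1 hu8
      have hsub' : T ⊆ {u, -u} := by
        intro v hv
        simpa using hsub v hv
      have hnn : ∀ v, 0 ≤ wt v := by
        intro v
        simp only [wt]
        positivity
      by_cases hu0 : u = 0
      · have : T ⊆ {0} := by
          intro v hv
          have := hsub v hv
          rw [hu0] at this
          simpa using this
        refine (Finset.sum_le_sum_of_subset_of_nonneg this fun v _ _ => hnn v).trans ?_
        simp [wt]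
      · have hw : ∀ v ∈ T, wt v ≤ 1 / 2 := by
          intro v hv
          have h0 : ‖v‖ ^ 2 ≠ 0 := by
            rcases hsub v hv with rfl | rfl <;> simpa using hu0
          simp only [wt]
          by_cases h4 : ‖v‖ ^ 2 = 4
          · rw [h4]; norm_num
          by_cases h6 : ‖v‖ ^ 2 = 6
          · rw [h6]; norm_num
          by_cases h8 : ‖v‖ ^ 2 = 8
          · rw [h8]; norm_num
          rw [if_neg h0, if_neg h4, if_neg h6, if_neg h8]; norm_num
        have h3 := Finset.sum_le_card_nsmul T wt (1 / 2) hw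
        have h4 : T.card ≤ 2 := (Finset.card_le_card hsub').trans Finset.card_le_two
        have h5 : (T.card : ℝ) ≤ 2 := by exact_mod_cast h4
        rw [nsmul_eq_mul] at h3
        linarith
  by_contra hcon
  push Not at hcon
  have hempty : ∑ v ∈ A.filter (fun v => cl v = cl d), wt v = 0 := by
    rw [Finset.sum_eq_zero]
    intro v hv
    rw [Finset.mem_filter, hA] at hv
    obtain ⟨t, ht, he⟩ := hcl d hd v hv.1.1 hv.2.symm
    have := hcon v hv.1.1 t ht (by rw [← he]; abel)
    linarith [hv.1.2]
  have hsum : ∑ c : Fin 24 → ZMod 2, ∑ v ∈ A.filter (fun v => cl v = c), wt v = 2 ^ 24 := by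
    rw [Finset.sum_fiberwise, htot]
  rw [← Finset.add_sum_erase _ _ (Finset.mem_univ (cl d)), hempty, zero_add] at hsum
  have hle := Finset.sum_le_card_nsmul (Finset.univ.erase (cl d))
    (fun c => ∑ v ∈ A.filter (fun v => cl v = c), wt v) 1 (fun c _ => hfib c)
  rw [hsum, Finset.card_erase_of_mem (Finset.mem_univ _), Finset.card_univ, Fintype.card_fun,
    ZMod.card, Fintype.card_fin, nsmul_eq_mul] at hle
  norm_num at hle
end Cov

end

section
namespace Cov
open scoped RealInnerProductSpace

variable {E : Type*} [NormedAddCommGroup E] [InnerProductSpace ℝ E]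

lemma disc_of_even {M : Submodule ℤ E} (he : ∀ v ∈ M, ∃ n : ℤ, ‖v‖ ^ 2 = 2 * n) :
    DiscreteTopology M := by
  rw [discreteTopology_iff_isOpen_singleton_zero, Metric.isOpen_singleton_iff]
  refine ⟨1, one_pos, fun v hv => ?_⟩
  rw [dist_zero_right] at hv
  obtain ⟨n, hn⟩ := he v v.2
  have h1 : ‖(v : E)‖ < 1 := hv
  have h2 : ‖(v : E)‖ ^ 2 < 1 := by nlinarith [norm_nonneg (v : E)]
  have h3 : n = 0 := by
    have a : (n : ℝ) < 1 := by linarith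
    have b : (-1 : ℝ) < n := by nlinarith [sq_nonneg ‖(v : E)‖]
    have a' : n < 1 := by exact_mod_cast a
    have b' : -1 < n := by exact_mod_cast b
    omega
  rw [h3] at hn
  have : (v : E) = 0 := by simpa using hn
  exact Subtype.ext this

/-- Data of a primitive norm zero vector `(a, h, l)` of `Λ ⊕ U`. -/
structure HD (Λ : Submodule ℤ E) where
  a : E
  h : ℤ
  l : ℤ
  eu : EU Λ
  no2 : ∀ v ∈ Λ, ‖v‖ ^ 2 ≠ 2
  ha : a ∈ Λ
  hpos : 0 < h
  null : ‖a‖ ^ 2 = 2 * h * l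
  prim : ∃ v ∈ Λ, ∃ k n : ℤ, ⟪v, a⟫ - k * l - n * h = 1

namespace HD
variable {Λ : Submodule ℤ E} (D : HD Λ)

/-- The centre. -/
def c : E := (1 / (D.h : ℝ)) • D.a

/-- `x` is the projection of a vector of height `k`. -/
def PP (x : E) (k : ℤ) : Prop :=
  x + (k : ℝ) • D.c ∈ Λ ∧ ∃ n : ℤ, ⟪x + (k : ℝ) • D.c, D.a⟫ = k * D.l + n * D.h

lemma hR : (0 : ℝ) < D.h := by exact_mod_cast D.hpos

lemma hc : (D.h : ℝ) • D.c = D.a := by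
  rw [c, smul_smul, mul_one_div_cancel D.hR.ne', one_smul]

lemma inner_c (x : E) : ⟪x, D.a⟫ = D.h * ⟪x, D.c⟫ := by
  conv_lhs => rw [← D.hc, inner_smul_right]

lemma norm_c : D.h * ‖D.c‖ ^ 2 = 2 * D.l := by
  have h1 := D.null
  rw [← D.hc, norm_smul, mul_pow, Real.norm_eq_abs, sq_abs] at h1
  have := D.hR
  have h2 : (D.h : ℝ) * (D.h * ‖D.c‖ ^ 2) = D.h * (2 * D.l) := by linarith
  exact mul_left_cancel₀ this.ne' h2

lemma PP_add {x y : E} {k j : ℤ} (hx : D.PP x k) (hy : D.PP y j) : D.PP (x + y) (k + j) := by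
  obtain ⟨h1, n, hn⟩ := hx
  obtain ⟨h2, m, hm⟩ := hy
  have e : x + y + ((k + j : ℤ) : ℝ) • D.c = (x + (k : ℝ) • D.c) + (y + (j : ℝ) • D.c) := by
    push_cast
    module
  refine ⟨by rw [e]; exact add_mem h1 h2, n + m, ?_⟩
  rw [e, inner_add_left, hn, hm]
  push_cast
  ring

lemma PP_neg {x : E} {k : ℤ} (hx : D.PP x k) : D.PP (-x) (-k) := by
  obtain ⟨h1, n, hn⟩ := hx
  have e : -x + ((-k : ℤ) : ℝ) • D.c = -(x + (k : ℝ) • D.c) := by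
    push_cast
    module
  refine ⟨by rw [e]; exact neg_mem h1, -n, ?_⟩
  rw [e, inner_neg_left, hn]
  push_cast
  ring

lemma PP_h : D.PP 0 D.h := by
  refine ⟨by rw [zero_add, D.hc]; exact D.ha, D.l, ?_⟩
  rw [zero_add, D.hc, real_inner_self_eq_norm_sq, D.null]
  ring

lemma PP_zero : D.PP 0 0 := ⟨by simp, 0, by simp⟩

lemma PP_mul (j : ℤ) : D.PP 0 (j * D.h) := by
  have e : ((j * D.h : ℤ) : ℝ) • D.c = (j : ℝ) • D.a := by
    push_cast
    rw [mul_smul, D.hc]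
  refine ⟨?_, j * D.l, ?_⟩
  · rw [zero_add, e, Int.cast_smul_eq_zsmul]
    exact Λ.smul_mem _ D.ha
  · rw [zero_add, e, inner_smul_left, real_inner_self_eq_norm_sq, D.null]
    simp
    ring

lemma PP_shift {x : E} {k : ℤ} (hx : D.PP x k) (j : ℤ) : D.PP x (k + j * D.h) := by
  have := D.PP_add hx (D.PP_mul j)
  rwa [add_zero] at this

lemma dvd_of_PP_zero {k : ℤ} (hk : D.PP 0 k) : D.h ∣ k := by
  obtain ⟨h1, n, hn⟩ := hk
  rw [zero_add] at h1 hn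
  obtain ⟨v, hv, k1, n1, h3⟩ := D.prim
  obtain ⟨t, ht⟩ := D.eu.inner_int hv h1
  have hR := D.hR
  rw [inner_smul_left, D.inner_c, real_inner_self_eq_norm_sq, D.norm_c] at hn
  rw [D.inner_c] at h3
  rw [inner_smul_right] at ht
  simp only [conj_trivial] at hn
  refine ⟨t - k1 * n - n1 * k, ?_⟩
  have : (k : ℝ) = D.h * (t - k1 * n - n1 * k) := by
    have e1 : (k : ℝ) * D.l = n * D.h := by linarith
    rw [← ht]
    linear_combination (-k : ℝ) * h3 - k1 * e1
  exact_mod_cast this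

lemma PP_unique {x : E} {k j : ℤ} (hx : D.PP x k) (hj : D.PP x j) : D.h ∣ k - j := by
  have := D.PP_add hx (D.PP_neg hj)
  rw [add_neg_cancel] at this
  exact D.dvd_of_PP_zero this

lemma PP_even {x : E} {k : ℤ} (hx : D.PP x k) : ∃ n : ℤ, ‖x‖ ^ 2 = 2 * n := by
  obtain ⟨h1, n, hn⟩ := hx
  obtain ⟨m, hm⟩ := D.eu.even _ h1
  refine ⟨m - k * n, ?_⟩
  have e1 := norm_sub_sq_real (x + (k : ℝ) • D.c) ((k : ℝ) • D.c)
  rw [add_sub_cancel_right, inner_smul_right, norm_smul, mul_pow, Real.norm_eq_abs, sq_abs, hm] at e1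
  rw [D.inner_c] at hn
  have h3 := D.norm_c
  have hR := D.hR
  have e2 : (D.h : ℝ) * (‖x‖ ^ 2) = D.h * (2 * (m - k * n)) := by
    rw [e1]
    linear_combination (-2 * k : ℝ) * hn + (k : ℝ) ^ 2 * h3
  have := mul_left_cancel₀ hR.ne' e2
  push_cast
  exact this

/-- The even unimodular lattice of the hole. -/
def M : Submodule ℤ E where
  carrier := {x | ∃ k, D.PP x k}
  add_mem' := by
    rintro x y ⟨k, hk⟩ ⟨j, hj⟩
    exact ⟨k + j, D.PP_add hk hj⟩
  zero_mem' := ⟨0, D.PP_zero⟩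
  smul_mem' := by
    intro n x hx
    have key : ∀ m : ℕ, ∃ k, D.PP (m • x) k := by
      intro m
      induction m with
      | zero => exact ⟨0, by simpa using D.PP_zero⟩
      | succ m ih =>
        obtain ⟨k, hk⟩ := hx
        obtain ⟨j, hj⟩ := ih
        exact ⟨j + k, by rw [succ_nsmul]; exact D.PP_add hj hk⟩
    obtain ⟨m, rfl | rfl⟩ := n.eq_nat_or_neg
    · obtain ⟨k, hk⟩ := key m
      exact ⟨k, by simpa using hk⟩
    · obtain ⟨k, hk⟩ := key m
      exact ⟨-k, by simpa using D.PP_neg hk⟩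

lemma mem_M (x : E) : x ∈ D.M ↔ ∃ k, D.PP x k := Iff.rfl

theorem M_EU : EU D.M where
  disc := disc_of_even fun v ⟨k, hk⟩ => D.PP_even hk
  even := fun v ⟨k, hk⟩ => D.PP_even hk
  span := by
    rw [eq_top_iff, ← D.eu.span, Submodule.span_le]
    intro v hv
    have h1 : D.h • v ∈ D.M := by
      refine ⟨0, by simpa using Λ.smul_mem _ hv, ?_⟩
      obtain ⟨n, hn⟩ := D.eu.inner_int hv D.ha
      refine ⟨n, ?_⟩
      rw [← Int.cast_smul_eq_zsmul ℝ]
      simp [inner_smul_left, hn, mul_comm]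
    have h2 : v = (1 / (D.h : ℝ)) • (D.h • v) := by
      rw [← Int.cast_smul_eq_zsmul ℝ, smul_smul, one_div_mul_cancel D.hR.ne', one_smul]
    rw [h2]
    exact Submodule.smul_mem _ _ (Submodule.subset_span h1)
  dual := by
    intro x hx
    obtain ⟨v1, hv1, k1, n1, h1⟩ := D.prim
    have hR := D.hR
    set ρ : ℝ := ⟪x, v1 - (k1 : ℝ) • D.c⟫ with hρ
    have hnull : ⟪D.a, D.a⟫ = 2 * D.h * D.l := by
      rw [real_inner_self_eq_norm_sq, D.null]
    -- the functional on `Λ`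
    have hμ : x - ρ • D.a ∈ Λ := by
      apply D.eu.dual
      intro v hv
      obtain ⟨t, ht⟩ := D.eu.inner_int hv D.ha
      have hm : v - (t : ℝ) • (v1 - (k1 : ℝ) • D.c) ∈ D.M := by
        refine ⟨-t * k1, ?_, ?_⟩
        · have : v - (t : ℝ) • (v1 - (k1 : ℝ) • D.c) + ((-t * k1 : ℤ) : ℝ) • D.c = v - t • v1 := by
            rw [← Int.cast_smul_eq_zsmul ℝ]
            push_cast
            module
          rw [this]
          exact sub_mem hv (Λ.smul_mem _ hv1)
        · have : v - (t : ℝ) • (v1 - (k1 : ℝ) • D.c) + ((-t * k1 : ℤ) : ℝ) • D.c = v - (t : ℝ) • v1 := by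
            push_cast
            module
          refine ⟨-t * n1, ?_⟩
          rw [this, inner_sub_left, inner_smul_left, ht]
          simp only [conj_trivial]
          push_cast
          linear_combination (-t : ℝ) * h1
      obtain ⟨n, hn⟩ := hx _ hm
      refine ⟨n, ?_⟩
      have ht' : ⟪D.a, v⟫ = t := by rw [real_inner_comm]; exact ht
      rw [inner_sub_left, inner_smul_left, ← hn, inner_sub_right, inner_smul_right, ← hρ, ht']
      simp only [conj_trivial]
      ring
    -- the functional on the other two basis vectors
    obtain ⟨j, hj⟩ : ∃ j : ℤ, D.h * ρ = j := by
      have hm : (D.h : ℝ) • (v1 - (k1 : ℝ) • D.c) ∈ D.M := by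
        have : (D.h : ℝ) • (v1 - (k1 : ℝ) • D.c) + ((D.h * k1 : ℤ) : ℝ) • D.c = (D.h : ℝ) • v1 := by
          push_cast
          module
        refine ⟨D.h * k1, ?_, ?_⟩
        · rw [this, Int.cast_smul_eq_zsmul]
          exact Λ.smul_mem _ hv1
        · refine ⟨1 + n1 * D.h, ?_⟩
          rw [this, inner_smul_left]
          simp only [conj_trivial]
          push_cast
          linear_combination (D.h : ℝ) * h1
      obtain ⟨n, hn⟩ := hx _ hm
      refine ⟨n, ?_⟩
      rw [← hn, inner_smul_right]
    obtain ⟨i, hi⟩ : ∃ i : ℤ, D.l * ρ - ⟪x, D.c⟫ = i := by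
      have hm : (D.l : ℝ) • (v1 - (k1 : ℝ) • D.c) - D.c ∈ D.M := by
        have : (D.l : ℝ) • (v1 - (k1 : ℝ) • D.c) - D.c + ((D.l * k1 + 1 : ℤ) : ℝ) • D.c =
            (D.l : ℝ) • v1 := by
          push_cast
          module
        refine ⟨D.l * k1 + 1, ?_, ?_⟩
        · rw [this, Int.cast_smul_eq_zsmul]
          exact Λ.smul_mem _ hv1
        · refine ⟨n1 * D.l, ?_⟩
          rw [this, inner_smul_left]
          simp only [conj_trivial]
          push_cast
          linear_combination (D.l : ℝ) * h1
      obtain ⟨n, hn⟩ := hx _ hm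
      refine ⟨n, ?_⟩
      rw [← hn, inner_sub_right, inner_smul_right]
    have e : x + ((-j : ℤ) : ℝ) • D.c = x - ρ • D.a := by
      push_cast
      rw [← D.hc, smul_smul, ← hj, mul_comm ρ, neg_smul, sub_eq_add_neg]
    refine ⟨-j, by rw [e]; exact hμ, -i, ?_⟩
    rw [e, inner_sub_left, inner_smul_left, hnull]
    simp only [conj_trivial]
    rw [D.inner_c]
    push_cast
    linear_combination (-(D.h : ℝ)) * hi - D.l * hj
end HD
end Cov

end

section
namespace Cov
open scoped RealInnerProductSpace

variable {E : Type*} [NormedAddCommGroup E] [InnerProductSpace ℝ E]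

lemma root_eq {r s : E} (hr : ‖r‖ ^ 2 = 2) (hs : ‖s‖ ^ 2 = 2) (h : ⟪r, s⟫ = 2) : r = s := by
  have := norm_sub_sq_real r s
  rw [hr, hs, h] at this
  have h0 : ‖r - s‖ ^ 2 = 0 := by linarith
  have : r - s = 0 := by simpa using h0
  exact sub_eq_zero.1 this

lemma root_cases {r s : E} (hr : ‖r‖ ^ 2 = 2) (hs : ‖s‖ ^ 2 = 2) (hi : ∃ n : ℤ, ⟪r, s⟫ = n) :
    r = s ∨ r = -s ∨ ⟪r, s⟫ = 1 ∨ ⟪r, s⟫ = -1 ∨ ⟪r, s⟫ = 0 := by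
  obtain ⟨n, hn⟩ := hi
  have h1 := norm_sub_sq_real r s
  have h2 := norm_add_sq_real r s
  rw [hr, hs, hn] at h1 h2
  have h3 : (n : ℝ) ≤ 2 := by nlinarith [sq_nonneg ‖r - s‖]
  have h4 : (-2 : ℝ) ≤ n := by nlinarith [sq_nonneg ‖r + s‖]
  have h3' : n ≤ 2 := by exact_mod_cast h3
  have h4' : -2 ≤ n := by exact_mod_cast h4
  rw [hn]
  interval_cases n
  · right; left
    apply root_eq hr (by rw [norm_neg, hs])
    rw [inner_neg_right, hn]; norm_num
  · right; right; right; left; norm_num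
  · right; right; right; right; norm_num
  · right; right; left; norm_num
  · left
    exact root_eq hr hs (by rw [hn]; norm_num)

open Classical in
/-- Sum over a root system of an odd function. -/
lemma rootsum (R : Finset E) (hneg : ∀ r ∈ R, -r ∈ R) (hn2 : ∀ r ∈ R, ‖r‖ ^ 2 = 2)
    (hIntg : ∀ r ∈ R, ∀ s ∈ R, ∃ n : ℤ, ⟪r, s⟫ = n) (f : E → ℝ)
    (hf : ∀ r ∈ R, f (-r) = - f r) (β : E) (hβ : β ∈ R) :
    ∑ r ∈ R, f r * ⟪r, β⟫ = 2 * (∑ r ∈ R with ⟪r, β⟫ = 1, f r) + 4 * f β := by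
  have hbb : ⟪β, β⟫ = 2 := by rw [real_inner_self_eq_norm_sq, hn2 β hβ]
  have hb0 : β ≠ 0 := by
    rintro rfl
    simp at hbb
  have hne : β ≠ -β := by
    intro h
    have : (2 : ℝ) • β = 0 := by
      rw [two_smul]; nth_rewrite 1 [h]; simp
    rcases smul_eq_zero.1 this with h | h
    · norm_num at h
    · exact hb0 h
  have h1 : ∀ r ∈ R, f r * ⟪r, β⟫ = (if ⟪r, β⟫ = 1 then f r else 0) +
      (if ⟪r, β⟫ = -1 then - f r else 0) + (if r = β then 2 * f β else 0) +
      (if r = -β then 2 * f β else 0) := by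
    intro r hr
    rcases root_cases (hn2 r hr) (hn2 β hβ) (hIntg r hr β hβ) with h | h | h | h | h
    · subst h
      rw [hbb]
      simp [hne]
      norm_num
      ring
    · subst h
      rw [inner_neg_left, hbb]
      simp [hne.symm, hf β hβ]
      norm_num
      ring
    · have a1 : r ≠ β := by rintro rfl; rw [hbb] at h; norm_num at h
      have a2 : r ≠ -β := by rintro rfl; rw [inner_neg_left, hbb] at h; norm_num at h
      simp [a1, a2, h]; norm_num
    · have a1 : r ≠ β := by rintro rfl; rw [hbb] at h; norm_num at h
      have a2 : r ≠ -β := by rintro rfl; rw [inner_neg_left, hbb] at h; norm_num at h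
      simp [a1, a2, h]; norm_num
    · have a1 : r ≠ β := by rintro rfl; rw [hbb] at h; norm_num at h
      have a2 : r ≠ -β := by rintro rfl; rw [inner_neg_left, hbb] at h; norm_num at h
      simp [a1, a2, h]
  have h2 : ∑ r ∈ R, (if ⟪r, β⟫ = -1 then - f r else 0) =
      ∑ r ∈ R, (if ⟪r, β⟫ = 1 then f r else 0) := by
    refine Finset.sum_bij' (fun r _ => -r) (fun r _ => -r) hneg hneg (by simp) (by simp) ?_
    intro r hr
    rw [inner_neg_left, hf r hr]
    by_cases h : ⟪r, β⟫ = -1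
    · rw [h]; simp
    · rw [if_neg h, if_neg]
      intro h3
      exact h (by linarith)
  rw [Finset.sum_congr rfl h1, Finset.sum_add_distrib, Finset.sum_add_distrib,
    Finset.sum_add_distrib, h2, Finset.sum_ite_eq', Finset.sum_ite_eq', if_pos hβ,
    if_pos (hneg β hβ), Finset.sum_filter]
  ring

open Classical in
lemma rootpair (R : Finset E) (hn2 : ∀ r ∈ R, ‖r‖ ^ 2 = 2) (β : E) (hβ : β ∈ R)
    (hsub : ∀ r ∈ R, ⟪r, β⟫ = 1 → β - r ∈ R) (f : E → ℝ) :
    ∑ r ∈ R with ⟪r, β⟫ = 1, f r = ∑ r ∈ R with ⟪r, β⟫ = 1, f (β - r) := by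
  have hbb : ⟪β, β⟫ = 2 := by rw [real_inner_self_eq_norm_sq, hn2 β hβ]
  have key : ∀ r ∈ R.filter (fun r => ⟪r, β⟫ = 1), β - r ∈ R.filter (fun r => ⟪r, β⟫ = 1) := by
    intro r hr
    rw [Finset.mem_filter] at hr ⊢
    refine ⟨hsub r hr.1 hr.2, ?_⟩
    rw [inner_sub_left, hbb, hr.2]; norm_num
  exact Finset.sum_bij' (fun r _ => β - r) (fun r _ => β - r) key key (by simp) (by simp) (by simp)

namespace HD
variable {Λ : Submodule ℤ E} (D : HD Λ)

lemma PP_vert {v : E} (hv : v ∈ Λ) (h2 : ‖v - D.c‖ ^ 2 = 2) : D.PP (v - D.c) 1 := by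
  obtain ⟨n, hn⟩ := D.eu.even v hv
  have e : v - D.c + ((1 : ℤ) : ℝ) • D.c = v := by simp
  refine ⟨by rw [e]; exact hv, n - 1, ?_⟩
  rw [e]
  have h1 := norm_sub_sq_real v D.c
  have h3 := D.norm_c
  rw [D.inner_c]
  push_cast
  rw [h2, hn] at h1
  linear_combination ((D.h : ℝ) / 2) * h1 + (1 / 2 : ℝ) * h3

lemma exists_height {β : E} (hβ : β ∈ D.M) (h2 : ‖β‖ ^ 2 = 2) :
    ∃ k : ℤ, D.PP β k ∧ 0 < k ∧ k < D.h := by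
  obtain ⟨k, hk⟩ := hβ
  have hp := D.PP_shift hk (-(k / D.h))
  have e : k + -(k / D.h) * D.h = k % D.h := by
    have := Int.emod_add_mul_ediv k D.h
    linarith
  rw [e] at hp
  refine ⟨k % D.h, hp, ?_, Int.emod_lt_of_pos _ D.hpos⟩
  rcases (Int.emod_nonneg k D.hpos.ne').lt_or_eq with h | h
  · exact h
  · rw [← h] at hp
    have := hp.1
    simp only [Int.cast_zero, zero_smul, add_zero] at this
    exact absurd h2 (D.no2 β this)

variable [FiniteDimensional ℝ E]

theorem hole_main (hn : Module.finrank ℝ E = 24) {ι : Type*} (S : Finset ι) (m : ι → ℝ) (V : ι → E)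
    (hm : ∀ i ∈ S, 0 ≤ m i) (hm0 : 0 < ∑ i ∈ S, m i)
    (hV : ∀ i ∈ S, m i ≠ 0 → V i ∈ Λ ∧ ‖V i - D.c‖ ^ 2 = 2)
    (hsum : ∑ i ∈ S, m i • (V i - D.c) = 0) (p : E)
    (hp : ∀ v ∈ Λ, ‖v - D.c‖ ^ 2 = 2 → ⟪v - D.c, p⟫ ≤ 0) : p = 0 := by
  classical
  have hM := D.M_EU
  have hfin : {v | v ∈ D.M ∧ ‖v‖ ^ 2 = 2}.Finite :=
    (ball_finite hM 2).subset fun v hv => ⟨hv.1, hv.2.le⟩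
  let R : Finset E := hfin.toFinset
  have hR : ∀ v, v ∈ R ↔ v ∈ D.M ∧ ‖v‖ ^ 2 = 2 := fun v => by simp [R]
  have hn2 : ∀ r ∈ R, ‖r‖ ^ 2 = 2 := fun r hr => ((hR r).1 hr).2
  have hneg : ∀ r ∈ R, -r ∈ R := fun r hr => by
    rw [hR] at hr ⊢
    exact ⟨neg_mem hr.1, by rw [norm_neg]; exact hr.2⟩
  have hIntg : ∀ r ∈ R, ∀ s ∈ R, ∃ n : ℤ, ⟪r, s⟫ = n := fun r hr s hs =>
    hM.inner_int ((hR r).1 hr).1 ((hR s).1 hs).1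
  have hsub : ∀ β ∈ R, ∀ r ∈ R, ⟪r, β⟫ = 1 → β - r ∈ R := by
    intro β hβ r hr h1
    rw [hR]
    refine ⟨sub_mem ((hR β).1 hβ).1 ((hR r).1 hr).1, ?_⟩
    rw [norm_sub_sq_real, hn2 β hβ, hn2 r hr, real_inner_comm, h1]; norm_num
  have hex : ∀ β : E, ∃ k : ℤ, β ∈ R → D.PP β k ∧ 0 < k ∧ k < D.h := by
    intro β
    by_cases hβ : β ∈ R
    · obtain ⟨k, hk⟩ := D.exists_height ((hR β).1 hβ).1 ((hR β).1 hβ).2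
      exact ⟨k, fun _ => hk⟩
    · exact ⟨0, fun h => absurd h hβ⟩
  choose k hk using hex
  have kuniq : ∀ β ∈ R, ∀ j, D.PP β j → ∃ t, k β = j + t * D.h := by
    intro β hβ j hj
    obtain ⟨t, ht⟩ := D.PP_unique (hk β hβ).1 hj
    exact ⟨t, by linarith⟩
  have kneg : ∀ β ∈ R, k (-β) = D.h - k β := by
    intro β hβ
    obtain ⟨t, ht⟩ := kuniq (-β) (hneg β hβ) _ (D.PP_neg (hk β hβ).1)
    have h1 := (hk β hβ).2
    have h2 := (hk (-β) (hneg β hβ)).2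
    have h3 := D.hpos
    have a : 0 < t := by by_contra h; nlinarith
    have b : t < 2 := by by_contra h; nlinarith
    obtain rfl : t = 1 := by omega
    linarith
  have kadd : ∀ β ∈ R, ∀ r ∈ R, ⟪r, β⟫ = 1 →
      k r + k (β - r) = k β ∨ k r + k (β - r) = k β + D.h := by
    intro β hβ r hr h1
    have hb := hsub β hβ r hr h1
    have hp := D.PP_add (hk r hr).1 (hk _ hb).1
    rw [add_sub_cancel] at hp
    obtain ⟨t, ht⟩ := kuniq β hβ _ hp
    have h1 := (hk β hβ).2
    have h2 := (hk r hr).2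
    have h2 := (hk _ hb).2
    have h3 := D.hpos
    have a : -2 < t := by by_contra h; nlinarith
    have b : t < 1 := by by_contra h; nlinarith
    have : t = -1 ∨ t = 0 := by omega
    rcases this with rfl | rfl
    · right; linarith
    · left; linarith
  let Dec : E → Prop := fun β => ∃ r ∈ R, ⟪r, β⟫ = 1 ∧ k r + k (β - r) = k β
  -- induction principle
  have induct : ∀ P : E → Prop, (∀ β ∈ R, ¬ Dec β → P β) → (∀ r s, P r → P s → P (r + s)) →
      ∀ β ∈ R, P β := by
    intro P hP1 hP2
    have : ∀ n : ℕ, ∀ β ∈ R, k β ≤ n → P β := by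
      intro n
      induction n with
      | zero =>
        intro β hβ h
        have := (hk β hβ).2.1
        push_cast at h
        omega
      | succ n ih =>
        intro β hβ h
        by_cases hd : Dec β
        · obtain ⟨r, hr, h1, h2⟩ := hd
          have hb := hsub β hβ r hr h1
          have a1 := (hk r hr).2.1
          have a2 := (hk _ hb).2.1
          push_cast at h
          have := hP2 r (β - r) (ih r hr (by omega)) (ih _ hb (by omega))
          rwa [add_sub_cancel] at this
        · exact hP1 β hβ hd
    intro β hβ
    exact this (k β).toNat β hβ (by omega)
  let f : E → ℝ := fun r => 2 * (k r : ℝ) - D.h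
  let Y : E := ∑ r ∈ R, f r • r
  have hY : ∀ β ∈ R, ¬ Dec β → ⟪β, Y⟫ = (R.card : ℝ) / 6 * k β - 4 * D.h := by
    intro β hβ hd
    have hbb : ⟪β, β⟫ = 2 := by rw [real_inner_self_eq_norm_sq, hn2 β hβ]
    have e1 : ⟪β, Y⟫ = ∑ r ∈ R, f r * ⟪r, β⟫ := by
      rw [inner_sum]
      refine Finset.sum_congr rfl fun r _ => ?_
      rw [inner_smul_right, real_inner_comm]
    rw [e1, rootsum R hneg hn2 hIntg f ?_ β hβ]
    · have e2 := rootpair R hn2 β hβ (hsub β hβ) f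
      have e3 : 2 * ∑ r ∈ R with ⟪r, β⟫ = 1, f r = ∑ r ∈ R with ⟪r, β⟫ = 1, (2 * (k β : ℝ)) := by
        rw [two_mul]
        nth_rewrite 2 [e2]
        rw [← Finset.sum_add_distrib]
        refine Finset.sum_congr rfl fun r hr => ?_
        rw [Finset.mem_filter] at hr
        rcases kadd β hβ r hr.1 hr.2 with h | h
        · exact absurd ⟨r, hr.1, hr.2, h⟩ hd
        · have : (k r : ℝ) + k (β - r) = k β + D.h := by exact_mod_cast h
          simp only [f]
          linarith
      have e4 := rootsum R hneg hn2 hIntg (fun r => ⟪r, β⟫) (fun r _ => by rw [inner_neg_left]) β hβ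
      have e5 : ∑ r ∈ R with ⟪r, β⟫ = 1, ⟪r, β⟫ = ∑ r ∈ R with ⟪r, β⟫ = 1, (1 : ℝ) :=
        Finset.sum_congr rfl fun r hr => (Finset.mem_filter.1 hr).2
      have e6 := venkov hn hM R hR β
      have e7 : ∑ r ∈ R, ⟪r, β⟫ ^ 2 = ∑ r ∈ R, ⟪r, β⟫ * ⟪r, β⟫ :=
        Finset.sum_congr rfl fun r hr => sq _
      rw [e7, e4, e5, hbb, hn2 β hβ] at e6
      rw [e3]
      simp only [Finset.sum_const, nsmul_eq_mul, mul_one] at e6 ⊢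
      simp only [f]
      linear_combination (k β : ℝ) / 24 * e6
    · intro r hr
      simp only [f, kneg r hr]
      push_cast
      ring
  have kone : ∀ v ∈ Λ, ‖v - D.c‖ ^ 2 = 2 → v - D.c ∈ R ∧ k (v - D.c) = 1 := by
    intro v hv h2
    have h1 := D.PP_vert hv h2
    have hr : v - D.c ∈ R := (hR _).2 ⟨⟨1, h1⟩, h2⟩
    refine ⟨hr, ?_⟩
    obtain ⟨t, ht⟩ := kuniq _ hr 1 h1
    have h3 := (hk _ hr).2
    have h4 := D.hpos
    have a : -1 < t := by by_contra h; nlinarith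
    have b : t < 1 := by by_contra h; nlinarith
    obtain rfl : t = 0 := by omega
    linarith
  have notdec : ∀ β ∈ R, k β = 1 → ¬ Dec β := by
    rintro β hβ h1 ⟨r, hr, h2, h3⟩
    have a1 := (hk r hr).2.1
    have a2 := (hk _ (hsub β hβ r hr h2)).2.1
    omega
  have hcard : (R.card : ℝ) / 6 = 4 * D.h := by
    have e1 : ∑ i ∈ S, m i * ⟪V i - D.c, Y⟫ = 0 := by
      have : ⟪∑ i ∈ S, m i • (V i - D.c), Y⟫ = 0 := by rw [hsum, inner_zero_left]
      rw [sum_inner] at this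
      rw [← this]
      refine Finset.sum_congr rfl fun i _ => ?_
      rw [inner_smul_left]; simp
    have e2 : ∑ i ∈ S, m i * ⟪V i - D.c, Y⟫ = ∑ i ∈ S, m i * ((R.card : ℝ) / 6 - 4 * D.h) := by
      refine Finset.sum_congr rfl fun i hi => ?_
      by_cases h0 : m i = 0
      · rw [h0]; simp
      · obtain ⟨a1, a2⟩ := kone _ (hV i hi h0).1 (hV i hi h0).2
        rw [hY _ a1 (notdec _ a1 a2), a2]; simp
    rw [e2, ← Finset.sum_mul] at e1
    rcases mul_eq_zero.1 e1 with h | h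
    · exact absurd h hm0.ne'
    · linarith
  have hYnn : ∀ β ∈ R, 0 ≤ ⟪β, Y⟫ := by
    apply induct
    · intro β hβ hd
      rw [hY β hβ hd, hcard]
      have : (1 : ℝ) ≤ k β := by exact_mod_cast (hk β hβ).2.1
      have := D.hR
      nlinarith
    · intro r s hr hs
      rw [inner_add_left]; linarith
  have kind : ∀ β ∈ R, ¬ Dec β → k β = 1 := by
    intro β hβ hd
    have h1 := hYnn _ (hneg β hβ)
    rw [inner_neg_left, hY β hβ hd, hcard] at h1
    have h2 : (k β : ℝ) ≤ 1 := by
      have := D.hR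
      by_contra h
      nlinarith
    have h2' : k β ≤ 1 := by exact_mod_cast h2
    have := (hk β hβ).2.1
    omega
  have hpn : ∀ β ∈ R, ⟪β, p⟫ ≤ 0 := by
    apply induct
    · intro β hβ hd
      have h1 := kind β hβ hd
      have h2 := (hk β hβ).1
      rw [h1] at h2
      have h3 := h2.1
      simp only [Int.cast_one, one_smul] at h3
      have := hp _ h3 (by rw [add_sub_cancel_right]; exact hn2 β hβ)
      rwa [add_sub_cancel_right] at this
    · intro r s hr hs
      rw [inner_add_left]; linarith
  have hp0 : ∀ β ∈ R, ⟪β, p⟫ = 0 := by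
    intro β hβ
    have := hpn _ (hneg β hβ)
    rw [inner_neg_left] at this
    linarith [hpn β hβ]
  have hfinal := venkov hn hM R hR p
  rw [Finset.sum_eq_zero (fun r hr => by rw [hp0 r hr]; norm_num)] at hfinal
  have hRc : 0 < (R.card : ℝ) := by
    have := D.hR
    linarith
  have : ‖p‖ ^ 2 = 0 := by
    by_contra h
    have h1 : 0 < ‖p‖ ^ 2 := by positivity
    have := mul_pos hRc h1
    linarith
  simpa using this
end HD
end Cov

end

section
namespace Cov
open scoped RealInnerProductSpace Topology
open Filter

lemma even_form {ι : Type*} (B : ι → ι → ℤ) (hs : ∀ i j, B i j = B j i) (hd : ∀ i, Even (B i i))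
    (m : ι → ℤ) (S : Finset ι) : Even (∑ i ∈ S, ∑ j ∈ S, m i * m j * B i j) := by
  classical
  induction S using Finset.induction_on with
  | empty => simp
  | insert a S ha ih =>
    rw [Finset.sum_insert ha, Finset.sum_insert ha]
    have : ∑ i ∈ S, ∑ j ∈ insert a S, m i * m j * B i j =
        (∑ j ∈ S, m a * m j * B a j) + ∑ i ∈ S, ∑ j ∈ S, m i * m j * B i j := by
      rw [← Finset.sum_add_distrib]
      refine Finset.sum_congr rfl fun i _ => ?_
      rw [Finset.sum_insert ha, hs i a]
      ring
    rw [this]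
    have h2 : Even (m a * m a * B a a) := (hd a).mul_left _
    have : m a * m a * B a a + ∑ j ∈ S, m a * m j * B a j + (∑ j ∈ S, m a * m j * B a j + ∑ i ∈ S, ∑ j ∈ S, m i * m j * B i j) = m a * m a * B a a + 2 * (∑ j ∈ S, m a * m j * B a j) + ∑ i ∈ S, ∑ j ∈ S, m i * m j * B i j := by ring
    rw [this]
    exact (h2.add (even_two_mul _)).add ih

lemma comb1 {ι : Type*} (S : Finset ι) (B : ι → ι → ℤ) (β : ι → ℝ) (hβ : ∀ i ∈ S, 0 ≤ β i)
    (hneg : ∑ i ∈ S, ∑ j ∈ S, β i * β j * B i j < 0) :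
    ∃ m : ι → ℕ, ∑ i ∈ S, ∑ j ∈ S, (m i : ℤ) * m j * B i j < 0 := by
  have h1 : Tendsto (fun x : ℝ => ∑ i ∈ S, ∑ j ∈ S, ((⌊β i * x⌋₊ : ℝ) / x) * ((⌊β j * x⌋₊ : ℝ) / x) * B i j)
      atTop (𝓝 (∑ i ∈ S, ∑ j ∈ S, β i * β j * B i j)) := by
    refine tendsto_finsetSum _ fun i hi => tendsto_finsetSum _ fun j hj => ?_
    exact ((tendsto_nat_floor_mul_div_atTop (hβ i hi)).mul
      (tendsto_nat_floor_mul_div_atTop (hβ j hj))).mul_const _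
  obtain ⟨x, hx, hx0⟩ := ((h1.eventually_lt_const hneg).and (eventually_gt_atTop 0)).exists
  refine ⟨fun i => ⌊β i * x⌋₊, ?_⟩
  have e : ∑ i ∈ S, ∑ j ∈ S, ((⌊β i * x⌋₊ : ℝ) / x) * ((⌊β j * x⌋₊ : ℝ) / x) * B i j =
      (∑ i ∈ S, ∑ j ∈ S, (⌊β i * x⌋₊ : ℝ) * ⌊β j * x⌋₊ * B i j) / x ^ 2 := by
    rw [Finset.sum_div]
    refine Finset.sum_congr rfl fun i _ => ?_
    rw [Finset.sum_div]
    refine Finset.sum_congr rfl fun j _ => ?_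
    field_simp
  rw [e, div_lt_iff₀ (by positivity), zero_mul] at hx
  exact_mod_cast hx

lemma comb {ι : Type*} (S : Finset ι) (B : ι → ι → ℤ) (hs : ∀ i j, B i j = B j i)
    (hd : ∀ i, B i i = 2) (hl : ∀ i j, -2 ≤ B i j) (β : ι → ℝ) (hβ : ∀ i ∈ S, 0 ≤ β i)
    (hneg : ∑ i ∈ S, ∑ j ∈ S, β i * β j * B i j < 0) :
    ∃ m : ι → ℕ, 0 < ∑ i ∈ S, m i ∧ ∑ i ∈ S, ∑ j ∈ S, (m i : ℤ) * m j * B i j = 0 ∧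
      ∀ i ∈ S, m i ≠ 0 → ∑ j ∈ S, (m j : ℤ) * B i j = 0 := by
  classical
  let q : (ι → ℕ) → ℤ := fun m => ∑ i ∈ S, ∑ j ∈ S, (m i : ℤ) * m j * B i j
  let b : (ι → ℕ) → ι → ℤ := fun m i => ∑ j ∈ S, (m j : ℤ) * B i j
  have hq0 : ∃ n : ℕ, 0 < n ∧ ∃ m : ι → ℕ, ∑ i ∈ S, m i = n ∧ q m ≤ 0 := by
    obtain ⟨m, hm⟩ := comb1 S B β hβ hneg
    refine ⟨∑ i ∈ S, m i, ?_, m, rfl, hm.le⟩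
    rw [Nat.pos_iff_ne_zero]
    intro h0
    have h1 : ∀ i ∈ S, m i = 0 := by simpa using h0
    rw [Finset.sum_eq_zero] at hm
    · exact lt_irrefl _ hm
    · intro i hi
      rw [h1 i hi]; simp
  obtain ⟨hN0, m, hmN, hqm⟩ := Nat.find_spec hq0
  have hmin := fun n (hn : n < Nat.find hq0) => Nat.find_min hq0 hn
  set N := Nat.find hq0 with hN
  have qb : q m = ∑ i ∈ S, (m i : ℤ) * b m i := by
    refine Finset.sum_congr rfl fun i _ => ?_
    rw [Finset.mul_sum]
    exact Finset.sum_congr rfl fun j _ => by ring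
  have heven : ∀ m : ι → ℕ, Even (q m) := fun m =>
    even_form B hs (fun i => by rw [hd]; exact even_two) (fun i => (m i : ℤ)) S
  have hNz : ∑ i ∈ S, (m i : ℤ) = N := by exact_mod_cast hmN
  -- lower bound
  have hlow : ∀ i ∈ S, 4 * (m i : ℤ) - 2 * N ≤ b m i := by
    intro i hi
    have h1 : ∑ j ∈ S, ((m j : ℤ) * (-2) + if j = i then 4 * (m i : ℤ) else 0) ≤ b m i := by
      refine Finset.sum_le_sum fun j _ => ?_
      by_cases h : j = i
      · subst h; rw [if_pos rfl, hd]; linarith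
      · rw [if_neg h]
        have := hl i j
        have h2 : (0 : ℤ) ≤ m j := by positivity
        nlinarith
    rw [Finset.sum_add_distrib, Finset.sum_ite_eq', if_pos hi, ← Finset.sum_mul, hNz] at h1
    linarith
  -- removing one
  have hrem : 2 ≤ N → ∀ i ∈ S, m i ≠ 0 → 2 * b m i ≤ q m := by
    intro h2 i hi hmi
    let m' : ι → ℕ := Function.update m i (m i - 1)
    have hm' : ∀ j, (m' j : ℤ) = m j - if j = i then 1 else 0 := by
      intro j
      by_cases h : j = i
      · subst h
        simp [m']
        omega
      · simp [m', h]
    have hs' : ∑ j ∈ S, m' j = N - 1 := by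
      have : ∑ j ∈ S, (m' j : ℤ) = N - 1 := by
        simp only [hm', Finset.sum_sub_distrib, Finset.sum_ite_eq', if_pos hi, hNz]
      have h3 : ((∑ j ∈ S, m' j : ℕ) : ℤ) = N - 1 := by exact_mod_cast this
      omega
    have hq' : q m' = q m - 2 * b m i + 2 := by
      have : q m' = ∑ k ∈ S, ∑ j ∈ S, ((m k : ℤ) * m j * B k j - (if k = i then (m j : ℤ) * B i j else 0)
          - (if j = i then (m k : ℤ) * B i k else 0) + if k = i then (if j = i then 2 else 0) else 0) := by
        refine Finset.sum_congr rfl fun k _ => Finset.sum_congr rfl fun j _ => ?_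
        rw [hm', hm']
        by_cases h1 : k = i
        · by_cases h3 : j = i
          · subst h1; subst h3; simp [hd]; ring
          · subst h1; simp [h3]; ring
        · by_cases h3 : j = i
          · subst h3; simp [h1, hs k j]; ring
          · simp [h1, h3]
      rw [this]
      have e3 : ∀ k ∈ S, ∑ j ∈ S, (if k = i then (m j : ℤ) * B i j else 0) = if k = i then b m i else 0 := by
        intro k _
        by_cases h : k = i <;> simp [h, b]
      have e4 : ∀ k ∈ S, ∑ j ∈ S, (if k = i then (if j = i then (2 : ℤ) else 0) else 0) = if k = i then 2 else 0 := by
        intro k _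
        by_cases h : k = i <;> simp [h, hi]
      simp only [Finset.sum_add_distrib, Finset.sum_sub_distrib]
      rw [Finset.sum_congr rfl e3, Finset.sum_congr rfl e4]
      simp only [Finset.sum_ite_eq', if_pos hi]
      simp only [q, b]
      ring
    have hpos : 0 < q m' := by
      by_contra h
      exact hmin (N - 1) (by omega) ⟨by omega, m', hs', by omega⟩
    obtain ⟨t, ht⟩ := heven m'
    obtain ⟨t', ht'⟩ := heven m
    omega
  have hN1 : 2 ≤ N := by
    by_contra h
    have h1 : N = 1 := by omega
    have : ∃ i ∈ S, m i ≠ 0 := by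
      by_contra h3
      push Not at h3
      rw [Finset.sum_eq_zero h3] at hmN
      omega
    obtain ⟨i, hi, hmi⟩ := this
    have hb : ∀ j ∈ S, 2 * (m j : ℤ) ≤ (m j : ℤ) * b m j := by
      intro j hj
      by_cases h0 : m j = 0
      · simp [h0]
      · have := hlow j hj
        have h5 : (1 : ℤ) ≤ m j := by omega
        rw [h1] at this
        push_cast at this
        nlinarith
    have := Finset.sum_le_sum hb
    rw [← qb, ← Finset.mul_sum, hNz] at this
    omega
  have hr := hrem hN1
  have hble : ∀ i ∈ S, m i ≠ 0 → b m i ≤ 0 := fun i hi h => by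
    have := hr i hi h
    linarith
  have hq : q m = 0 := by
    rcases Nat.eq_or_lt_of_le hN1 with h2 | h3
    · rw [qb]
      refine Finset.sum_eq_zero fun i hi => ?_
      by_cases h0 : m i = 0
      · simp [h0]
      · have h4 := hlow i hi
        have h5 := hble i hi h0
        have h6 : (1 : ℤ) ≤ m i := by omega
        rw [← h2] at h4
        push_cast at h4
        have : b m i = 0 := by linarith
        rw [this, mul_zero]
    · have h4 : 2 * q m ≤ N * q m := by
        rw [← hNz, Finset.sum_mul]
        conv_lhs => rw [qb, Finset.mul_sum]
        refine Finset.sum_le_sum fun i hi => ?_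
        by_cases h0 : m i = 0
        · simp [h0]
        · have := hr i hi h0
          have h6 : (0 : ℤ) ≤ m i := by positivity
          nlinarith
      have h5 : (3 : ℤ) ≤ N := by exact_mod_cast h3
      nlinarith
  refine ⟨m, by omega, hq, ?_⟩
  intro i hi h0
  have h1 : ∑ i ∈ S, -((m i : ℤ) * b m i) = 0 := by
    rw [Finset.sum_neg_distrib, ← qb, hq, neg_zero]
  rw [Finset.sum_eq_zero_iff_of_nonneg] at h1
  · have := h1 i hi
    have h3 : (m i : ℤ) * b m i = 0 := by linarith
    rcases mul_eq_zero.1 h3 with h | h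
    · exact absurd (by exact_mod_cast h) h0
    · exact h
  · intro j hj
    by_cases h0 : m j = 0
    · simp [h0]
    · have := hble j hj h0
      have h6 : (0 : ℤ) ≤ m j := by positivity
      nlinarith
end Cov

end

section
namespace Cov
open scoped RealInnerProductSpace Topology
open Filter

variable {E : Type*} [NormedAddCommGroup E] [InnerProductSpace ℝ E] [FiniteDimensional ℝ E]

lemma lat_closed {Λ : Submodule ℤ E} (h : EU Λ) : IsClosed (Λ : Set E) := by
  haveI := h.disc
  haveI : DiscreteTopology Λ.toAddSubgroup := h.disc
  exact AddSubgroup.isClosed_of_discrete (H := Λ.toAddSubgroup)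

lemma nearest {Λ : Submodule ℤ E} (h : EU Λ) (x : E) : ∃ v ∈ Λ, ∀ u ∈ Λ, ‖x - v‖ ≤ ‖x - u‖ := by
  obtain ⟨v, hv, h1⟩ := (lat_closed h).exists_infDist_eq_dist ⟨0, Λ.zero_mem⟩ x
  refine ⟨v, hv, fun u hu => ?_⟩
  have := Metric.infDist_le_dist_of_mem (x := x) hu
  rw [h1, dist_eq_norm, dist_eq_norm] at this
  exact this

lemma deep {Λ : Submodule ℤ E} (h : EU Λ) : ∃ x0 : E, ∀ x : E, ∃ v ∈ Λ, ∀ u ∈ Λ, ‖x - v‖ ≤ ‖x0 - u‖ := by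
  haveI := h.disc
  haveI : IsZLattice ℝ Λ := ⟨h.span⟩
  let b := (Module.Free.chooseBasis ℤ Λ).ofZLatticeBasis ℝ
  have hb : Submodule.span ℤ (Set.range b) = Λ := Module.Basis.ofZLatticeBasis_span ℝ Λ _
  let C := ∑ i, ‖b i‖
  have hC : ∀ x, ‖ZSpan.fract b x‖ ≤ C := fun x => ZSpan.norm_fract_le b x
  have hK : IsCompact (Metric.closedBall (0 : E) C) := isCompact_closedBall _ _
  have hne : (Metric.closedBall (0 : E) C).Nonempty := ⟨ZSpan.fract b 0, by simpa using hC 0⟩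
  obtain ⟨x0, -, hx0⟩ := hK.exists_isMaxOn hne (Metric.continuous_infDist_pt (Λ : Set E)).continuousOn
  refine ⟨x0, fun x => ?_⟩
  obtain ⟨v, hv, hv2⟩ := (lat_closed h).exists_infDist_eq_dist ⟨0, Λ.zero_mem⟩ (ZSpan.fract b x)
  have hfl : (ZSpan.floor b x : E) ∈ Λ := hb.le (ZSpan.floor b x).2
  refine ⟨v + ZSpan.floor b x, add_mem hv hfl, fun u hu => ?_⟩
  have h1 : x - (v + ZSpan.floor b x) = ZSpan.fract b x - v := by
    rw [ZSpan.fract_apply]; abel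
  rw [h1, ← dist_eq_norm, ← hv2, ← dist_eq_norm]
  have h2 : Metric.infDist (ZSpan.fract b x) (Λ : Set E) ≤ Metric.infDist x0 Λ :=
    hx0 (by simpa using hC x)
  exact h2.trans (Metric.infDist_le_dist_of_mem hu)

lemma deep_conv {Λ : Submodule ℤ E} (h : EU Λ) : ∃ (x0 : E) (R : ℝ) (S : Finset E) (β : E → ℝ),
    0 ≤ R ∧ (∀ x : E, ∃ v ∈ Λ, ‖x - v‖ ≤ R) ∧ (∀ v ∈ Λ, R ≤ ‖x0 - v‖) ∧
    (∀ v ∈ S, v ∈ Λ ∧ ‖x0 - v‖ = R) ∧ (∀ v ∈ S, 0 ≤ β v) ∧ ∑ v ∈ S, β v = 1 ∧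
    ∑ v ∈ S, β v • v = x0 := by
  classical
  obtain ⟨x0, hx0⟩ := deep h
  obtain ⟨v0, hv0, hmin⟩ := nearest h x0
  set R := ‖x0 - v0‖ with hR
  have hR0 : 0 ≤ R := norm_nonneg _
  have hfar : ∀ x : E, ∃ v ∈ Λ, ‖x - v‖ ≤ R := fun x => by
    obtain ⟨v, hv, h1⟩ := hx0 x
    exact ⟨v, hv, h1 v0 hv0⟩
  have hTf : {v | v ∈ Λ ∧ ‖x0 - v‖ ≤ R + 1}.Finite := by
    refine (ball_finite h ((‖x0‖ + R + 1) ^ 2)).subset fun v hv => ⟨hv.1, ?_⟩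
    have : ‖v‖ ≤ ‖x0‖ + R + 1 := by
      have h1 : v = x0 - (x0 - v) := by abel
      calc ‖v‖ = ‖x0 - (x0 - v)‖ := by rw [← h1]
        _ ≤ ‖x0‖ + ‖x0 - v‖ := norm_sub_le _ _
        _ ≤ _ := by linarith [hv.2]
    have h0 := norm_nonneg v
    gcongr
  let T : Finset E := hTf.toFinset
  have hT : ∀ v, v ∈ T ↔ v ∈ Λ ∧ ‖x0 - v‖ ≤ R + 1 := fun v => by simp [T]
  let S := T.filter fun v => ‖x0 - v‖ = R
  have hS : ∀ v ∈ S, v ∈ Λ ∧ ‖x0 - v‖ = R := fun v hv => by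
    rw [Finset.mem_filter, hT] at hv
    exact ⟨hv.1.1, hv.2⟩
  have hconv : x0 ∈ convexHull ℝ (S : Set E) := by
    by_contra hcon
    obtain ⟨f, u, hf1, hf2⟩ := geometric_hahn_banach_closed_point (convex_convexHull ℝ (S : Set E))
      (S.finite_toSet.isClosed_convexHull (𝕜 := ℝ)) hcon
    let g := (InnerProductSpace.toDual ℝ E).symm f
    have hg : ∀ x, ⟪g, x⟫ = f x := fun x => InnerProductSpace.toDual_symm_apply
    have hev : ∀ v ∈ T, ∀ᶠ t : ℝ in 𝓝[>] 0, R < ‖x0 + t • g - v‖ := by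
      intro v hv
      have hv' := (hT v).1 hv
      rcases (hmin v hv'.1).lt_or_eq with h1 | h1
      · have hc : Continuous fun t : ℝ => ‖x0 + t • g - v‖ := by fun_prop
        have h2 : ∀ᶠ t : ℝ in 𝓝 0, R < ‖x0 + t • g - v‖ := by
          apply hc.continuousAt.eventually_const_lt
          simpa using h1
        exact h2.filter_mono nhdsWithin_le_nhds
      · have hvS : v ∈ S := Finset.mem_filter.2 ⟨hv, h1.symm⟩
        filter_upwards [self_mem_nhdsWithin] with t ht
        have ht0 : (0 : ℝ) < t := ht
        have h2 : f v < f x0 := (hf1 v (subset_convexHull ℝ _ hvS)).trans hf2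
        have h3 : 0 < ⟪x0 - v, g⟫ := by
          rw [real_inner_comm, hg, map_sub]; linarith
        have h4 : ‖x0 + t • g - v‖ ^ 2 = R ^ 2 + 2 * t * ⟪x0 - v, g⟫ + ‖t • g‖ ^ 2 := by
          rw [show x0 + t • g - v = (x0 - v) + t • g by abel, norm_add_sq_real, inner_smul_right, ← h1]
          ring
        have h5 : 0 < t * ⟪x0 - v, g⟫ := mul_pos ht0 h3
        refine lt_of_pow_lt_pow_left₀ 2 (norm_nonneg _) ?_
        nlinarith [sq_nonneg ‖t • g‖]
    have hev1 : ∀ᶠ t : ℝ in 𝓝[>] 0, ∀ v ∈ T, R < ‖x0 + t • g - v‖ := by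
      rw [eventually_all_finset]; exact hev
    have hev2 : ∀ᶠ t : ℝ in 𝓝[>] 0, ‖t • g‖ < 1 := by
      have hc : Continuous fun t : ℝ => ‖t • g‖ := by fun_prop
      have h2 : ∀ᶠ t : ℝ in 𝓝 0, ‖t • g‖ < 1 := by
        apply hc.continuousAt.eventually_lt_const
        simp
      exact h2.filter_mono nhdsWithin_le_nhds
    obtain ⟨t, ht1, ht2⟩ := (hev1.and hev2).exists
    obtain ⟨v, hv, h1⟩ := hfar (x0 + t • g)
    have : v ∈ T := by
      rw [hT]
      refine ⟨hv, ?_⟩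
      calc ‖x0 - v‖ = ‖(x0 + t • g - v) - t • g‖ := by congr 1; abel
        _ ≤ _ := norm_sub_le _ _
        _ ≤ _ := by linarith
    exact absurd h1 (not_le.2 (ht1 v this))
  rw [Finset.mem_convexHull'] at hconv
  obtain ⟨β, hβ, h1, h2⟩ := hconv
  exact ⟨x0, R, S, β, hR0, hfar, hmin, hS, hβ, h1, h2⟩

lemma mkHD {Λ : Submodule ℤ E} (h : EU Λ) (h2 : ∀ v ∈ Λ, ‖v‖ ^ 2 ≠ 2) (a : E) (H l : ℤ) (ha : a ∈ Λ)
    (hH : 0 < H) (hnull : ‖a‖ ^ 2 = 2 * H * l) : ∃ D : HD Λ, D.c = (1 / (H : ℝ)) • a := by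
  let I : Ideal ℤ :=
    { carrier := {z | ∃ v ∈ Λ, ∃ k n : ℤ, ⟪v, a⟫ - k * l - n * H = z}
      add_mem' := by
        rintro z z' ⟨v, hv, k, n, e⟩ ⟨v', hv', k', n', e'⟩
        refine ⟨v + v', add_mem hv hv', k + k', n + n', ?_⟩
        rw [inner_add_left]
        push_cast
        linarith
      zero_mem' := ⟨0, Λ.zero_mem, 0, 0, by simp⟩
      smul_mem' := by
        rintro c z ⟨v, hv, k, n, e⟩
        refine ⟨c • v, Λ.smul_mem _ hv, c * k, c * n, ?_⟩
        rw [← Int.cast_smul_eq_zsmul ℝ, inner_smul_left]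
        simp only [conj_trivial, smul_eq_mul]
        push_cast
        rw [← e]; ring }
  obtain ⟨d0, hd0⟩ := (IsPrincipalIdealRing.principal I).principal
  have hmem : ∀ z, z ∈ I ↔ d0 ∣ z := by
    intro z
    rw [hd0, ← Ideal.span, Ideal.mem_span_singleton]
  have hHI : H ∈ I := ⟨0, Λ.zero_mem, 0, -1, by simp⟩
  have hlI : l ∈ I := ⟨0, Λ.zero_mem, -1, 0, by simp⟩
  have hd00 : d0 ≠ 0 := by
    rintro rfl
    have := (hmem H).1 hHI
    rw [zero_dvd_iff] at this
    omega
  set d : ℤ := |d0| with hd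
  have hdpos : 0 < d := abs_pos.2 hd00
  have hmem' : ∀ z, z ∈ I ↔ d ∣ z := fun z => by rw [hmem, hd, abs_dvd]
  obtain ⟨H0, hH0⟩ := (hmem' H).1 hHI
  obtain ⟨l0, hl0⟩ := (hmem' l).1 hlI
  have hdR : (0 : ℝ) < d := by exact_mod_cast hdpos
  have hH0p : 0 < H0 := by
    by_contra h0
    nlinarith
  have haI : (1 / (d : ℝ)) • a ∈ Λ := by
    apply h.dual
    intro v hv
    obtain ⟨z, hz⟩ := h.inner_int hv ha
    have : z ∈ I := ⟨v, hv, 0, 0, by simp [hz]⟩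
    obtain ⟨z0, hz0⟩ := (hmem' z).1 this
    refine ⟨z0, ?_⟩
    rw [inner_smul_left, real_inner_comm, hz, hz0]
    simp only [conj_trivial]
    push_cast
    field_simp
  have hHR : (H : ℝ) = d * H0 := by exact_mod_cast hH0
  have hlR : (l : ℝ) = d * l0 := by exact_mod_cast hl0
  obtain ⟨v, hv, k, n, e⟩ := (hmem' d).2 dvd_rfl
  refine ⟨⟨(1 / (d : ℝ)) • a, H0, l0, h, h2, haI, hH0p, ?_, v, hv, k, n, ?_⟩, ?_⟩
  · rw [norm_smul, mul_pow, hnull, hHR, hlR, Real.norm_eq_abs, sq_abs]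
    field_simp
  · rw [inner_smul_right]
    rw [hHR, hlR] at e
    field_simp
    linarith
  · have : (0 : ℝ) < H0 := by exact_mod_cast hH0p
    simp only [HD.c]
    rw [smul_smul, hHR]
    congr 1
    field_simp

theorem cov (hn : Module.finrank ℝ E = 24) {Λ : Submodule ℤ E} (h : EU Λ)
    (h2 : ∀ v ∈ Λ, ‖v‖ ^ 2 ≠ 2) (x : E) : ∃ v ∈ Λ, ‖x - v‖ ^ 2 ≤ 2 := by
  classical
  obtain ⟨x0, R, S, β, hR0, hfar, hmin, hS, hβ, hβ1, hβx⟩ := deep_conv h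
  suffices hR : R ^ 2 ≤ 2 by
    obtain ⟨v, hv, h1⟩ := hfar x
    refine ⟨v, hv, le_trans ?_ hR⟩
    gcongr
  by_contra hR
  push Not at hR
  -- distances at most 8
  have h8 : ∀ v ∈ S, ∀ w ∈ S, ‖v - w‖ ^ 2 ≤ 8 := by
    intro v hv w hw
    have hmin2 : ∀ u ∈ Λ, R ^ 2 ≤ ‖x0 - u‖ ^ 2 := fun u hu => by
      have := hmin u hu
      gcongr
    obtain ⟨hvΛ, hvR⟩ := hS v hv
    obtain ⟨hwΛ, hwR⟩ := hS w hw
    have key : ∀ u ∈ Λ, ⟪v - w, u⟫ ≤ ‖u‖ ^ 2 := by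
      intro u hu
      have a1 := hmin2 (v - u) (sub_mem hvΛ hu)
      have a2 := hmin2 (w + u) (add_mem hwΛ hu)
      rw [show x0 - (v - u) = (x0 - v) + u by abel, norm_add_sq_real, hvR] at a1
      rw [show x0 - (w + u) = (x0 - w) - u by abel, norm_sub_sq_real, hwR] at a2
      have : ⟪v - w, u⟫ = ⟪x0 - w, u⟫ - ⟪x0 - v, u⟫ := by
        rw [← inner_sub_left]; congr 1; abel
      linarith
    obtain ⟨s, hs, t, ht, e, hs8⟩ := mod2 hn h h2 (v - w) (sub_mem hvΛ hwΛ)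
    have e2 : s = (v - w) - (2 : ℝ) • t := by rw [e]; abel
    have e3 := norm_sub_sq_real (v - w) ((2 : ℝ) • t)
    rw [← e2, inner_smul_right, norm_smul, mul_pow] at e3
    have := key t ht
    norm_num at e3
    linarith
  choose Nn hNn using fun v : S => h.even v (hS v v.2).1
  have hBex : ∀ v w : S, ∃ n : ℤ, 2 - ‖(v : E) - w‖ ^ 2 / 2 = n := by
    intro v w
    obtain ⟨n, hn⟩ := h.even (v - w : E) (sub_mem (hS v v.2).1 (hS w w.2).1)
    exact ⟨2 - n, by rw [hn]; push_cast; ring⟩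
  choose B hB using hBex
  have hin : ∀ v w : S, ⟪(v : E), (w : E)⟫ = Nn v - 1 + (Nn w - 1) + B v w := by
    intro v w
    have := norm_sub_sq_real (v : E) w
    rw [hNn, hNn] at this
    rw [← hB]
    linarith
  have hcomb := comb (Finset.univ : Finset S) B
    (by intro v w
        have : (B v w : ℝ) = B w v := by rw [← hB, ← hB, norm_sub_rev]
        exact_mod_cast this)
    (by intro v
        have : (B v v : ℝ) = 2 := by rw [← hB]; simp
        exact_mod_cast this)
    (by intro v w
        have : (-2 : ℝ) ≤ B v w := by
          rw [← hB]
          linarith [h8 v v.2 w w.2]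
        exact_mod_cast this)
    (fun v => β v) (fun v _ => hβ v v.2)
    (by
      have e0 : ∑ v : S, β v • (x0 - v : E) = 0 := by
        simp only [smul_sub, Finset.sum_sub_distrib]
        rw [← Finset.sum_smul, Finset.sum_coe_sort S β, hβ1,
          Finset.sum_coe_sort S (fun v => β v • v), hβx]
        simp
      have e1 : ∀ v w : S, (B v w : ℝ) = 2 - R ^ 2 + ⟪x0 - v, (x0 - w : E)⟫ := by
        intro v w
        rw [← hB]
        have := norm_sub_sq_real (x0 - v : E) (x0 - w)
        rw [(hS v v.2).2, (hS w w.2).2, show (x0 - v : E) - (x0 - w) = -(v - w) by abel, norm_neg] at this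
        linarith
      have e2 : ∑ i : S, ∑ j : S, β i * β j * (B i j : ℝ) = 2 - R ^ 2 := by
        have s1 : ∑ v : S, β v = 1 := by rw [Finset.sum_coe_sort S β, hβ1]
        have e3 : ∑ i : S, ∑ j : S, β i * β j * ⟪x0 - i, (x0 - j : E)⟫ = 0 := by
          have : ⟪∑ v : S, β v • (x0 - v : E), ∑ v : S, β v • (x0 - v : E)⟫ = 0 := by rw [e0]; simp
          rw [sum_inner] at this
          rw [← this]
          refine Finset.sum_congr rfl fun i _ => ?_
          rw [inner_sum]
          refine Finset.sum_congr rfl fun j _ => ?_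
          rw [inner_smul_left, inner_smul_right]; simp; ring
        have : ∑ i : S, ∑ j : S, β i * β j * (B i j : ℝ) =
            (∑ i : S, β i) * (∑ j : S, β j) * (2 - R ^ 2) +
            ∑ i : S, ∑ j : S, β i * β j * ⟪x0 - i, (x0 - j : E)⟫ := by
          rw [Finset.sum_mul_sum, Finset.sum_mul, ← Finset.sum_add_distrib]
          refine Finset.sum_congr rfl fun i _ => ?_
          rw [Finset.sum_mul, ← Finset.sum_add_distrib]
          refine Finset.sum_congr rfl fun j _ => ?_
          rw [e1]; ring
        rw [this, e3, s1]; ring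
      rw [e2]; linarith)
  obtain ⟨m, hm0, hq, hb⟩ := hcomb
  let a : E := ∑ v : S, (m v : ℝ) • (v : E)
  let H : ℤ := ∑ v : S, (m v : ℤ)
  let l : ℤ := ∑ v : S, (m v : ℤ) * (Nn v - 1)
  have haΛ : a ∈ Λ := by
    refine Submodule.sum_mem _ fun v _ => ?_
    rw [Nat.cast_smul_eq_nsmul]
    exact Λ.smul_of_tower_mem _ (hS v v.2).1
  have hH : 0 < H := by
    have : ((∑ v : S, m v : ℕ) : ℤ) = H := by push_cast; rfl
    omega
  have hHr : (H : ℝ) = ∑ v : S, (m v : ℝ) := by simp [H]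
  have hlr : (l : ℝ) = ∑ v : S, (m v : ℝ) * (Nn v - 1) := by simp [l]
  have hHR : (0 : ℝ) < H := by exact_mod_cast hH
  have hva : ∀ v : S, ⟪(v : E), a⟫ = H * (Nn v - 1) + l + (∑ w : S, (m w : ℤ) * B v w : ℤ) := by
    intro v
    rw [inner_sum]
    simp only [inner_smul_right, hin]
    push_cast
    rw [hHr, hlr, Finset.sum_mul, ← Finset.sum_add_distrib, ← Finset.sum_add_distrib]
    exact Finset.sum_congr rfl fun w _ => by ring
  have hnull : ‖a‖ ^ 2 = 2 * H * l := by
    have e1 : ‖a‖ ^ 2 = ∑ v : S, (m v : ℝ) * ⟪(v : E), a⟫ := by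
      rw [← real_inner_self_eq_norm_sq]
      conv_lhs => rw [sum_inner]
      refine Finset.sum_congr rfl fun v _ => ?_
      rw [inner_smul_left]; simp
    have hqr : ∑ v : S, (m v : ℝ) * ((∑ w : S, (m w : ℤ) * B v w : ℤ) : ℝ) = 0 := by
      have : ∑ v : S, (m v : ℤ) * (∑ w : S, (m w : ℤ) * B v w) = 0 := by
        rw [← hq]
        refine Finset.sum_congr rfl fun i _ => ?_
        rw [Finset.mul_sum]
        exact Finset.sum_congr rfl fun j _ => by ring
      exact_mod_cast this
    rw [e1]
    calc _ = ∑ v : S, (H * ((m v : ℝ) * (Nn v - 1)) + l * m v + (m v : ℝ) * ((∑ w : S, (m w : ℤ) * B v w : ℤ) : ℝ)) := by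
          refine Finset.sum_congr rfl fun v _ => ?_
          rw [hva]; ring
      _ = _ := by
          rw [Finset.sum_add_distrib, Finset.sum_add_distrib, hqr, ← Finset.mul_sum, ← Finset.mul_sum,
            ← hHr, ← hlr]
          ring
  obtain ⟨D, hD⟩ := mkHD h h2 a H l haΛ hH hnull
  have hca : (H : ℝ) • D.c = a := by
    rw [hD, smul_smul, mul_one_div_cancel hHR.ne', one_smul]
  have hvert : ∀ v : S, m v ≠ 0 → ‖(v : E) - D.c‖ ^ 2 = 2 := by
    intro v hv
    have e1 := hva v
    rw [hb v (Finset.mem_univ _) hv] at e1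
    rw [norm_sub_sq_real, hNn]
    have e2 : ⟪(v : E), a⟫ = H * ⟪(v : E), D.c⟫ := by
      rw [← inner_smul_right, hca]
    have e3 : (H : ℝ) ^ 2 * ‖D.c‖ ^ 2 = 2 * H * l := by
      rw [← hnull, ← hca, norm_smul, mul_pow, Real.norm_eq_abs, sq_abs]
    have e4 : (H : ℝ) * ‖D.c‖ ^ 2 = 2 * l := by
      apply mul_left_cancel₀ hHR.ne'
      linarith
    rw [e2] at e1
    push_cast at e1
    apply mul_left_cancel₀ hHR.ne'
    linarith
  have hzero : ∑ v : S, (m v : ℝ) • ((v : E) - D.c) = 0 := by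
    simp only [smul_sub, Finset.sum_sub_distrib]
    rw [← Finset.sum_smul, ← hHr, hca]
    exact sub_self a
  have hRp : R ^ 2 = ‖x0 - D.c‖ ^ 2 + 2 := by
    have e1 : ∑ v : S, (m v : ℝ) * ⟪(v : E) - D.c, x0 - D.c⟫ = 0 := by
      have : ⟪∑ v : S, (m v : ℝ) • ((v : E) - D.c), x0 - D.c⟫ = 0 := by rw [hzero, inner_zero_left]
      rw [sum_inner] at this
      rw [← this]
      refine Finset.sum_congr rfl fun v _ => ?_
      rw [inner_smul_left]; simp
    have e2 : ∀ v : S, (m v : ℝ) * R ^ 2 = m v * (‖x0 - D.c‖ ^ 2 + 2) - 2 * ((m v : ℝ) * ⟪(v : E) - D.c, x0 - D.c⟫) := by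
      intro v
      by_cases h0 : m v = 0
      · simp [h0]
      · have := norm_sub_sq_real (x0 - D.c) (v - D.c)
        rw [hvert v h0, show (x0 - D.c) - ((v : E) - D.c) = x0 - v by abel, (hS v v.2).2, real_inner_comm] at this
        rw [this]; ring
    have e3 : (H : ℝ) * R ^ 2 = H * (‖x0 - D.c‖ ^ 2 + 2) := by
      rw [hHr, Finset.sum_mul, Finset.sum_mul]
      calc _ = ∑ v : S, ((m v : ℝ) * (‖x0 - D.c‖ ^ 2 + 2) - 2 * ((m v : ℝ) * ⟪(v : E) - D.c, x0 - D.c⟫)) :=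
            Finset.sum_congr rfl fun v _ => e2 v
        _ = _ := by rw [Finset.sum_sub_distrib, ← Finset.mul_sum, e1]; ring
    exact mul_left_cancel₀ hHR.ne' e3
  have hp := D.hole_main hn (Finset.univ : Finset S) (fun v => (m v : ℝ)) (fun v => (v : E))
    (fun v _ => by positivity) (by rw [← hHr]; exact hHR)
    (fun v _ hv => ⟨(hS v v.2).1, hvert v (by simpa using hv)⟩) hzero (x0 - D.c) (by
      intro v hv hv2
      have a1 := hmin v hv
      have a2 : R ^ 2 ≤ ‖x0 - v‖ ^ 2 := by gcongr
      have := norm_sub_sq_real (x0 - D.c) (v - D.c)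
      rw [hv2, show (x0 - D.c) - ((v : E) - D.c) = x0 - v by abel, real_inner_comm] at this
      linarith)
  rw [hp] at hRp
  simp at hRp
  linarith
end Cov

end

section
namespace Bimonster
open ComplexConjugate

lemma om_eq : ω = -1 / 2 + (Real.sqrt 3 / 2 : ℝ) * Complex.I := by
  have h : (2 * (Real.pi : ℂ) * Complex.I / 3) = ((2 * Real.pi / 3 : ℝ) : ℂ) * Complex.I := by
    push_cast; ring
  rw [ω, h, Complex.exp_mul_I, ← Complex.ofReal_cos, ← Complex.ofReal_sin,
    show 2 * Real.pi / 3 = Real.pi - Real.pi / 3 by ring, Real.cos_pi_sub, Real.sin_pi_sub,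
    Real.cos_pi_div_three, Real.sin_pi_div_three]
  push_cast; ring

lemma om_re : ω.re = -1 / 2 := by rw [om_eq]; simp [Complex.add_re]
lemma om_im : ω.im = Real.sqrt 3 / 2 := by rw [om_eq]; simp [Complex.add_im]

lemma om_sq : ω ^ 2 = -1 - ω := by
  have h3 : Real.sqrt 3 * Real.sqrt 3 = 3 := Real.mul_self_sqrt (by norm_num)
  apply Complex.ext
  · simp [sq, om_re, om_im]; linarith
  · simp [sq, om_re, om_im]; ring

lemma om_mul : ω * ω = -1 - ω := by rw [← sq, om_sq]

lemma om_conj : conj ω = -1 - ω := by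
  apply Complex.ext
  · simp [om_re]; norm_num
  · simp [om_im]

lemma th_eq : θ = 1 + 2 * ω := by rw [θ, om_conj]; ring

lemma th_sq : θ * θ = -3 := by
  rw [th_eq]; linear_combination 4 * om_sq

lemma th_conj : conj θ = -θ := by
  rw [θ]; simp

lemma th_ne : θ ≠ 0 := by
  intro h
  have := th_sq
  rw [h] at this
  norm_num at this

lemma qc_eq : qc = -1 + ω := by
  rw [qc, th_eq]; linear_combination (-1 - 2 * ω + 2) * om_sq

/-- Embedding of pairs of integers. -/
def toC (z : ℤ × ℤ) : ℂ := z.1 + z.2 * ω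

def eadd (z w : ℤ × ℤ) : ℤ × ℤ := (z.1 + w.1, z.2 + w.2)
def emul (z w : ℤ × ℤ) : ℤ × ℤ := (z.1 * w.1 - z.2 * w.2, z.1 * w.2 + z.2 * w.1 - z.2 * w.2)
def econj (z : ℤ × ℤ) : ℤ × ℤ := (z.1 - z.2, -z.2)
def eneg (z : ℤ × ℤ) : ℤ × ℤ := (-z.1, -z.2)

lemma toC_add (z w) : toC (eadd z w) = toC z + toC w := by
  simp only [toC, eadd]; push_cast; ring
lemma toC_mul (z w) : toC (emul z w) = toC z * toC w := by
  simp only [toC, emul]; push_cast; linear_combination (-(z.2 : ℂ) * w.2) * om_sq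
lemma toC_conj (z) : toC (econj z) = conj (toC z) := by
  simp only [toC, econj]; simp [om_conj]; ring
lemma toC_neg (z) : toC (eneg z) = - toC z := by
  simp only [toC, eneg]; push_cast; ring
lemma toC_zero : toC (0, 0) = 0 := by simp [toC]

lemma toC_inj {z w : ℤ × ℤ} (h : toC z = toC w) : z = w := by
  have h1 := congrArg Complex.im h
  have h2 := congrArg Complex.re h
  simp [toC, om_re, om_im] at h1 h2
  have h3 : Real.sqrt 3 ≠ 0 := by positivity
  have h4 : z.2 = w.2 := h1
  rw [h4] at h2
  have h5 : z.1 = w.1 := by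
    have : (z.1 : ℝ) = w.1 := by linarith
    exact_mod_cast this
  exact Prod.ext h5 h4

lemma EisP_iff (z : ℂ) : EisP z ↔ ∃ w, z = toC w :=
  ⟨fun ⟨a, b, h⟩ => ⟨(a, b), h⟩, fun ⟨w, h⟩ => ⟨w.1, w.2, h⟩⟩

lemma EisP.toC (z) : EisP (toC z) := (EisP_iff _).2 ⟨z, rfl⟩
lemma EisP.add {z w} (hz : EisP z) (hw : EisP w) : EisP (z + w) := by
  rw [EisP_iff] at *
  obtain ⟨a, rfl⟩ := hz; obtain ⟨b, rfl⟩ := hw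
  exact ⟨_, (toC_add a b).symm⟩
lemma EisP.mul {z w} (hz : EisP z) (hw : EisP w) : EisP (z * w) := by
  rw [EisP_iff] at *
  obtain ⟨a, rfl⟩ := hz; obtain ⟨b, rfl⟩ := hw
  exact ⟨_, (toC_mul a b).symm⟩
lemma EisP.conj {z} (hz : EisP z) : EisP (conj z) := by
  rw [EisP_iff] at *
  obtain ⟨a, rfl⟩ := hz
  exact ⟨_, (toC_conj a).symm⟩
lemma EisP.neg {z} (hz : EisP z) : EisP (-z) := by
  rw [EisP_iff] at *
  obtain ⟨a, rfl⟩ := hz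
  exact ⟨_, (toC_neg a).symm⟩
lemma EisP.sub {z w} (hz : EisP z) (hw : EisP w) : EisP (z - w) := by
  rw [sub_eq_add_neg]; exact hz.add hw.neg
lemma EisP.int (n : ℤ) : EisP n := ⟨n, 0, by simp⟩
lemma EisP.zero : EisP 0 := by simpa using EisP.int 0
lemma EisP.one : EisP 1 := by simpa using EisP.int 1
lemma EisP.om : EisP ω := ⟨0, 1, by simp⟩
lemma EisP.th : EisP θ := ⟨1, 2, by rw [th_eq]; push_cast; ring⟩
lemma EisP.sum {ι : Type*} (s : Finset ι) (f : ι → ℂ) (h : ∀ i ∈ s, EisP (f i)) : EisP (∑ i ∈ s, f i) := by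
  classical
  induction s using Finset.induction_on with
  | empty => simpa using EisP.zero
  | insert a s ha ih =>
    rw [Finset.sum_insert ha]
    exact (h a (by simp)).add (ih fun i hi => h i (by simp [hi]))
lemma EisUnit.eis {u} (h : EisUnit u) : EisP u := by
  rcases h with h | h | h | h | h | h <;> subst h
  · exact EisP.one
  · exact EisP.one.neg
  · exact EisP.om
  · exact EisP.om.neg
  · rw [sq]; exact EisP.om.mul EisP.om
  · rw [sq]; exact (EisP.om.mul EisP.om).neg

/-- Multiples of `θ`. -/
def ThP (z : ℂ) : Prop := ∃ w, EisP w ∧ z = θ * w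

lemma ThP.eis {z} (h : ThP z) : EisP z := by
  obtain ⟨w, hw, rfl⟩ := h; exact EisP.th.mul hw
lemma ThP.add {z w} (hz : ThP z) (hw : ThP w) : ThP (z + w) := by
  obtain ⟨a, ha, rfl⟩ := hz; obtain ⟨b, hb, rfl⟩ := hw
  exact ⟨a + b, ha.add hb, by ring⟩
lemma ThP.mul {z w} (hz : ThP z) (hw : EisP w) : ThP (w * z) := by
  obtain ⟨a, ha, rfl⟩ := hz
  exact ⟨w * a, hw.mul ha, by ring⟩
lemma ThP.neg {z} (hz : ThP z) : ThP (-z) := by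
  obtain ⟨a, ha, rfl⟩ := hz
  exact ⟨-a, ha.neg, by ring⟩
lemma ThP.sub {z w} (hz : ThP z) (hw : ThP w) : ThP (z - w) := by
  rw [sub_eq_add_neg]; exact hz.add hw.neg
lemma ThP.conj {z} (hz : ThP z) : ThP (conj z) := by
  obtain ⟨a, ha, rfl⟩ := hz
  exact ⟨-(starRingEnd ℂ) a, ha.conj.neg, by rw [map_mul, th_conj]; ring⟩
lemma ThP.zero : ThP 0 := ⟨0, EisP.zero, by simp⟩
lemma ThP.three : ThP 3 := ⟨-θ, EisP.th.neg, by linear_combination th_sq⟩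
lemma ThP.th {z} (h : EisP z) : ThP (θ * z) := ⟨z, h, rfl⟩
lemma ThP.sum {ι : Type*} (s : Finset ι) (f : ι → ℂ) (h : ∀ i ∈ s, ThP (f i)) : ThP (∑ i ∈ s, f i) := by
  classical
  induction s using Finset.induction_on with
  | empty => simpa using ThP.zero
  | insert a s ha ih =>
    rw [Finset.sum_insert ha]
    exact (h a (by simp)).add (ih fun i hi => h i (by simp [hi]))

lemma ThP_toC (z : ℤ × ℤ) : ThP (toC z) ↔ (3 : ℤ) ∣ z.1 + z.2 := by
  constructor
  · rintro ⟨w, hw, h⟩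
    obtain ⟨w, rfl⟩ := (EisP_iff w).1 hw
    have : toC z = toC (emul (1, 2) w) := by
      rw [toC_mul, h, th_eq]; simp [toC]
    have := toC_inj this
    rw [this]
    simp only [emul]
    exact ⟨w.1 - w.2, by ring⟩
  · rintro ⟨k, hk⟩
    -- `z = 3k + b (ω - 1)`
    have e : toC z = k * 3 + z.2 * (θ * (1 + ω)) := by
      have h1 : (z.1 : ℂ) = 3 * k - z.2 := by
        have : z.1 = 3 * k - z.2 := by linarith
        exact_mod_cast this
      simp only [toC]
      rw [h1, th_eq]
      linear_combination (-2 * z.2 : ℂ) * om_sq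
    rw [e]
    exact (ThP.three.mul (EisP.int k)).add
      ((ThP.th (EisP.one.add EisP.om)).mul (EisP.int z.2))

/-- A real multiple of `θ` is an integer multiple of 3. -/
lemma ThP_real {z : ℂ} (h : ThP z) (hz : conj z = z) : ∃ n : ℤ, z = 3 * n := by
  obtain ⟨w, hw⟩ := (EisP_iff z).1 h.eis
  rw [hw] at h hz
  rw [ThP_toC] at h
  rw [← toC_conj] at hz
  have := toC_inj hz
  have h2 := congrArg Prod.snd this
  simp only [econj] at h2
  have h3 : w.2 = 0 := by omega
  rw [h3, add_zero] at h
  obtain ⟨n, hn⟩ := h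
  refine ⟨n, ?_⟩
  rw [hw, toC, h3, hn]; push_cast; ring

lemma eis_half {z w : ℂ} (h : θ * z = θ * w) : z = w := mul_left_cancel₀ th_ne h

/-- The norm form. -/
def eN (z : ℤ × ℤ) : ℤ := z.1 * z.1 - z.1 * z.2 + z.2 * z.2

lemma toC_norm (z) : conj (toC z) * toC z = (eN z : ℤ) := by
  rw [← toC_conj, ← toC_mul]
  simp only [toC, emul, econj, eN]
  push_cast
  ring

lemma eN_nonneg (z) : 0 ≤ eN z := by
  simp only [eN]; nlinarith [sq_nonneg (2 * z.1 - z.2), sq_nonneg z.2]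

lemma eN_eq_zero {z} (h : eN z = 0) : z = (0, 0) := by
  simp only [eN] at h
  have h2 : z.2 = 0 := by
    by_contra h0
    have : 0 < z.2 ^ 2 := by positivity
    nlinarith [sq_nonneg (2 * z.1 - z.2)]
  rw [h2] at h
  have h1 : z.1 = 0 := by
    have : z.1 * z.1 = 0 := by linarith
    simpa using this
  exact Prod.ext h1 h2

lemma eN_one {z} (h : eN z = 1) : EisUnit (toC z) := by
  have hb : z.2 ^ 2 ≤ 1 := by
    simp only [eN] at h
    by_contra h0
    nlinarith [sq_nonneg (2 * z.1 - z.2)]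
  have ha : z.1 ^ 2 ≤ 1 := by
    simp only [eN] at h
    by_contra h0
    nlinarith [sq_nonneg (2 * z.2 - z.1)]
  have hb1 : z.2 ≤ 1 := by nlinarith
  have hb2 : -1 ≤ z.2 := by nlinarith
  have ha1 : z.1 ≤ 1 := by nlinarith
  have ha2 : -1 ≤ z.1 := by nlinarith
  obtain ⟨a, b⟩ := z
  simp only [eN, EisUnit, om_sq, toC] at *
  interval_cases a <;> interval_cases b <;> simp at h ⊢
  · right; right; right; left; ring
  · right; right; right; right; ring

lemma EisUnit.mulconj {u} (h : EisUnit u) : conj u * u = 1 := by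
  have e : conj ω * ω = 1 := by rw [om_conj]; linear_combination -om_sq
  rcases h with h | h | h | h | h | h <;> subst h
  · simp
  · simp
  · exact e
  · simp [e]
  · rw [map_pow, ← mul_pow, e, one_pow]
  · rw [map_neg, map_pow, neg_mul_neg, ← mul_pow, e, one_pow]

lemma EisUnit.ne {u} (h : EisUnit u) : u ≠ 0 := by
  rintro rfl
  have := h.mulconj
  simp at this

lemma EisUnit.of_mulconj {u} (hu : EisP u) (h : conj u * u = 1) : EisUnit u := by
  obtain ⟨w, rfl⟩ := (EisP_iff u).1 hu
  rw [toC_norm] at h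
  exact eN_one (by exact_mod_cast h)

lemma EisUnit.conj {u} (h : EisUnit u) : EisUnit (conj u) :=
  EisUnit.of_mulconj h.eis.conj (by rw [Complex.conj_conj, mul_comm]; exact h.mulconj)

end Bimonster

end

section
namespace Bimonster
open ComplexConjugate

lemma herm_eq (u v : V) : herm u v =
    -(conj (u 0) * v 0 + conj (u 1) * v 1 + conj (u 2) * v 2 + conj (u 3) * v 3) -
    (conj (u 4) * v 4 + conj (u 5) * v 5 + conj (u 6) * v 6 + conj (u 7) * v 7) -
    (conj (u 8) * v 8 + conj (u 9) * v 9 + conj (u 10) * v 10 + conj (u 11) * v 11) -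
    conj (u 12) * θ * v 13 + conj (u 13) * θ * v 12 := by
  rw [herm, th_conj]
  have : (∑ i : Fin 12, conj (u (Fin.castLE (by norm_num) i)) * v (Fin.castLE (by norm_num) i)) =
    (conj (u 0) * v 0 + conj (u 1) * v 1 + conj (u 2) * v 2 + conj (u 3) * v 3) +
    (conj (u 4) * v 4 + conj (u 5) * v 5 + conj (u 6) * v 6 + conj (u 7) * v 7) +
    (conj (u 8) * v 8 + conj (u 9) * v 9 + conj (u 10) * v 10 + conj (u 11) * v 11) := by
    simp only [Fin.sum_univ_succ, Fin.sum_univ_zero, add_zero]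
    ring_nf
    rfl
  rw [this]
  ring

lemma herm_add (u v w : V) : herm u (v + w) = herm u v + herm u w := by
  simp only [herm_eq, Pi.add_apply]; ring
lemma herm_smul (c : ℂ) (u v : V) : herm u (c • v) = c * herm u v := by
  simp only [herm_eq, Pi.smul_apply, smul_eq_mul]; ring
lemma herm_conj (u v : V) : conj (herm u v) = herm v u := by
  simp only [herm_eq, map_add, map_sub, map_neg, map_mul, Complex.conj_conj, th_conj]; ring
lemma herm_add_left (u v w : V) : herm (u + v) w = herm u w + herm v w := by
  rw [← herm_conj, herm_add, map_add, herm_conj, herm_conj]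
lemma herm_smul_left (c : ℂ) (u v : V) : herm (c • u) v = conj c * herm u v := by
  rw [← herm_conj, herm_smul, map_mul, herm_conj]
lemma herm_sub (u v w : V) : herm u (v - w) = herm u v - herm u w := by
  rw [sub_eq_add_neg, ← neg_one_smul ℂ w, herm_add, herm_smul]; ring
lemma herm_sub_left (u v w : V) : herm (u - v) w = herm u w - herm v w := by
  rw [← herm_conj, herm_sub, map_sub, herm_conj, herm_conj]

/-- The same condition as `inE8`, with explicit coordinates. -/
def E8c (a b c d : ℂ) : Prop :=
  EisP a ∧ EisP d ∧ ThP (b - a - d) ∧ ThP (c + a - d)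

lemma eis_mod (z : ℂ) (h : EisP z) : ∃ n : ℤ, ThP (z - n) := by
  obtain ⟨w, rfl⟩ := (EisP_iff z).1 h
  refine ⟨w.1 + w.2, ?_⟩
  have : toC w - ((w.1 + w.2 : ℤ) : ℂ) = toC (-w.2, w.2) := by
    simp only [toC]; push_cast; ring
  rw [this, ThP_toC]; simp

lemma ThP_iff (z : ℂ) : ThP z ↔ ∃ a b : ℤ, z = θ * ((a : ℂ) + (b : ℂ) * ω) := by
  constructor
  · rintro ⟨w, ⟨a, b, rfl⟩, h⟩; exact ⟨a, b, h⟩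
  · rintro ⟨a, b, h⟩; exact ⟨_, ⟨a, b, rfl⟩, h⟩

lemma inE8_iff (w : Fin 4 → ℂ) : inE8 w ↔ E8c (w 0) (w 1) (w 2) (w 3) := by
  simp only [inE8, E8c, ← ThP_iff]
  constructor
  · rintro ⟨h, s, t, hst⟩
    have h0 := hst 0
    have h1 := hst 1
    have h2 := hst 2
    have h3 := hst 3
    simp [tet1, tet2] at h0 h1 h2 h3
    refine ⟨h 0, h 3, ?_, ?_⟩
    · convert (h1.sub h0).sub h3 using 1; ring
    · convert (h2.add h0).sub h3 using 1; ring
  · rintro ⟨ha, hd, hb, hc⟩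
    obtain ⟨s, hs⟩ := eis_mod _ ha
    obtain ⟨t, ht⟩ := eis_mod _ hd
    refine ⟨?_, s, t, ?_⟩
    · intro i
      fin_cases i
      · exact ha
      · convert (hb.eis.add ha).add hd using 1
        simp; ring
      · convert (hc.eis.sub ha).add hd using 1
        simp; ring
      · exact hd
    · intro i
      fin_cases i
      · simpa [tet1, tet2] using hs
      · have := (hb.add hs).add ht
        simp [tet1, tet2]
        convert this using 1; ring
      · have := (hc.sub hs).add ht
        simp [tet1, tet2]
        convert this using 1; ring
      · simpa [tet1, tet2] using ht

lemma mem_Lset (v : V) : v ∈ Lset ↔ E8c (v 0) (v 1) (v 2) (v 3) ∧ E8c (v 4) (v 5) (v 6) (v 7) ∧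
    E8c (v 8) (v 9) (v 10) (v 11) ∧ EisP (v 12) ∧ EisP (v 13) := by
  simp only [Lset, Set.mem_setOf_eq, inE8_iff]
  constructor
  · rintro ⟨h, h1, h2⟩
    exact ⟨h 0, h 1, h 2, h1, h2⟩
  · rintro ⟨h1, h2, h3, h4, h5⟩
    refine ⟨fun k => ?_, h4, h5⟩
    fin_cases k
    exacts [h1, h2, h3]

lemma E8c.add {a b c d a' b' c' d' : ℂ} (h : E8c a b c d) (h' : E8c a' b' c' d') :
    E8c (a + a') (b + b') (c + c') (d + d') := by
  obtain ⟨h1, h2, h3, h4⟩ := h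
  obtain ⟨k1, k2, k3, k4⟩ := h'
  refine ⟨h1.add k1, h2.add k2, ?_, ?_⟩
  · convert h3.add k3 using 1; ring
  · convert h4.add k4 using 1; ring

lemma E8c.smul {a b c d u : ℂ} (h : E8c a b c d) (hu : EisP u) :
    E8c (u * a) (u * b) (u * c) (u * d) := by
  obtain ⟨h1, h2, h3, h4⟩ := h
  refine ⟨hu.mul h1, hu.mul h2, ?_, ?_⟩
  · convert h3.mul hu using 1; ring
  · convert h4.mul hu using 1; ring

lemma Lset_add {u v : V} (hu : u ∈ Lset) (hv : v ∈ Lset) : u + v ∈ Lset := by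
  rw [mem_Lset] at *
  obtain ⟨h1, h2, h3, h4, h5⟩ := hu
  obtain ⟨k1, k2, k3, k4, k5⟩ := hv
  exact ⟨h1.add k1, h2.add k2, h3.add k3, h4.add k4, h5.add k5⟩

lemma Lset_smul {c : ℂ} {v : V} (hc : EisP c) (hv : v ∈ Lset) : c • v ∈ Lset := by
  rw [mem_Lset] at *
  obtain ⟨k1, k2, k3, k4, k5⟩ := hv
  exact ⟨k1.smul hc, k2.smul hc, k3.smul hc, hc.mul k4, hc.mul k5⟩

lemma Lset_sub {u v : V} (hu : u ∈ Lset) (hv : v ∈ Lset) : u - v ∈ Lset := by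
  rw [sub_eq_add_neg, ← neg_one_smul ℂ v]
  exact Lset_add hu (Lset_smul EisP.one.neg hv)

lemma E8c.pair {a b c d a' b' c' d' : ℂ} (h : E8c a b c d) (h' : E8c a' b' c' d') :
    ThP (conj a * a' + conj b * b' + conj c * c' + conj d * d') := by
  obtain ⟨h1, h2, h3, h4⟩ := h
  obtain ⟨k1, k2, k3, k4⟩ := h'
  have hb : EisP b := by convert (h3.eis.add h1).add h2 using 1; ring
  have hc : EisP c := by convert (h4.eis.sub h1).add h2 using 1; ring
  have e1 := k3.mul hb.conj
  have e2 := k4.mul hc.conj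
  have e3 := h3.conj.mul (k1.add k2)
  have e4 := h4.conj.mul (k2.sub k1)
  have e5 := ThP.three.mul (h1.conj.mul k1)
  have e6 := ThP.three.mul (h2.conj.mul k2)
  have := ((((e1.add e2).add e3).add e4).add e5).add e6
  simp only [map_sub, map_add] at this
  convert this using 1
  ring

lemma pair_th {u v : V} (hu : u ∈ Lset) (hv : v ∈ Lset) : ThP (herm u v) := by
  rw [mem_Lset] at *
  obtain ⟨h1, h2, h3, h4, h5⟩ := hu
  obtain ⟨k1, k2, k3, k4, k5⟩ := hv
  rw [herm_eq]
  have e1 := ThP.th (h4.conj.mul k5)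
  have e2 := ThP.th (h5.conj.mul k4)
  convert ((((h1.pair k1).neg.sub (h2.pair k2)).sub (h3.pair k3)).sub e1).add e2 using 1
  ring

lemma qc_div {z : ℂ} (h : ThP (conj qc * z)) : EisP z := by
  obtain ⟨w, hw, h⟩ := h
  have : z = (-1 - ω) * w := by
    apply eis_half
    rw [qc_eq] at h
    simp only [map_add, map_neg, map_one, om_conj, th_eq] at *
    linear_combination (-1 - ω) * h - z * om_sq
  rw [this]
  exact (EisP.one.neg.sub EisP.om).mul hw

end Bimonster

end

section
namespace Bimonster
open ComplexConjugate

/-- Integral vectors, coordinatewise embedded. -/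
def toV (z : Fin 14 → ℤ × ℤ) : V := fun k => toC (z k)

def ptZ : Fin 13 → Fin 14 → ℤ × ℤ :=
  ![![(0, 0), (0, 0), (0, 0), (0, 0), (0, 0), (0, 0), (0, 0), (0, 0), (0, 0), (0, 0), (0, 0), (0, 0), (1, 0), (-1, -1)],
    ![(-1, 1), (0, 0), (0, 0), (0, 0), (0, 0), (0, 0), (0, 0), (0, 0), (0, 0), (0, 0), (0, 0), (0, 0), (0, 0), (0, 0)],
    ![(0, 0), (0, 0), (0, 0), (0, 0), (-1, 1), (0, 0), (0, 0), (0, 0), (0, 0), (0, 0), (0, 0), (0, 0), (0, 0), (0, 0)],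
    ![(0, 0), (0, 0), (0, 0), (0, 0), (0, 0), (0, 0), (0, 0), (0, 0), (-1, 1), (0, 0), (0, 0), (0, 0), (0, 0), (0, 0)],
    ![(0, 0), (-1, 1), (0, 0), (0, 0), (0, 0), (0, 0), (0, 0), (0, 0), (0, 0), (0, 0), (0, 0), (0, 0), (0, 0), (0, 0)],
    ![(0, 0), (0, 0), (0, 0), (0, 0), (0, 0), (-1, 1), (0, 0), (0, 0), (0, 0), (0, 0), (0, 0), (0, 0), (0, 0), (0, 0)],
    ![(0, 0), (0, 0), (0, 0), (0, 0), (0, 0), (0, 0), (0, 0), (0, 0), (0, 0), (-1, 1), (0, 0), (0, 0), (0, 0), (0, 0)],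
    ![(0, 0), (0, 0), (0, 0), (0, 0), (0, 0), (0, 0), (0, 0), (-1, 1), (0, 0), (0, 0), (0, 0), (-1, 1), (0, 1), (-1, -1)],
    ![(0, 0), (0, 0), (0, 0), (-1, 1), (0, 0), (0, 0), (0, 0), (0, 0), (0, 0), (0, 0), (0, 0), (-1, 1), (0, 1), (-1, -1)],
    ![(0, 0), (0, 0), (0, 0), (-1, 1), (0, 0), (0, 0), (0, 0), (-1, 1), (0, 0), (0, 0), (0, 0), (0, 0), (0, 1), (-1, -1)],
    ![(0, 0), (0, 0), (0, 0), (-1, 1), (0, 0), (0, 0), (1, -1), (-1, 1), (0, 0), (0, 0), (1, -1), (-1, 1), (0, 2), (-2, -2)],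
    ![(0, 0), (0, 0), (1, -1), (-1, 1), (0, 0), (0, 0), (0, 0), (-1, 1), (0, 0), (0, 0), (1, -1), (-1, 1), (0, 2), (-2, -2)],
    ![(0, 0), (0, 0), (1, -1), (-1, 1), (0, 0), (0, 0), (1, -1), (-1, 1), (0, 0), (0, 0), (0, 0), (-1, 1), (0, 2), (-2, -2)]]

def lnZ : Fin 13 → Fin 14 → ℤ × ℤ :=
  ![![(0, 0), (1, 0), (1, 0), (-2, 0), (0, 0), (1, 0), (1, 0), (-2, 0), (0, 0), (1, 0), (1, 0), (-2, 0), (-2, 1), (-1, -2)],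
    ![(1, 0), (0, 0), (1, 0), (-1, 0), (0, 0), (0, 0), (0, 0), (0, 0), (0, 0), (0, 0), (0, 0), (0, 0), (-1, 0), (0, 0)],
    ![(0, 0), (0, 0), (0, 0), (0, 0), (1, 0), (0, 0), (1, 0), (-1, 0), (0, 0), (0, 0), (0, 0), (0, 0), (-1, 0), (0, 0)],
    ![(0, 0), (0, 0), (0, 0), (0, 0), (0, 0), (0, 0), (0, 0), (0, 0), (1, 0), (0, 0), (1, 0), (-1, 0), (-1, 0), (0, 0)],
    ![(1, 0), (1, 0), (-1, 0), (0, 0), (0, 0), (0, 0), (0, 0), (0, 0), (0, 0), (0, 0), (0, 0), (0, 0), (0, 0), (0, 0)],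
    ![(0, 0), (0, 0), (0, 0), (0, 0), (1, 0), (1, 0), (-1, 0), (0, 0), (0, 0), (0, 0), (0, 0), (0, 0), (0, 0), (0, 0)],
    ![(0, 0), (0, 0), (0, 0), (0, 0), (0, 0), (0, 0), (0, 0), (0, 0), (1, 0), (1, 0), (-1, 0), (0, 0), (0, 0), (0, 0)],
    ![(0, 0), (1, 0), (1, 0), (1, 0), (0, 0), (0, 0), (0, 0), (0, 0), (0, 0), (0, 0), (0, 0), (0, 0), (0, 0), (0, 0)],
    ![(0, 0), (0, 0), (0, 0), (0, 0), (0, 0), (1, 0), (1, 0), (1, 0), (0, 0), (0, 0), (0, 0), (0, 0), (0, 0), (0, 0)],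
    ![(0, 0), (0, 0), (0, 0), (0, 0), (0, 0), (0, 0), (0, 0), (0, 0), (0, 0), (1, 0), (1, 0), (1, 0), (0, 0), (0, 0)],
    ![(0, 0), (1, 0), (1, 0), (-2, 0), (1, 0), (0, 0), (1, 0), (-1, 0), (1, 0), (0, 0), (1, 0), (-1, 0), (-1, 1), (-1, -2)],
    ![(1, 0), (0, 0), (1, 0), (-1, 0), (0, 0), (1, 0), (1, 0), (-2, 0), (1, 0), (0, 0), (1, 0), (-1, 0), (-1, 1), (-1, -2)],
    ![(1, 0), (0, 0), (1, 0), (-1, 0), (1, 0), (0, 0), (1, 0), (-1, 0), (0, 0), (1, 0), (1, 0), (-2, 0), (-1, 1), (-1, -2)]]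

lemma rA_toV : rA = toV (ptZ 0) := by
  funext k; fin_cases k <;> simp [rA, toV, ptZ, toC, qc_eq, om_sq, th_eq] <;> ring
lemma rC1_toV : rC1 = toV (ptZ 1) := by
  funext k; fin_cases k <;> simp [rC1, toV, ptZ, toC, qc_eq, om_sq, th_eq] <;> ring
lemma rC2_toV : rC2 = toV (ptZ 2) := by
  funext k; fin_cases k <;> simp [rC2, toV, ptZ, toC, qc_eq, om_sq, th_eq] <;> ring
lemma rC3_toV : rC3 = toV (ptZ 3) := by
  funext k; fin_cases k <;> simp [rC3, toV, ptZ, toC, qc_eq, om_sq, th_eq] <;> ring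
lemma rE1_toV : rE1 = toV (ptZ 4) := by
  funext k; fin_cases k <;> simp [rE1, toV, ptZ, toC, qc_eq, om_sq, th_eq] <;> ring
lemma rE2_toV : rE2 = toV (ptZ 5) := by
  funext k; fin_cases k <;> simp [rE2, toV, ptZ, toC, qc_eq, om_sq, th_eq] <;> ring
lemma rE3_toV : rE3 = toV (ptZ 6) := by
  funext k; fin_cases k <;> simp [rE3, toV, ptZ, toC, qc_eq, om_sq, th_eq] <;> ring
lemma rA1_toV : rA1 = toV (ptZ 7) := by
  funext k; fin_cases k <;> simp [rA1, toV, ptZ, toC, qc_eq, om_sq, th_eq] <;> ring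
lemma rA2_toV : rA2 = toV (ptZ 8) := by
  funext k; fin_cases k <;> simp [rA2, toV, ptZ, toC, qc_eq, om_sq, th_eq] <;> ring
lemma rA3_toV : rA3 = toV (ptZ 9) := by
  funext k; fin_cases k <;> simp [rA3, toV, ptZ, toC, qc_eq, om_sq, th_eq] <;> ring
lemma rG1_toV : rG1 = toV (ptZ 10) := by
  funext k; fin_cases k <;> simp [rG1, toV, ptZ, toC, qc_eq, om_sq, th_eq] <;> ring
lemma rG2_toV : rG2 = toV (ptZ 11) := by
  funext k; fin_cases k <;> simp [rG2, toV, ptZ, toC, qc_eq, om_sq, th_eq] <;> ring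
lemma rG3_toV : rG3 = toV (ptZ 12) := by
  funext k; fin_cases k <;> simp [rG3, toV, ptZ, toC, qc_eq, om_sq, th_eq] <;> ring
lemma rF_toV : rF = toV (lnZ 0) := by
  funext k; fin_cases k <;> simp [rF, toV, lnZ, toC, qc_eq, om_sq, th_eq] <;> ring
lemma rB1_toV : rB1 = toV (lnZ 1) := by
  funext k; fin_cases k <;> simp [rB1, toV, lnZ, toC, qc_eq, om_sq, th_eq] <;> ring
lemma rB2_toV : rB2 = toV (lnZ 2) := by
  funext k; fin_cases k <;> simp [rB2, toV, lnZ, toC, qc_eq, om_sq, th_eq] <;> ring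
lemma rB3_toV : rB3 = toV (lnZ 3) := by
  funext k; fin_cases k <;> simp [rB3, toV, lnZ, toC, qc_eq, om_sq, th_eq] <;> ring
lemma rD1_toV : rD1 = toV (lnZ 4) := by
  funext k; fin_cases k <;> simp [rD1, toV, lnZ, toC, qc_eq, om_sq, th_eq] <;> ring
lemma rD2_toV : rD2 = toV (lnZ 5) := by
  funext k; fin_cases k <;> simp [rD2, toV, lnZ, toC, qc_eq, om_sq, th_eq] <;> ring
lemma rD3_toV : rD3 = toV (lnZ 6) := by
  funext k; fin_cases k <;> simp [rD3, toV, lnZ, toC, qc_eq, om_sq, th_eq] <;> ring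
lemma rF1_toV : rF1 = toV (lnZ 7) := by
  funext k; fin_cases k <;> simp [rF1, toV, lnZ, toC, qc_eq, om_sq, th_eq] <;> ring
lemma rF2_toV : rF2 = toV (lnZ 8) := by
  funext k; fin_cases k <;> simp [rF2, toV, lnZ, toC, qc_eq, om_sq, th_eq] <;> ring
lemma rF3_toV : rF3 = toV (lnZ 9) := by
  funext k; fin_cases k <;> simp [rF3, toV, lnZ, toC, qc_eq, om_sq, th_eq] <;> ring
lemma rZ1_toV : rZ1 = toV (lnZ 10) := by
  funext k; fin_cases k <;> simp [rZ1, toV, lnZ, toC, qc_eq, om_sq, th_eq] <;> ring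
lemma rZ2_toV : rZ2 = toV (lnZ 11) := by
  funext k; fin_cases k <;> simp [rZ2, toV, lnZ, toC, qc_eq, om_sq, th_eq] <;> ring
lemma rZ3_toV : rZ3 = toV (lnZ 12) := by
  funext k; fin_cases k <;> simp [rZ3, toV, lnZ, toC, qc_eq, om_sq, th_eq] <;> ring

lemma pt_toV (i : Fin 13) : pt i = toV (ptZ i) := by
  fin_cases i
  exacts [rA_toV, rC1_toV, rC2_toV, rC3_toV, rE1_toV, rE2_toV, rE3_toV, rA1_toV, rA2_toV, rA3_toV, rG1_toV, rG2_toV, rG3_toV]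
lemma lnr_toV (i : Fin 13) : lnr i = toV (lnZ i) := by
  fin_cases i
  exacts [rF_toV, rB1_toV, rB2_toV, rB3_toV, rD1_toV, rD2_toV, rD3_toV, rF1_toV, rF2_toV, rF3_toV, rZ1_toV, rZ2_toV, rZ3_toV]

/-- The Hermitian form on integral vectors. -/
def hermZ (u v : Fin 14 → ℤ × ℤ) : ℤ × ℤ :=
  let m (i : Fin 14) := eneg (emul (econj (u i)) (v i))
  let s := eadd (m 0) <| eadd (m 1) <| eadd (m 2) <| eadd (m 3) <| eadd (m 4) <| eadd (m 5) <|
    eadd (m 6) <| eadd (m 7) <| eadd (m 8) <| eadd (m 9) <| eadd (m 10) (m 11)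
  eadd s (emul (1, 2) (eadd (eneg (emul (econj (u 12)) (v 13))) (emul (econj (u 13)) (v 12))))

lemma herm_toV (u v) : herm (toV u) (toV v) = toC (hermZ u v) := by
  have h : toC (1, 2) = θ := by rw [th_eq]; simp [toC]
  simp only [hermZ, toC_add, toC_neg, toC_mul, toC_conj, herm_eq, toV, h]
  ring

def LsetZ (z : Fin 14 → ℤ × ℤ) : Prop :=
  let P (a b c d : ℤ × ℤ) : Prop :=
    (3 : ℤ) ∣ (b.1 - a.1 - d.1) + (b.2 - a.2 - d.2) ∧ (3 : ℤ) ∣ (c.1 + a.1 - d.1) + (c.2 + a.2 - d.2)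
  P (z 0) (z 1) (z 2) (z 3) ∧ P (z 4) (z 5) (z 6) (z 7) ∧ P (z 8) (z 9) (z 10) (z 11)

instance (z) : Decidable (LsetZ z) := by unfold LsetZ; infer_instance

lemma LsetZ.mem {z} (h : LsetZ z) : toV z ∈ Lset := by
  have P : ∀ a b c d : ℤ × ℤ, (3 : ℤ) ∣ (b.1 - a.1 - d.1) + (b.2 - a.2 - d.2) →
      (3 : ℤ) ∣ (c.1 + a.1 - d.1) + (c.2 + a.2 - d.2) → E8c (toC a) (toC b) (toC c) (toC d) := by
    intro a b c d h1 h2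
    refine ⟨EisP.toC _, EisP.toC _, ?_, ?_⟩
    · have := (ThP_toC (b.1 - a.1 - d.1, b.2 - a.2 - d.2)).2 h1
      convert this using 1
      simp only [toC]; push_cast; ring
    · have := (ThP_toC (c.1 + a.1 - d.1, c.2 + a.2 - d.2)).2 h2
      convert this using 1
      simp only [toC]; push_cast; ring
  rw [mem_Lset]
  obtain ⟨⟨h1, h2⟩, ⟨h3, h4⟩, h5, h6⟩ := h
  exact ⟨P _ _ _ _ h1 h2, P _ _ _ _ h3 h4, P _ _ _ _ h5 h6, EisP.toC _, EisP.toC _⟩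

lemma pt_mem (i) : pt i ∈ Lset := by
  rw [pt_toV]
  apply LsetZ.mem
  revert i
  decide +kernel
lemma lnr_mem (i) : lnr i ∈ Lset := by
  rw [lnr_toV]
  apply LsetZ.mem
  revert i
  decide +kernel

lemma pt_norm (i) : herm (pt i) (pt i) = -3 := by
  have h : ∀ i, hermZ (ptZ i) (ptZ i) = (-3, 0) := by decide +kernel
  rw [pt_toV, herm_toV, h]; simp [toC]
lemma lnr_norm (i) : herm (lnr i) (lnr i) = -3 := by
  have h : ∀ i, hermZ (lnZ i) (lnZ i) = (-3, 0) := by decide +kernel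
  rw [lnr_toV, herm_toV, h]; simp [toC]

lemma D26_mem {d} (h : d ∈ D26) : d ∈ Lset := by
  rcases h with ⟨i, rfl⟩ | ⟨i, rfl⟩
  exacts [pt_mem i, lnr_mem i]
lemma D26_norm {d} (h : d ∈ D26) : herm d d = -3 := by
  rcases h with ⟨i, rfl⟩ | ⟨i, rfl⟩
  exacts [pt_norm i, lnr_norm i]

lemma E8c_of {a b c d : ℂ} (ha : ThP (conj qc * a)) (hb : ThP (conj qc * b))
    (h1 : ThP (a + b - c)) (h2 : ThP (b + c + d)) : E8c a b c d := by
  have ha := qc_div ha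
  have hb := qc_div hb
  have hc : EisP c := by convert (ha.add hb).sub h1.eis using 1; ring
  have hd : EisP d := by convert (h2.eis.sub hb).sub hc using 1; ring
  have h3 : ThP (b - a - d) := by
    convert (((ThP.three.mul hb).sub h1).sub h2) using 1; ring
  refine ⟨ha, hd, h3, ?_⟩
  convert ((ThP.three.mul ha).sub h1).add h3 using 1; ring

lemma Lset_of {v : V} (hp : ∀ i, ThP (herm (pt i) v)) (hl : ∀ i, ThP (herm (lnr i) v)) : v ∈ Lset := by
  have c1 : ThP (herm rC1 v) := hp 1
  have c2 : ThP (herm rC2 v) := hp 2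
  have c3 : ThP (herm rC3 v) := hp 3
  have e1 : ThP (herm rE1 v) := hp 4
  have e2 : ThP (herm rE2 v) := hp 5
  have e3 : ThP (herm rE3 v) := hp 6
  have a : ThP (herm rA v) := hp 0
  have b1 : ThP (herm rB1 v) := hl 1
  have d1 : ThP (herm rD1 v) := hl 4
  have d2 : ThP (herm rD2 v) := hl 5
  have d3 : ThP (herm rD3 v) := hl 6
  have f1 : ThP (herm rF1 v) := hl 7
  have f2 : ThP (herm rF2 v) := hl 8
  have f3 : ThP (herm rF3 v) := hl 9
  have g1 : E8c (v 0) (v 1) (v 2) (v 3) := by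
    apply E8c_of
    · convert c1.neg using 1; simp [herm_eq, rC1]
    · convert e1.neg using 1; simp [herm_eq, rE1]
    · convert d1.neg using 1; simp [herm_eq, rD1]; ring
    · convert f1.neg using 1; simp [herm_eq, rF1]
  have g2 : E8c (v 4) (v 5) (v 6) (v 7) := by
    apply E8c_of
    · convert c2.neg using 1; simp [herm_eq, rC2]
    · convert e2.neg using 1; simp [herm_eq, rE2]
    · convert d2.neg using 1; simp [herm_eq, rD2]; ring
    · convert f2.neg using 1; simp [herm_eq, rF2]
  have g3 : E8c (v 8) (v 9) (v 10) (v 11) := by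
    apply E8c_of
    · convert c3.neg using 1; simp [herm_eq, rC3]
    · convert e3.neg using 1; simp [herm_eq, rE3]
    · convert d3.neg using 1; simp [herm_eq, rD3]; ring
    · convert f3.neg using 1; simp [herm_eq, rF3]
  have h13 : EisP (v 13) := by
    obtain ⟨k1, k2, k3, k4⟩ := g1
    have : ThP (θ * v 13) := by
      convert b1.add k4 using 1
      simp [herm_eq, rB1]; ring
    obtain ⟨w, hw, h⟩ := this
    rw [eis_half h]; exact hw
  have h12 : EisP (v 12) := by
    have : ThP (θ * (ω * v 12)) := by
      convert a.add (ThP.th h13) using 1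
      simp [herm_eq, rA, om_conj]
      linear_combination (-θ * v 12) * om_sq
    obtain ⟨w, hw, h⟩ := this
    have h := eis_half h
    have : v 12 = (-1 - ω) * w := by linear_combination (-1 - ω) * h + v 12 * om_sq
    rw [this]
    exact (EisP.one.neg.sub EisP.om).mul hw
  rw [mem_Lset]
  exact ⟨g1, g2, g3, h12, h13⟩

end Bimonster

end

section
namespace Bimonster
open ComplexConjugate

lemma om_conj_mul : conj ω * ω = 1 := by rw [om_conj]; linear_combination -om_sq

lemma reflMap_add (μ : ℂ) (r u v : V) : reflMap μ r (u + v) = reflMap μ r u + reflMap μ r v := by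
  simp only [reflMap, herm_add]
  rw [mul_add, add_div, add_smul]; abel
lemma reflMap_smul (μ : ℂ) (r : V) (c : ℂ) (v : V) : reflMap μ r (c • v) = c • reflMap μ r v := by
  simp only [reflMap, herm_smul, smul_sub, smul_smul]
  congr 2; ring

def reflL (μ : ℂ) (r : V) : V →ₗ[ℂ] V where
  toFun := reflMap μ r
  map_add' := reflMap_add μ r
  map_smul' := reflMap_smul μ r

lemma reflMap_self {μ : ℂ} {r : V} (h : herm r r = -3) (v : V) :
    herm r (reflMap μ r v) = μ * herm r v := by
  rw [reflMap, herm_sub, herm_smul, h]; ring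

lemma reflMap_comp {μ ν : ℂ} {r : V} (h : herm r r = -3) (hm : μ * ν = 1) (v : V) :
    reflMap μ r (reflMap ν r v) = v := by
  have e : reflMap μ r (reflMap ν r v) = reflMap ν r v - ((1 - μ) * (ν * herm r v) / herm r r) • r := by
    rw [← reflMap_self h]; rfl
  rw [e, reflMap, sub_sub, ← add_smul, h]
  have : (1 - ν) * herm r v / -3 + (1 - μ) * (ν * herm r v) / -3 = 0 := by
    linear_combination (herm r v / 3) * hm
  rw [this]; simp

lemma reflMap_iso {μ : ℂ} {r : V} (h : herm r r = -3) (hm : conj μ * μ = 1) (u v : V) :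
    herm (reflMap μ r u) (reflMap μ r v) = herm u v := by
  simp only [reflMap, herm_sub, herm_sub_left, herm_smul, herm_smul_left, h, map_div₀, map_mul, map_sub,
    map_neg, map_one, herm_conj, map_ofNat]
  linear_combination (-(herm u r * herm r v) / 3) * hm

lemma reflMap_mem {r v : V} (h : herm r r = -3) (hr : r ∈ Lset) (hv : v ∈ Lset) : reflMap ω r v ∈ Lset := by
  obtain ⟨w, hw, e⟩ := pair_th hr hv
  apply Lset_sub hv
  apply Lset_smul _ hr
  have : (1 - ω) * herm r v / herm r r = (-1 - ω) * w := by
    rw [h, e, th_eq]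
    linear_combination (2 * w / 3) * om_sq
  rw [this]
  exact (EisP.one.neg.sub EisP.om).mul hw

lemma reflMap_mem' {r v : V} (h : herm r r = -3) (hr : r ∈ Lset) (hv : v ∈ Lset) :
    reflMap (conj ω) r v ∈ Lset := by
  obtain ⟨w, hw, e⟩ := pair_th hr hv
  apply Lset_sub hv
  apply Lset_smul _ hr
  have : (1 - conj ω) * herm r v / herm r r = -ω * w := by
    rw [h, e, th_eq, om_conj]
    linear_combination (-2 * w / 3) * om_sq
  rw [this]
  exact EisP.om.neg.mul hw

def reflE (r : V) (h : herm r r = -3) : V ≃ₗ[ℂ] V :=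
  LinearEquiv.ofLinear (reflL ω r) (reflL (conj ω) r)
    (LinearMap.ext fun v => reflMap_comp h (by rw [mul_comm, om_conj_mul]) v)
    (LinearMap.ext fun v => reflMap_comp h om_conj_mul v)

lemma reflE_apply (r h v) : reflE r h v = reflMap ω r v := rfl
lemma reflE_symm (r h v) : (reflE r h).symm v = reflMap (conj ω) r v := rfl

lemma reflE_mem {r : V} (h : herm r r = -3) (hr : r ∈ Lset) : reflE r h ∈ AutL := by
  refine ⟨fun v => ⟨fun hv => reflMap_mem h hr hv, fun hv => ?_⟩, fun u v => ?_⟩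
  · have := reflMap_mem' h hr hv
    rwa [reflE_apply, reflMap_comp h om_conj_mul] at this
  · exact reflMap_iso h om_conj_mul u v

lemma reflMap_conj (g : V ≃ₗ[ℂ] V) (hg : ∀ u v, herm (g u) (g v) = herm u v) (μ : ℂ) (b v : V) :
    reflMap μ (g b) (g v) = g (reflMap μ b v) := by
  simp only [reflMap, hg, map_sub, map_smul]

lemma Rad.mem {r : V} (h : Rad D26 r) : r ∈ Lset ∧ herm r r = -3 := by
  induction h with
  | base h => exact ⟨D26_mem h, D26_norm h⟩
  | refl _ _ ha hb =>
    exact ⟨reflMap_mem ha.2 ha.1 hb.1, by rw [reflMap_iso ha.2 om_conj_mul, hb.2]⟩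
  | inv _ _ ha hb =>
    refine ⟨reflMap_mem' ha.2 ha.1 hb.1, ?_⟩
    rw [reflMap_iso ha.2 (by rw [Complex.conj_conj, mul_comm, om_conj_mul]), hb.2]
  | unit hu _ ha =>
    refine ⟨Lset_smul hu.eis ha.1, ?_⟩
    rw [herm_smul, herm_smul_left, ha.2, ← mul_assoc, mul_comm _ (conj _), hu.mulconj, one_mul]

lemma Rad.clos {r : V} (h : Rad D26 r) (hn : herm r r = -3) :
    reflE r hn ∈ Subgroup.closure (ReflAutos D26) := by
  induction h with
  | base h =>
    apply Subgroup.subset_closure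
    exact ⟨reflE_mem hn (D26_mem h), _, h, fun v => rfl⟩
  | @refl a b ha hb iha ihb =>
    have e : reflE _ hn = reflE a ha.mem.2 * reflE b hb.mem.2 * (reflE a ha.mem.2)⁻¹ := by
      rw [eq_mul_inv_iff_mul_eq]
      ext1 v
      exact reflMap_conj (reflE a ha.mem.2) (fun u v => reflMap_iso ha.mem.2 om_conj_mul u v) ω b v
    rw [e]
    exact mul_mem (mul_mem (iha _) (ihb _)) (inv_mem (iha _))
  | @inv a b ha hb iha ihb =>
    have e : reflE _ hn = (reflE a ha.mem.2)⁻¹ * reflE b hb.mem.2 * (reflE a ha.mem.2) := by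
      rw [← mul_inv_eq_iff_eq_mul]
      ext1 v
      exact reflMap_conj (reflE a ha.mem.2).symm (fun u v => reflMap_iso ha.mem.2
        (by rw [Complex.conj_conj, mul_comm, om_conj_mul]) u v) ω b v
    rw [e]
    exact mul_mem (mul_mem (inv_mem (iha _)) (ihb _)) (iha _)
  | @unit u r hu hr ih =>
    have e : reflE _ hn = reflE r hr.mem.2 := by
      ext1 v
      rw [reflE_apply, reflE_apply, reflMap, reflMap, herm_smul_left, hn, hr.mem.2, smul_smul]
      congr 2
      linear_combination ((1 - ω) * herm r v / -3) * hu.mulconj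
    rw [e]
    exact ih _

lemma D26_root {d : V} (h : d ∈ D26) : IsRoot d := by
  refine ⟨D26_mem h, D26_norm h, ?_⟩
  rintro α hα y hy rfl
  have e := D26_norm h
  rw [herm_smul, herm_smul_left] at e
  obtain ⟨n, hn⟩ := ThP_real (pair_th hy hy) (herm_conj y y)
  obtain ⟨w, rfl⟩ := (EisP_iff α).1 hα
  apply eN_one
  rw [hn, ← mul_assoc, mul_comm (toC w), toC_norm] at e
  have e2 : eN w * (3 * n) = -3 := by exact_mod_cast e
  have h0 := eN_nonneg w
  have h1 : eN w ∣ 1 := ⟨-n, by linarith⟩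
  exact Int.eq_one_of_dvd_one h0 h1

lemma reduction (H : ∀ r, r ∈ Lset → herm r r = -3 → Rad D26 r) :
    Subgroup.closure (ReflAutos D26) = RL := by
  apply le_antisymm
  · apply Subgroup.closure_mono
    rintro g ⟨hg, r, hr, h⟩
    exact ⟨hg, r, D26_root hr, h⟩
  · apply (Subgroup.closure_le _).2
    rintro g ⟨hg, r, hr, h⟩
    have e : g = reflE r hr.2.1 := by
      ext1 v
      exact h v
    rw [e]
    exact (H r hr.1 hr.2.1).clos _

end Bimonster

end

section
namespace Bimonster
open ComplexConjugate

/-- Point sets of the 13 lines. -/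
def LN : Fin 13 → Finset (Fin 13) :=
  ![{0, 4, 5, 6}, {0, 1, 7, 10}, {0, 2, 8, 11}, {0, 3, 9, 12}, {1, 4, 11, 12}, {2, 5, 10, 12},
    {3, 6, 10, 11}, {4, 8, 9, 10}, {5, 7, 9, 11}, {6, 7, 8, 12}, {2, 3, 4, 7}, {1, 3, 5, 8},
    {1, 2, 6, 9}]

abbrev XS : Type := ℂ × (Fin 13 → ℂ)

def hX (x y : XS) : ℂ := conj x.1 * y.1 - ∑ i, conj (x.2 i) * y.2 i

lemma hX_add (x y z : XS) : hX x (y + z) = hX x y + hX x z := by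
  simp only [hX, Prod.fst_add, Prod.snd_add, Pi.add_apply, mul_add, Finset.sum_add_distrib]; ring
lemma hX_smul (x : XS) (c : ℂ) (y : XS) : hX x (c • y) = c * hX x y := by
  simp only [hX, Prod.smul_fst, Prod.smul_snd, Pi.smul_apply, smul_eq_mul, mul_sub, Finset.mul_sum]
  congr 1
  · ring
  · exact Finset.sum_congr rfl fun i _ => by ring
lemma hX_conj (x y : XS) : conj (hX x y) = hX y x := by
  simp only [hX, map_sub, map_mul, map_sum, Complex.conj_conj]
  congr 1
  · ring
  · exact Finset.sum_congr rfl fun i _ => by ring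
lemma hX_add_left (x y z : XS) : hX (x + y) z = hX x z + hX y z := by
  rw [← hX_conj, hX_add, map_add, hX_conj, hX_conj]
lemma hX_smul_left (c : ℂ) (x y : XS) : hX (c • x) y = conj c * hX x y := by
  rw [← hX_conj, hX_smul, map_mul, hX_conj]
lemma hX_sub (x y z : XS) : hX x (y - z) = hX x y - hX x z := by
  rw [sub_eq_add_neg, ← neg_one_smul ℂ z, hX_add, hX_smul]; ring
lemma hX_sub_left (x y z : XS) : hX (x - y) z = hX x z - hX y z := by
  rw [← hX_conj, hX_sub, map_sub, hX_conj, hX_conj]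

def nnZ : Fin 14 → ℤ × ℤ :=
  ![(0, 0), (0, 0), (-1, 1), (2, -2), (0, 0), (0, 0), (-1, 1), (2, -2), (0, 0), (0, 0), (-1, 1), (2, -2),
    (0, -4), (4, 4)]

def nn : V := toV nnZ

lemma nn_norm : herm nn nn = 3 := by
  rw [nn, herm_toV, show hermZ nnZ nnZ = (3, 0) by decide +kernel]; simp [toC]
lemma nn_pt (i) : herm nn (pt i) = 0 := by
  have h : ∀ i, hermZ nnZ (ptZ i) = (0, 0) := by decide +kernel
  rw [nn, pt_toV, herm_toV, h]; simp [toC]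
lemma pt_pt (i j) : herm (pt i) (pt j) = if i = j then -3 else 0 := by
  have h : ∀ i j, hermZ (ptZ i) (ptZ j) = if i = j then (-3, 0) else (0, 0) := by decide +kernel
  rw [pt_toV, pt_toV, herm_toV, h]
  split_ifs <;> simp [toC]

def toCh : ℤ × ℤ →+ ℂ where
  toFun := toC
  map_zero' := toC_zero
  map_add' := toC_add

lemma nn_lnr (j) : nn + ∑ i ∈ LN j, pt i = qc • lnr j := by
  have h : ∀ j k, nnZ k + ∑ i ∈ LN j, ptZ i k = emul (-1, 1) (lnZ j k) := by decide +kernel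
  funext k
  have h2 := congrArg toCh (h j k)
  rw [map_add, map_sum] at h2
  have e : toCh (emul (-1, 1) (lnZ j k)) = qc * lnr j k := by
    rw [qc_eq, lnr_toV]
    change toC _ = _
    rw [toC_mul]
    simp [toV, toC]
  rw [e] at h2
  rw [Pi.smul_apply, smul_eq_mul, ← h2, Pi.add_apply, Finset.sum_apply]
  congr 1
  exact Finset.sum_congr rfl fun i _ => by rw [pt_toV]; rfl

lemma qc_norm : conj qc * qc = 3 := by
  rw [qc_eq]; simp only [map_add, map_neg, map_one, om_conj]; linear_combination -om_sq
lemma qc_ne : qc ≠ 0 := by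
  intro h
  have := qc_norm
  rw [h] at this; simp at this

def Fm : XS →ₗ[ℂ] V where
  toFun x := qc⁻¹ • (x.1 • nn + ∑ i, x.2 i • pt i)
  map_add' x y := by
    rw [← smul_add]
    congr 1
    simp only [Prod.fst_add, Prod.snd_add, Pi.add_apply, add_smul, Finset.sum_add_distrib]
    abel
  map_smul' c x := by
    simp only [Prod.smul_fst, Prod.smul_snd, Pi.smul_apply, smul_eq_mul, mul_smul, RingHom.id_apply]
    rw [smul_comm c qc⁻¹, smul_add c, Finset.smul_sum]

lemma Fm_apply (x) : Fm x = qc⁻¹ • (x.1 • nn + ∑ i, x.2 i • pt i) := rfl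

lemma herm_sum (u : V) (f : Fin 13 → V) : herm u (∑ i, f i) = ∑ i, herm u (f i) := by
  let φ : V →+ ℂ := ⟨⟨herm u, by simpa using herm_smul 0 u 0⟩, herm_add u⟩
  exact map_sum φ f _

lemma Fm_iso (x y) : herm (Fm x) (Fm y) = hX x y := by
  have pn (i) : herm (pt i) nn = 0 := by rw [← herm_conj, nn_pt, map_zero]
  have hp (i) : herm (pt i) (y.1 • nn + ∑ i, y.2 i • pt i) = -3 * y.2 i := by
    rw [herm_add, herm_smul, pn, herm_sum]
    simp only [herm_smul, pt_pt]
    simp [mul_comm]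
  have hn : herm nn (y.1 • nn + ∑ i, y.2 i • pt i) = 3 * y.1 := by
    rw [herm_add, herm_smul, nn_norm, herm_sum]
    simp only [herm_smul, nn_pt]
    simp [mul_comm]
  rw [Fm_apply, Fm_apply, herm_smul, herm_smul_left, herm_add_left, herm_smul_left, hn,
    ← herm_conj, herm_sum]
  have : ∀ i, herm (y.1 • nn + ∑ i, y.2 i • pt i) (x.2 i • pt i) = x.2 i * (conj (-3 * y.2 i)) := by
    intro i
    rw [herm_smul, ← herm_conj, hp]
  simp only [this, map_sum, map_mul, Complex.conj_conj, hX]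
  have e : qc⁻¹ * conj qc⁻¹ * 3 = 1 := by
    rw [← qc_norm, map_inv₀]
    have := qc_ne
    have h2 : conj qc ≠ 0 := by simpa using this
    field_simp
  have e2 : ∑ i, conj (x.2 i) * (conj (conj (-3)) * y.2 i) = -3 * ∑ i, conj (x.2 i) * y.2 i := by
    rw [Finset.mul_sum]
    exact Finset.sum_congr rfl fun i _ => by simp; ring
  simp only [map_neg, map_ofNat] at e2 ⊢
  rw [e2]
  linear_combination (conj x.1 * y.1 - ∑ i, conj (x.2 i) * y.2 i) * e

/-- The point roots in the `X`-model. -/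
def pX (i : Fin 13) : XS := (0, Pi.single i qc)
/-- The line roots in the `X`-model. -/
def lX (j : Fin 13) : XS := (1, fun i => if i ∈ LN j then 1 else 0)

lemma Fm_pX (i) : Fm (pX i) = pt i := by
  rw [Fm_apply, pX, Finset.sum_eq_single i]
  · simp [qc_ne, smul_smul]
  · intro j _ hj
    simp [hj]
  · simp
lemma Fm_lX (j) : Fm (lX j) = lnr j := by
  have : ∑ i, (lX j).2 i • pt i = ∑ i ∈ LN j, pt i := by
    rw [← Finset.sum_filter_add_sum_filter_not Finset.univ (· ∈ LN j)]
    simp only [lX, ite_smul, one_smul, zero_smul]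
    rw [Finset.sum_ite_of_true (by simp), Finset.sum_ite_of_false (by simp)]
    simp
  rw [Fm_apply, this, lX, one_smul, nn_lnr, smul_smul, inv_mul_cancel₀ qc_ne, one_smul]

lemma hX_pX (i) (x : XS) : hX (pX i) x = -(conj qc * x.2 i) := by
  rw [hX, pX, Finset.sum_eq_single i]
  · simp
  · intro j _ hj
    simp [hj]
  · simp
lemma hX_lX (j) (x : XS) : hX (lX j) x = x.1 - ∑ i ∈ LN j, x.2 i := by
  simp only [hX, lX]
  simp [Finset.sum_ite, apply_ite]

lemma Fm_inj : Function.Injective Fm := by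
  rw [injective_iff_map_eq_zero]
  intro x hx
  have h (y) : hX y x = 0 := by rw [← Fm_iso, hx]; simpa using herm_smul 0 (Fm y) 0
  have h2 (i) : x.2 i = 0 := by
    have := h (pX i)
    rw [hX_pX] at this
    simpa [qc_ne] using this
  have h1 : x.1 = 0 := by
    have := h (lX 0)
    rw [hX_lX] at this
    simpa [h2] using this
  exact Prod.ext h1 (funext h2)

lemma Fm_surj : Function.Surjective Fm := by
  apply (LinearMap.injective_iff_surjective_of_finrank_eq_finrank _).1 Fm_inj
  simp

def LX (x : XS) : Prop := (∀ i, EisP (x.2 i)) ∧ ∀ j, ThP (x.1 - ∑ i ∈ LN j, x.2 i)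

lemma LX_iff (x) : LX x ↔ Fm x ∈ Lset := by
  constructor
  · rintro ⟨h1, h2⟩
    apply Lset_of
    · intro i
      rw [← Fm_pX, Fm_iso, hX_pX, qc_eq]
      simp only [map_add, map_neg, map_one, om_conj]
      have e := ThP.th (EisP.om.neg.mul (h1 i))
      convert e using 1
      rw [th_eq]
      linear_combination (2 * x.2 i) * om_sq
    · intro i
      rw [← Fm_lX, Fm_iso, hX_lX]
      exact h2 i
  · intro h
    refine ⟨fun i => ?_, fun j => ?_⟩
    · have := pair_th (pt_mem i) h
      rw [← Fm_pX, Fm_iso, hX_pX] at this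
      apply qc_div
      simpa using this.neg
    · have := pair_th (lnr_mem j) h
      rwa [← Fm_lX, Fm_iso, hX_lX] at this

lemma LX.add {x y} (hx : LX x) (hy : LX y) : LX (x + y) := by
  rw [LX_iff] at *; rw [map_add]; exact Lset_add hx hy
lemma LX.sub {x y} (hx : LX x) (hy : LX y) : LX (x - y) := by
  rw [LX_iff] at *; rw [map_sub]; exact Lset_sub hx hy
lemma LX.smul {x c} (hc : EisP c) (hx : LX x) : LX (c • x) := by
  rw [LX_iff] at *; rw [map_smul]; exact Lset_smul hc hx
lemma LX.pair {x y} (hx : LX x) (hy : LX y) : ThP (hX x y) := by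
  rw [LX_iff] at *; rw [← Fm_iso]; exact pair_th hx hy
lemma LX.eis {x} (hx : LX x) : EisP x.1 := by
  have := (hx.2 0).eis.add (EisP.sum (LN 0) x.2 fun i _ => hx.1 i)
  simpa using this
lemma LX_pX (i) : LX (pX i) := by rw [LX_iff, Fm_pX]; exact pt_mem i
lemma LX_lX (i) : LX (lX i) := by rw [LX_iff, Fm_lX]; exact lnr_mem i

def reflX (μ : ℂ) (r x : XS) : XS := x - ((1 - μ) * hX r x / hX r r) • r
lemma Fm_reflX (μ r x) : Fm (reflX μ r x) = reflMap μ (Fm r) (Fm x) := by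
  simp only [reflX, reflMap, map_sub, map_smul, Fm_iso]

def RX (x : XS) : Prop := Rad D26 (Fm x)

lemma RX_pX (i) : RX (pX i) := by rw [RX, Fm_pX]; exact Rad.base (Or.inl ⟨i, rfl⟩)
lemma RX_lX (i) : RX (lX i) := by rw [RX, Fm_lX]; exact Rad.base (Or.inr ⟨i, rfl⟩)
lemma RX.refl {a b} (ha : RX a) (hb : RX b) : RX (reflX ω a b) := by
  rw [RX, Fm_reflX]; exact Rad.refl ha hb
lemma RX.inv {a b} (ha : RX a) (hb : RX b) : RX (reflX (conj ω) a b) := by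
  rw [RX, Fm_reflX]; exact Rad.inv ha hb
lemma RX.unit {u a} (hu : EisUnit u) (ha : RX a) : RX (u • a) := by
  rw [RX, map_smul]; exact Rad.unit hu ha
lemma RX.lx {x} (h : RX x) : LX x := (LX_iff x).2 h.mem.1
lemma RX.norm {x} (h : RX x) : hX x x = -3 := by rw [← Fm_iso]; exact h.mem.2

/-- Linear isometries sending the 26 roots into the radical preserve the radical. -/
lemma RX_map (g : XS →ₗ[ℂ] XS) (hg : ∀ x y, hX (g x) (g y) = hX x y)
    (hp : ∀ i, RX (g (pX i))) (hl : ∀ i, RX (g (lX i))) {x} (hx : RX x) : RX (g x) := by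
  have key : ∀ v, Rad D26 v → ∀ x, Fm x = v → RX (g x) := by
    have gr (μ a b) : g (reflX μ a b) = reflX μ (g a) (g b) := by
      simp only [reflX, map_sub, map_smul, hg]
    intro v hv
    induction hv with
    | base h =>
      intro x hx
      rcases h with ⟨i, hi⟩ | ⟨i, hi⟩
      · rw [← hi, ← Fm_pX] at hx
        rw [Fm_inj hx]; exact hp i
      · rw [← hi, ← Fm_lX] at hx
        rw [Fm_inj hx]; exact hl i
    | @refl a b _ _ ha hb =>
      intro x hx
      obtain ⟨a, rfl⟩ := Fm_surj a
      obtain ⟨b, rfl⟩ := Fm_surj b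
      rw [← Fm_reflX] at hx
      rw [Fm_inj hx, gr]
      exact (ha _ rfl).refl (hb _ rfl)
    | @inv a b _ _ ha hb =>
      intro x hx
      obtain ⟨a, rfl⟩ := Fm_surj a
      obtain ⟨b, rfl⟩ := Fm_surj b
      rw [← Fm_reflX] at hx
      rw [Fm_inj hx, gr]
      exact (ha _ rfl).inv (hb _ rfl)
    | @unit u r hu _ hr =>
      intro x hx
      obtain ⟨r, rfl⟩ := Fm_surj r
      rw [← map_smul] at hx
      rw [Fm_inj hx, map_smul]
      exact (hr _ rfl).unit hu
  exact key _ hx x rfl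

lemma reductionX (H : ∀ x, LX x → hX x x = -3 → RX x) :
    Subgroup.closure (ReflAutos D26) = RL := by
  apply reduction
  intro r hr hn
  obtain ⟨x, rfl⟩ := Fm_surj r
  exact H x ((LX_iff x).2 hr) (by rw [← Fm_iso]; exact hn)

end Bimonster

end

section
namespace Bimonster
open ComplexConjugate

def al : ℂ := 4 + 3 * ω
lemma al_conj : conj al = 1 - 3 * ω := by
  rw [al]; simp only [map_add, map_mul, map_ofNat, om_conj]; ring
lemma al_norm : conj al * al = 13 := by
  rw [al_conj, al]; linear_combination -9 * om_sq

def wX : XS := (al, fun _ => 1)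

lemma hX_w (x : XS) : hX wX x = conj al * x.1 - ∑ i, x.2 i := by
  simp [hX, wX]
lemma w_null : hX wX wX = 0 := by
  rw [hX_w, wX, al_norm]; simp

lemma LX_w : LX wX := by
  refine ⟨fun i => EisP.one, fun j => ?_⟩
  have h : ∀ j, (LN j).card = 4 := by decide +kernel
  simp only [wX, Finset.sum_const, h, al]
  convert ThP.three.mul EisP.om using 1
  simp; ring

lemma al_red_nat (n : ℤ) (h0 : 0 ≤ n) (h1 : n < 13) : ∃ k e u : ℂ, EisP k ∧ EisUnit u ∧
    (e = 0 ∨ e = 1 ∨ e = θ) ∧ (n : ℂ) = u * e + al * k := by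
  have T : ∀ (k : ℤ × ℤ) (e u : ℂ), EisUnit u → (e = 0 ∨ e = 1 ∨ e = θ) →
      (n : ℂ) = u * e + al * toC k → ∃ k e u : ℂ, EisP k ∧ EisUnit u ∧
      (e = 0 ∨ e = 1 ∨ e = θ) ∧ (n : ℂ) = u * e + al * k :=
    fun k e u h1 h2 h3 => ⟨toC k, e, u, EisP.toC _, h1, h2, h3⟩
  interval_cases n
  · refine T (0, 0) (0) (1) (by simp [EisUnit]) (by simp) ?_
    simp only [toC, al, th_eq]; push_cast; linear_combination (0 + 0 * ω) * om_sq
  · refine T (0, 0) (1) (1) (by simp [EisUnit]) (by simp) ?_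
    simp only [toC, al, th_eq]; push_cast; linear_combination (0 + 0 * ω) * om_sq
  · refine T (0, -1) (θ) (-ω ^ 2) (by simp [EisUnit]) (by simp) ?_
    simp only [toC, al, th_eq]; push_cast; linear_combination (2 + 2 * ω) * om_sq
  · refine T (0, -1) (1) (ω) (by simp [EisUnit]) (by simp) ?_
    simp only [toC, al, th_eq]; push_cast; linear_combination (3 + 0 * ω) * om_sq
  · refine T (0, -1) (1) (-ω ^ 2) (by simp [EisUnit]) (by simp) ?_
    simp only [toC, al, th_eq]; push_cast; linear_combination (4 + 0 * ω) * om_sq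
  · refine T (0, -1) (θ) (-ω) (by simp [EisUnit]) (by simp) ?_
    simp only [toC, al, th_eq]; push_cast; linear_combination (5 + 0 * ω) * om_sq
  · refine T (1, -1) (θ) (-1) (by simp [EisUnit]) (by simp) ?_
    simp only [toC, al, th_eq]; push_cast; linear_combination (3 + 0 * ω) * om_sq
  · refine T (0, -2) (θ) (1) (by simp [EisUnit]) (by simp) ?_
    simp only [toC, al, th_eq]; push_cast; linear_combination (6 + 0 * ω) * om_sq
  · refine T (1, -2) (θ) (ω) (by simp [EisUnit]) (by simp) ?_
    simp only [toC, al, th_eq]; push_cast; linear_combination (4 + 0 * ω) * om_sq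
  · refine T (1, -2) (1) (ω ^ 2) (by simp [EisUnit]) (by simp) ?_
    simp only [toC, al, th_eq]; push_cast; linear_combination (5 + 0 * ω) * om_sq
  · refine T (1, -2) (1) (-ω) (by simp [EisUnit]) (by simp) ?_
    simp only [toC, al, th_eq]; push_cast; linear_combination (6 + 0 * ω) * om_sq
  · refine T (1, -2) (θ) (ω ^ 2) (by simp [EisUnit]) (by simp) ?_
    simp only [toC, al, th_eq]; push_cast; linear_combination (7 + -2 * ω) * om_sq
  · refine T (1, -3) (1) (-1) (by simp [EisUnit]) (by simp) ?_
    simp only [toC, al, th_eq]; push_cast; linear_combination (9 + 0 * ω) * om_sq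

lemma al_red (z : ℂ) (hz : EisP z) : ∃ k e u : ℂ, EisP k ∧ EisUnit u ∧
    (e = 0 ∨ e = 1 ∨ e = θ) ∧ z = u * e + al * k := by
  obtain ⟨⟨a, b⟩, rfl⟩ := (EisP_iff z).1 hz
  obtain ⟨k, e, u, hk, hu, he, h⟩ := al_red_nat ((a + 3 * b) % 13) (Int.emod_nonneg _ (by norm_num))
    (Int.emod_lt_of_pos _ (by norm_num))
  have h2 : (a : ℂ) + 3 * b = ((a + 3 * b) % 13 : ℤ) + 13 * ((a + 3 * b) / 13 : ℤ) := by
    exact_mod_cast (Int.emod_add_mul_ediv (a + 3 * b) 13).symm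
  have hal : EisP (conj al) := ⟨1, -3, by rw [al_conj]; push_cast; ring⟩
  refine ⟨k + ω * b + conj al * ((a + 3 * b) / 13 : ℤ), e, u,
    (hk.add (EisP.om.mul (EisP.int b))).add (hal.mul (EisP.int _)), hu, he, ?_⟩
  rw [h] at h2
  simp only [toC]
  have e1 : al * ω = ω - 3 := by rw [al]; linear_combination 3 * om_sq
  linear_combination h2 - b * e1 - (((a + 3 * b) / 13 : ℤ) : ℂ) * al_norm

lemma plane_sum (f : Fin 13 → ℤ) (p : Fin 13) :
    ∑ j, (if p ∈ LN j then ∑ i ∈ LN j, f i else 0) = 3 * f p + ∑ i, f i := by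
  have hc : ∀ p i, (∑ j, if p ∈ LN j ∧ i ∈ LN j then (1 : ℤ) else 0) = if i = p then 4 else 1 := by
    decide +kernel
  have h1 : ∀ j, (if p ∈ LN j then ∑ i ∈ LN j, f i else 0) =
      ∑ i, (if p ∈ LN j ∧ i ∈ LN j then (1 : ℤ) else 0) * f i := by
    intro j
    split_ifs with h
    · simp [h, ← Finset.sum_filter]
    · simp [h]
  simp only [h1]
  rw [Finset.sum_comm]
  simp only [← Finset.sum_mul, hc]
  rw [← Finset.sum_erase_add _ _ (Finset.mem_univ p), ← Finset.sum_erase_add _ f (Finset.mem_univ p)]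
  rw [Finset.sum_congr rfl (g := f)]
  · simp; ring
  · intro i hi
    simp [Finset.ne_of_mem_erase hi]

lemma line_bound (z : Fin 13 → ℤ × ℤ) (c : ℤ)
    (hl : ∀ j, (3 : ℤ) ∣ c - ∑ i ∈ LN j, ((z i).1 + (z i).2)) (p : Fin 13)
    (hp : ¬ (3 : ℤ) ∣ c - ((z p).1 + (z p).2)) : eN (z p) + 4 ≤ ∑ i, eN (z i) := by
  have h1 : ∀ j, p ∈ LN j → eN (z p) + 1 ≤ ∑ i ∈ LN j, eN (z i) := by
    intro j hj
    rw [← Finset.add_sum_erase _ _ hj]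
    have : ∃ i ∈ (LN j).erase p, z i ≠ (0, 0) := by
      by_contra h
      push Not at h
      apply hp
      have h3 := hl j
      rw [← Finset.add_sum_erase _ _ hj, Finset.sum_eq_zero (s := (LN j).erase p)] at h3
      · simpa using h3
      · intro i hi
        rw [h i hi]; rfl
    obtain ⟨i, hi, h0⟩ := this
    have h4 := Finset.single_le_sum (f := fun i => eN (z i)) (fun i _ => eN_nonneg (z i)) hi
    have h5 : eN (z i) ≠ 0 := fun h => h0 (eN_eq_zero h)
    have h6 := eN_nonneg (z i)
    omega
  have h2 := plane_sum (fun i => eN (z i)) p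
  have h3 : ∑ j, (if p ∈ LN j then eN (z p) + 1 else 0) ≤
      ∑ j, (if p ∈ LN j then ∑ i ∈ LN j, eN (z i) else 0) := by
    apply Finset.sum_le_sum
    intro j _
    split_ifs with h
    · exact h1 j h
    · exact le_refl _
  have hc : ∀ p, (∑ j, if p ∈ LN j then (1 : ℤ) else 0) = 4 := by decide +kernel
  have h4 : ∑ j, (if p ∈ LN j then eN (z p) + 1 else 0) = 4 * (eN (z p) + 1) := by
    rw [← hc p, Finset.sum_mul]
    exact Finset.sum_congr rfl fun j _ => by split_ifs <;> simp
  rw [h2, h4] at h3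
  linarith

lemma case0 (z : Fin 13 → ℤ × ℤ) (hl : ∀ j, (3 : ℤ) ∣ 0 - ∑ i ∈ LN j, ((z i).1 + (z i).2))
    (h1 : ∑ i, (z i).1 = 0) (h2 : ∑ i, (z i).2 = 0) (h3 : ∑ i, eN (z i) = 3) : False := by
  have hr : ∀ p, (3 : ℤ) ∣ eN (z p) := by
    intro p
    by_cases hp : (3 : ℤ) ∣ 0 - ((z p).1 + (z p).2)
    · obtain ⟨k, hk⟩ := hp
      refine ⟨3 * k * k - (z p).1 * (z p).2, ?_⟩
      have : (z p).1 = -(z p).2 - 3 * k := by linarith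
      simp only [eN, this]; ring
    · have := line_bound z 0 hl p hp
      have := eN_nonneg (z p)
      omega
  have : ∃ p, z p ≠ (0, 0) := by
    by_contra h
    push Not at h
    rw [Finset.sum_eq_zero (fun i _ => by rw [h i]; rfl)] at h3
    norm_num at h3
  obtain ⟨p, hp⟩ := this
  have h5 : eN (z p) ≠ 0 := fun h => hp (eN_eq_zero h)
  have h6 := eN_nonneg (z p)
  have h7 := hr p
  rw [← Finset.add_sum_erase _ _ (Finset.mem_univ p)] at h1 h2 h3
  have h8 := Finset.sum_nonneg (s := Finset.univ.erase p) (fun i _ => eN_nonneg (z i))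
  have h9 : ∑ i ∈ Finset.univ.erase p, eN (z i) = 0 := by omega
  rw [Finset.sum_eq_zero_iff_of_nonneg (fun i _ => eN_nonneg (z i))] at h9
  rw [Finset.sum_eq_zero (fun i hi => by rw [eN_eq_zero (h9 i hi)])] at h1 h2
  exact hp (Prod.ext (by simpa using h1) (by simpa using h2))

lemma case1 (z : Fin 13 → ℤ × ℤ) (hl : ∀ j, (3 : ℤ) ∣ 1 - ∑ i ∈ LN j, ((z i).1 + (z i).2))
    (h1 : ∑ i, (z i).1 = 1) (h2 : ∑ i, (z i).2 = -3) (h3 : ∑ i, eN (z i) = 4) : False := by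
  have hr : ∀ p, 0 ≤ eN (z p) - (z p).1 + 2 * (z p).2 := by
    intro p
    have h5 : eN ((z p).1, (z p).2 + 1) ≠ 0 := by
      intro h
      have h6 := eN_eq_zero h
      have h7 := congrArg Prod.fst h6
      have h8 := congrArg Prod.snd h6
      simp only at h7 h8
      have := line_bound z 1 hl p (by omega)
      have h9 : z p = (0, -1) := Prod.ext h7 (by simp; omega)
      rw [h3, h9] at this
      norm_num [eN] at this
    have h6 := eN_nonneg ((z p).1, (z p).2 + 1)
    have h7 : eN ((z p).1, (z p).2 + 1) = eN (z p) - (z p).1 + 2 * (z p).2 + 1 := by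
      simp only [eN]; ring
    omega
  have := Finset.sum_nonneg (s := Finset.univ) (fun i _ => hr i)
  rw [Finset.sum_add_distrib, Finset.sum_sub_distrib, ← Finset.mul_sum] at this
  omega

lemma case2 (z : Fin 13 → ℤ × ℤ)
    (h1 : ∑ i, (z i).1 = 7) (h3 : ∑ i, eN (z i) = 6) : False := by
  have hr : ∀ p, (z p).1 ≤ eN (z p) := by
    intro p
    simp only [eN]
    generalize (z p).1 = a
    generalize (z p).2 = b
    by_cases h : a = 1
    · subst h
      by_cases hb : 1 ≤ b
      · nlinarith
      · have : b ≤ 0 := by omega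
        nlinarith
    · have h : a ≤ 0 ∨ 2 ≤ a := by omega
      rcases h with h | h
      · nlinarith [sq_nonneg (2 * b - a), sq_nonneg a]
      · nlinarith [sq_nonneg (2 * b - a), sq_nonneg a]
  have := Finset.sum_le_sum (s := Finset.univ) (fun i _ => hr i)
  omega

lemma toC_sum (z : Fin 13 → ℤ × ℤ) (s : Finset (Fin 13)) :
    ∑ i ∈ s, toC (z i) = toC (∑ i ∈ s, (z i).1, ∑ i ∈ s, (z i).2) := by
  simp only [toC, Finset.sum_add_distrib, Finset.sum_mul, Int.cast_sum]

lemma noRoots' {x : XS} (hx : LX x) (hw : hX wX x = 0) (hn : hX x x = -3)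
    (h0 : x.1 = 0 ∨ x.1 = 1 ∨ x.1 = θ) : False := by
  have := hx.1
  simp only [EisP_iff] at this
  choose z hz using this
  have hl := hx.2
  simp only [hz] at hl
  rw [hX_w, al_conj] at hw
  simp only [hz, toC_sum] at hw hl
  simp only [hX, hz, toC_norm] at hn
  rcases h0 with h0 | h0 | h0
  · refine case0 z (fun j => ?_) ?_ ?_ ?_
    · have := hl j
      rw [h0, zero_sub, ← toC_neg, ThP_toC] at this
      rw [Finset.sum_add_distrib]
      convert this using 1
      simp only [eneg]; ring
    · rw [h0] at hw
      have := toC_inj (z := (∑ i, (z i).1, ∑ i, (z i).2)) (w := (0, 0)) (by rw [toC_zero]; linear_combination -hw)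
      exact congrArg Prod.fst this
    · rw [h0] at hw
      have := toC_inj (z := (∑ i, (z i).1, ∑ i, (z i).2)) (w := (0, 0)) (by rw [toC_zero]; linear_combination -hw)
      exact congrArg Prod.snd this
    · rw [h0] at hn
      have : ((∑ i, eN (z i) : ℤ) : ℂ) = (3 : ℤ) := by push_cast; linear_combination -hn
      exact_mod_cast this
  · refine case1 z (fun j => ?_) ?_ ?_ ?_
    · have := hl j
      rw [h0, show (1 : ℂ) = toC (1, 0) by simp [toC], sub_eq_add_neg, ← toC_neg, ← toC_add, ThP_toC] at this
      rw [Finset.sum_add_distrib]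
      convert this using 1
      simp only [eneg, eadd]; ring
    · rw [h0] at hw
      have := toC_inj (z := (∑ i, (z i).1, ∑ i, (z i).2)) (w := (1, -3)) (by
        rw [show toC (1, -3) = 1 - 3 * ω by simp [toC]; ring]; linear_combination -hw)
      exact congrArg Prod.fst this
    · rw [h0] at hw
      have := toC_inj (z := (∑ i, (z i).1, ∑ i, (z i).2)) (w := (1, -3)) (by
        rw [show toC (1, -3) = 1 - 3 * ω by simp [toC]; ring]; linear_combination -hw)
      exact congrArg Prod.snd this
    · rw [h0] at hn
      have : ((∑ i, eN (z i) : ℤ) : ℂ) = (4 : ℤ) := by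
        push_cast; simp at hn; linear_combination -hn
      exact_mod_cast this
  · refine case2 z ?_ ?_
    · rw [h0, th_eq] at hw
      have := toC_inj (z := (∑ i, (z i).1, ∑ i, (z i).2)) (w := (7, 5)) (by
        rw [show toC (7, 5) = 7 + 5 * ω by simp [toC]]; linear_combination -hw - 6 * om_sq)
      exact congrArg Prod.fst this
    · rw [h0, th_conj] at hn
      have : ((∑ i, eN (z i) : ℤ) : ℂ) = (6 : ℤ) := by
        push_cast; linear_combination -hn - th_sq
      exact_mod_cast this

lemma noRoots {x : XS} (hx : LX x) (hw : hX wX x = 0) (hn : hX x x = -3) : False := by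
  obtain ⟨k, e, u, hk, hu, he, h⟩ := al_red _ hx.eis
  have hxw : hX x wX = 0 := by rw [← hX_conj, hw, map_zero]
  apply noRoots' (x := conj u • (x - k • wX))
  · exact LX.smul hu.conj.eis (hx.sub (LX.smul hk LX_w))
  · rw [hX_smul, hX_sub, hw, hX_smul, w_null]; simp
  · rw [hX_smul, hX_smul_left, hX_sub, hX_sub_left, hX_sub_left, hX_smul, hX_smul, hX_smul_left,
      hX_smul_left, hw, hxw, w_null, hn, Complex.conj_conj]
    linear_combination -3 * hu.mulconj
  · have : (conj u • (x - k • wX)).1 = e := by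
      simp only [Prod.smul_fst, Prod.fst_sub, smul_eq_mul, wX]
      rw [h]
      linear_combination e * hu.mulconj
    rw [this]; exact he

end Bimonster

end

section
namespace Bimonster
open ComplexConjugate

/-- Evaluate a natural number before passing it on (useful for kernel computation). -/
def fN {β : Type} (n : ℕ) (k : ℕ → β) : β := Nat.rec (k 0) (fun m _ => k (m + 1)) n
def fI {β : Type} (z : ℤ) (k : ℤ → β) : β :=
  Int.rec (fun n => fN n fun m => k (Int.ofNat m)) (fun n => fN n fun m => k (Int.negSucc m)) z
def fP {β : Type} (z : ℤ × ℤ) (k : ℤ × ℤ → β) : β := fI z.1 fun a => fI z.2 fun b => k (a, b)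
lemma fN_eq {β : Type} (n : ℕ) (k : ℕ → β) : fN n k = k n := by cases n <;> rfl
lemma fI_eq {β : Type} (n : ℤ) (k : ℤ → β) : fI n k = k n := by
  cases n <;> simp only [fI, fN_eq]
lemma fP_eq {β : Type} (z : ℤ × ℤ) (k : ℤ × ℤ → β) : fP z k = k z := by
  simp only [fP, fI_eq]

def lget (l : List (ℤ × ℤ)) : ℕ → ℤ × ℤ :=
  List.rec (fun _ => (0, 0)) (fun x _ ih n => Nat.rec x (fun m _ => ih m) n) l

def forceN {β : Type} (s : ℕ → ℤ × ℤ) (k : (ℕ → ℤ × ℤ) → β) : β :=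
  fP (s 0) fun a0 =>
  fP (s 1) fun a1 =>
  fP (s 2) fun a2 =>
  fP (s 3) fun a3 =>
  fP (s 4) fun a4 =>
  fP (s 5) fun a5 =>
  fP (s 6) fun a6 =>
  fP (s 7) fun a7 =>
  fP (s 8) fun a8 =>
  fP (s 9) fun a9 =>
  fP (s 10) fun a10 =>
  fP (s 11) fun a11 =>
  fP (s 12) fun a12 =>
  fP (s 13) fun a13 =>
  k (lget [a0, a1, a2, a3, a4, a5, a6, a7, a8, a9, a10, a11, a12, a13])

def toXN (s : ℕ → ℤ × ℤ) : XS := (toC (s 0), fun i => toC (s (i + 1)))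

lemma toXN_congr {s t : ℕ → ℤ × ℤ} (h : ∀ n, n < 14 → s n = t n) : toXN s = toXN t := by
  simp only [toXN]
  rw [h 0 (by norm_num)]
  congr 1
  funext i
  rw [h _ (by omega)]

def trunc (s : ℕ → ℤ × ℤ) : ℕ → ℤ × ℤ :=
  lget [s 0, s 1, s 2, s 3, s 4, s 5, s 6, s 7, s 8, s 9, s 10, s 11, s 12, s 13]
lemma forceN_eq {β : Type} (s) (k : (ℕ → ℤ × ℤ) → β) : forceN s k = k (trunc s) := by
  simp only [forceN, fP_eq, trunc]
lemma trunc_eq (s n) (h : n < 14) : trunc s n = s n := by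
  interval_cases n <;> rfl
lemma toXN_trunc (s) : toXN (trunc s) = toXN s := toXN_congr (trunc_eq s)

def maskL : List (ℤ × ℤ) :=
  [(227, 0), (2311, 0), (4619, 0), (9235, 0), (12325, 0), (10313, 0), (6289, 0), (3617, 0), (5441, 0), (9089, 0), (313, 0), (597, 0), (1165, 0)]
def mask (j : ℕ) : ℕ := (lget maskL j).1.toNat

lemma mask_LN : ∀ j i : Fin 13, (Nat.testBit (mask j) (i + 1) = true ↔ i ∈ LN j) := by decide +kernel
lemma mask_zero : ∀ j : Fin 13, Nat.testBit (mask j) 0 = true := by decide +kernel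

/-- The point step: multiply a coordinate by `ω` or `ω̄`. -/
def ptStep (i : ℕ) (f : Bool) (s : ℕ → ℤ × ℤ) (n : ℕ) : ℤ × ℤ :=
  bif n == i + 1 then
    (bif f then ((s n).2 - (s n).1, -(s n).1) else (-(s n).2, (s n).1 - (s n).2))
  else s n

def msum (m : ℕ) (s : ℕ → ℤ × ℤ) : ℕ → ℤ × ℤ :=
  fun n => Nat.rec (0, 0) (fun k ih => bif Nat.testBit m (k + 1) then eadd (s (k + 1)) ih else ih) n

def lnT (f : Bool) (h : ℤ × ℤ) : ℤ × ℤ :=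
  bif (h.1 + h.2) % 3 == 0 then
    (bif f then (h.1 - (h.1 + h.2) / 3, (h.1 + h.2) / 3) else ((h.1 + h.2) / 3, h.2 - (h.1 + h.2) / 3))
  else (0, 0)

/-- The line step. -/
def lnStep (j : ℕ) (f : Bool) (s : ℕ → ℤ × ℤ) (k : (ℕ → ℤ × ℤ) → Bool) : Bool :=
  fN (mask j) fun m =>
  fP (lnT f (eadd (s 0) (eneg (msum m s 13)))) fun t =>
    k (fun n => bif Nat.testBit m n then eadd (s n) t else s n)

def lnStep' (j : ℕ) (f : Bool) (s : ℕ → ℤ × ℤ) (n : ℕ) : ℤ × ℤ :=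
  bif Nat.testBit (mask j) n then eadd (s n) (lnT f (eadd (s 0) (eneg (msum (mask j) s 13)))) else s n

lemma lnStep_eq (j f s k) : lnStep j f s k = k (lnStep' j f s) := by
  simp only [lnStep, fN_eq, fP_eq]; rfl

def run (fuel : ℕ) : ℕ → (ℕ → ℤ × ℤ) → ((ℕ → ℤ × ℤ) → Bool) → Bool :=
  Nat.rec (fun _ s k => k s) (fun _ ih code s k =>
    fN (code / 52) fun c2 => fN (code % 52 / 2) fun i =>
      bif Nat.ble 13 i then lnStep (i - 13) (code % 2 == 1) s fun s' => forceN s' fun s'' => ih c2 s'' k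
      else forceN (ptStep i (code % 2 == 1) s) fun s'' => ih c2 s'' k) fuel

lemma toXN_pt (i : Fin 13) (f : Bool) (s) :
    toXN (ptStep i f s) = reflX (if f then conj ω else ω) (pX i) (toXN s) := by
  have hn : hX (pX i) (pX i) = -3 := by
    rw [← Fm_iso, Fm_pX, pt_norm]
  refine Prod.ext ?_ (funext fun k => ?_)
  · simp [reflX, toXN, ptStep, pX]
  · simp only [reflX, hn, hX_pX, Prod.snd_sub, Prod.smul_snd, Pi.sub_apply, Pi.smul_apply, smul_eq_mul, toXN]
    by_cases hk : k = i
    · subst hk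
      simp only [ptStep, pX, BEq.rfl, cond_true, Pi.single_eq_same]
      have e := qc_norm
      cases f
      · simp only [cond_false, toC]
        push_cast
        linear_combination (((s (k + 1)).1 + (s (k + 1)).2 * ω) * (1 - ω) / 3) * e - (s (k + 1)).2 * om_sq
      · simp only [cond_true, toC, if_true, om_conj]
        push_cast
        linear_combination (((s (k + 1)).1 + (s (k + 1)).2 * ω) * (2 + ω) / 3) * e + (s (k + 1)).2 * om_sq
    · have : ((k : ℕ) + 1 == (i : ℕ) + 1) = false := by
        simp only [beq_eq_false_iff_ne]
        intro h
        exact hk (Fin.ext (by omega))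
      simp [ptStep, this, pX, hk]

lemma msum_eq (m s) (n : ℕ) : toC (msum m s n) =
    ∑ k ∈ Finset.range n, if Nat.testBit m (k + 1) then toC (s (k + 1)) else 0 := by
  induction n with
  | zero => simp [msum, toC]
  | succ n ih =>
    rw [Finset.sum_range_succ, ← ih]
    change toC (bif Nat.testBit m (n + 1) then eadd (s (n + 1)) (msum m s n) else msum m s n) = _
    cases Nat.testBit m (n + 1)
    · simp
    · simp [toC_add, add_comm]

lemma msum_LN (j : Fin 13) (s) : toC (msum (mask j) s 13) = ∑ i ∈ LN j, (toXN s).2 i := by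
  rw [msum_eq, ← Fin.sum_univ_eq_sum_range
    (fun k => if Nat.testBit (mask j) (k + 1) = true then toC (s (k + 1)) else 0) 13]
  simp only [mask_LN, toXN]
  simp [← Finset.sum_filter]

lemma lnT_eq (f : Bool) (h : ℤ × ℤ) : lnT f h = (0, 0) ∨
    toC (lnT f h) = (1 - if f then conj ω else ω) * toC h / 3 := by
  by_cases h3 : (h.1 + h.2) % 3 = 0
  · right
    obtain ⟨q, hq⟩ : (3 : ℤ) ∣ h.1 + h.2 := Int.dvd_of_emod_eq_zero h3
    have e : (h.1 + h.2) / 3 = q := by omega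
    have e2 : (h.1 : ℂ) = 3 * q - h.2 := by
      have : h.1 = 3 * q - h.2 := by omega
      exact_mod_cast this
    cases f
    · simp only [lnT, h3, e, toC]
      simp [e2]
      linear_combination (-(h.2 : ℂ) / 3) * (-om_sq)
    · simp only [lnT, h3, e, toC]
      simp [e2, om_conj]
      linear_combination (-(h.2 : ℂ) / 3) * om_sq
  · left
    have : ((h.1 + h.2) % 3 == 0) = false := by simpa using h3
    simp only [lnT, this, cond_false]

lemma toXN_ln (j : Fin 13) (f : Bool) (s) : toXN (lnStep' j f s) = toXN s ∨
    toXN (lnStep' j f s) = reflX (if f then conj ω else ω) (lX j) (toXN s) := by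
  have hn : hX (lX j) (lX j) = -3 := by
    rw [← Fm_iso, Fm_lX, lnr_norm]
  rcases lnT_eq f (eadd (s 0) (eneg (msum (mask j) s 13))) with h | h
  · left
    apply toXN_congr
    intro n _
    rw [lnStep', h]
    cases Nat.testBit (mask j) n <;> simp [eadd]
  · right
    have e : toC (eadd (s 0) (eneg (msum (mask j) s 13))) = hX (lX j) (toXN s) := by
      rw [toC_add, toC_neg, msum_LN, hX_lX]
      simp [toXN]; ring
    rw [e] at h
    rw [reflX, hn]
    generalize hX (lX j) (toXN s) = c at h
    refine Prod.ext ?_ (funext fun k => ?_)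
    · simp only [toXN, lnStep', mask_zero, cond_true, toC_add, h, Prod.fst_sub, Prod.smul_fst, lX, smul_eq_mul]
      ring
    · simp only [toXN, lnStep', Prod.snd_sub, Prod.smul_snd, lX, smul_eq_mul, Pi.sub_apply, Pi.smul_apply,
        ← mask_LN]
      cases Nat.testBit (mask j) (k + 1)
      · simp
      · simp only [cond_true, toC_add, h, if_true]
        ring

lemma run_sound (fuel : ℕ) : ∀ (code : ℕ) (s : ℕ → ℤ × ℤ) (k : (ℕ → ℤ × ℤ) → Bool), RX (toXN s) →
    run fuel code s k = true → ∃ s', RX (toXN s') ∧ k s' = true := by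
  induction fuel with
  | zero => exact fun code s k hs h => ⟨s, hs, h⟩
  | succ n ih =>
    intro code s k hs h
    have h : fN (code / 52) (fun c2 => fN (code % 52 / 2) fun i =>
      bif Nat.ble 13 i then lnStep (i - 13) (code % 2 == 1) s fun s' => forceN s' fun s'' => run n c2 s'' k
      else forceN (ptStep i (code % 2 == 1) s) fun s'' => run n c2 s'' k) = true := h
    simp only [fN_eq, forceN_eq, lnStep_eq] at h
    have hi : code % 52 / 2 < 26 := by omega
    generalize code % 52 / 2 = i at h hi
    generalize (code % 2 == 1) = f at h
    have hR {a b} (ha : RX a) (hb : RX b) : RX (reflX (if f then conj ω else ω) a b) := by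
      cases f
      · exact ha.refl hb
      · exact ha.inv hb
    cases hb : Nat.ble 13 i
    · rw [hb, cond_false] at h
      refine ih _ _ _ ?_ h
      have : i < 13 := by
        by_contra h0
        rw [Nat.ble_eq_true_of_le (by omega)] at hb
        exact absurd hb (by simp)
      rw [toXN_trunc]
      have e := toXN_pt ⟨i, this⟩ f s
      rw [show toXN (ptStep i f s) = _ from e]
      exact hR (RX_pX _) hs
    · rw [hb, cond_true] at h
      refine ih _ _ _ ?_ h
      rw [toXN_trunc]
      rcases toXN_ln ⟨i - 13, by omega⟩ f s with e | e
      · rw [show toXN (lnStep' (i - 13) f s) = _ from e]; exact hs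
      · rw [show toXN (lnStep' (i - 13) f s) = _ from e]
        exact hR (RX_lX _) hs

/-- The 26 roots, as integral vectors. -/
def dZ (k : ℕ) (n : ℕ) : ℤ × ℤ :=
  bif Nat.ble 13 k then (bif Nat.testBit (mask (k - 13)) n then (1, 0) else (0, 0))
  else (bif n == k + 1 then (-1, 1) else (0, 0))

def uZ (u : ℕ) : ℤ × ℤ := lget [(1, 0), (-1, 0), (0, 1), (0, -1), (-1, -1), (1, 1)] u

lemma toXN_dZ_pt (i : Fin 13) : toXN (dZ i) = pX i := by
  have h : Nat.ble 13 i = false := by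
    rw [← Bool.not_eq_true, Nat.ble_eq]; omega
  refine Prod.ext ?_ (funext fun k => ?_)
  · simp [toXN, dZ, h, pX, toC]
  · simp only [toXN, dZ, h, cond_false, pX]
    by_cases hk : k = i
    · subst hk
      simp [toC, qc_eq]
    · have : ((k : ℕ) + 1 == (i : ℕ) + 1) = false := by
        simp only [beq_eq_false_iff_ne]
        intro h
        exact hk (Fin.ext (by omega))
      simp [this, hk, toC]
lemma toXN_dZ_ln (i : Fin 13) : toXN (dZ (13 + i)) = lX i := by
  have h : Nat.ble 13 (13 + i) = true := by
    rw [Nat.ble_eq]; omega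
  refine Prod.ext ?_ (funext fun k => ?_)
  · simp only [toXN, dZ, h, cond_true, Nat.add_sub_cancel_left, mask_zero, lX]
    simp [toC]
  · simp only [toXN, dZ, h, cond_true, lX, Nat.add_sub_cancel_left, ← mask_LN]
    cases Nat.testBit (mask i) (k + 1) <;> simp [toC]

lemma RX_dZ (k : ℕ) (hk : k < 26) : RX (toXN (dZ k)) := by
  by_cases h : k < 13
  · have := toXN_dZ_pt ⟨k, h⟩
    simp only at this
    rw [this]; exact RX_pX _
  · have := toXN_dZ_ln ⟨k - 13, by omega⟩
    simp only at this
    rw [show 13 + (k - 13) = k by omega] at this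
    rw [this]; exact RX_lX _

lemma uZ_unit (u : ℕ) (hu : u < 6) : EisUnit (toC (uZ u)) := by
  apply eN_one
  interval_cases u <;> decide +kernel

lemma toXN_mul (c : ℤ × ℤ) (s) : toXN (fun n => emul c (s n)) = toC c • toXN s := by
  refine Prod.ext ?_ (funext fun k => ?_) <;> simp [toXN, toC_mul]

end Bimonster

end

section
namespace Bimonster
open ComplexConjugate

def hsumN (l s : ℕ → ℤ × ℤ) (n : ℕ) : ℤ × ℤ :=
  Nat.rec (0, 0) (fun k ih => eadd (emul (econj (l (k + 1))) (s (k + 1))) ih) n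
def hN (l s : ℕ → ℤ × ℤ) : ℤ × ℤ := eadd (emul (econj (l 0)) (s 0)) (eneg (hsumN l s 13))

lemma toC_hN (l s) : toC (hN l s) = hX (toXN l) (toXN s) := by
  have h : ∀ n, toC (hsumN l s n) = ∑ k ∈ Finset.range n, conj (toC (l (k + 1))) * toC (s (k + 1)) := by
    intro n
    induction n with
    | zero => exact toC_zero
    | succ n ih =>
      rw [Finset.sum_range_succ, ← ih, ← toC_conj, ← toC_mul, ← toC_add]
      congr 1
      simp only [hsumN, eadd, Prod.mk.injEq]
      constructor <;> ring
  rw [hN, toC_add, toC_neg, h, toC_mul, toC_conj, hX, toXN, toXN,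
    ← Fin.sum_univ_eq_sum_range (fun k => conj (toC (l (k + 1))) * toC (s (k + 1)))]
  ring

/-- The Heisenberg translation attached to `l` and `γ`. -/
def TX (l : XS) (γ : ℂ) (v : XS) : XS :=
  v + ((2 + ω) * hX wX v / 3) • l + (γ * hX wX v - (1 - ω) * hX l v / 3) • wX

def wN (n : ℕ) : ℤ × ℤ := Nat.rec (4, 3) (fun _ _ => (1, 0)) n
lemma toXN_wN : toXN wN = wX := by
  simp only [toXN, wN, wX, toC, al]; simp

def tgt (A B : ℤ × ℤ) (l s : ℕ → ℤ × ℤ) (n : ℕ) : ℤ × ℤ :=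
  eadd (emul (3, 0) (s n)) (eadd (emul A (l n)) (emul B (wN n)))

def chk (t r : ℕ → ℤ × ℤ) (n : ℕ) : Bool :=
  Nat.rec true (fun k ih => bif t k == emul (3, 0) (r k) then ih else false) n

lemma chk_sound (t r n) (h : chk t r n = true) : ∀ k, k < n → t k = emul (3, 0) (r k) := by
  induction n with
  | zero => intro k hk; omega
  | succ n ih =>
    have h : (bif t n == emul (3, 0) (r n) then chk t r n else false) = true := h
    cases h0 : t n == emul (3, 0) (r n)
    · simp [h0] at h
    · rw [h0, cond_true] at h
      intro k hk
      rcases Nat.lt_succ_iff_lt_or_eq.1 hk with h1 | rfl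
      · exact ih h k h1
      · exact eq_of_beq h0

def step1 (l : ℕ → ℤ × ℤ) (g : ℤ × ℤ) (d : ℕ) (c : ℕ) : Bool :=
  forceN (dZ d) fun s =>
  fP (hN wN s) fun hw => fP (emul (2, 1) hw) fun A =>
  fP (eadd (emul g hw) (eneg (emul (1, -1) (hN l s)))) fun B =>
  forceN (tgt A B l s) fun t =>
  fN (c % 26) fun bi => fN (c / 26 % 6) fun bu => fN (c / 156 % 64) fun len => fN (c / 9984) fun code =>
  forceN (fun n => emul (uZ bu) (dZ bi n)) fun s0 =>
  run len code s0 fun r => chk t r 14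

lemma step1_sound (l g d c) (h : step1 l g d c = true) :
    RX (TX (toXN l) (toC g / 3) (toXN (dZ d))) := by
  simp only [step1, forceN_eq, fP_eq, fN_eq] at h
  obtain ⟨r, hr, h⟩ := run_sound _ _ _ _ (by
    rw [toXN_trunc, toXN_mul]
    exact RX.unit (uZ_unit _ (Nat.mod_lt _ (by norm_num))) (RX_dZ _ (Nat.mod_lt _ (by norm_num)))) h
  have h := chk_sound _ _ _ h
  convert hr using 1
  have e : (3 : ℂ) • toXN r = (3 : ℂ) • TX (toXN l) (toC g / 3) (toXN (dZ d)) := by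
    have e3 : (3 : ℂ) = toC (3, 0) := by simp [toC]
    rw [e3, ← toXN_mul, ← toXN_congr h, toXN_trunc, ← e3]
    set A := emul (2, 1) (hN wN (trunc (dZ d))) with hA
    set B := eadd (emul g (hN wN (trunc (dZ d)))) (eneg (emul (1, -1) (hN l (trunc (dZ d))))) with hB
    have eA : toC A = (2 + ω) * hX wX (toXN (dZ d)) := by
      rw [hA, toC_mul, toC_hN, toXN_wN, toXN_trunc]; simp [toC]
    have eB : toC B = toC g * hX wX (toXN (dZ d)) - (1 - ω) * hX (toXN l) (toXN (dZ d)) := by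
      rw [hB, toC_add, toC_neg, toC_mul, toC_mul, toC_hN, toC_hN, toXN_wN, toXN_trunc]; simp [toC]; ring
    have ew (n) : toC (wN n) = toC (wN n) := rfl
    have e1 : toXN (tgt A B l (trunc (dZ d))) =
        (3 : ℂ) • toXN (trunc (dZ d)) + toC A • toXN l + toC B • toXN wN := by
      rw [e3]
      refine Prod.ext ?_ (funext fun k => ?_)
      · simp [toXN, tgt, toC_add, toC_mul]; ring
      · simp [toXN, tgt, toC_add, toC_mul]; ring
    rw [e1, toXN_trunc, toXN_wN, eA, eB, TX, smul_add, smul_add, smul_smul, smul_smul]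
    congr 3 <;> ring
  have := congrArg (fun x => (3 : ℂ)⁻¹ • x) e
  simpa using this.symm

def stepAll (l : ℕ → ℤ × ℤ) (g : ℤ × ℤ) (cs : List ℕ) : ℕ → Bool :=
  List.rec (fun _ => true) (fun c _ ih d => bif step1 l g d c then ih (d + 1) else false) cs

lemma stepAll_sound (l g) (cs : List ℕ) : ∀ d, stepAll l g cs d = true →
    ∀ k, k < cs.length → RX (TX (toXN l) (toC g / 3) (toXN (dZ (d + k)))) := by
  induction cs with
  | nil => intro d _ k hk; simp at hk
  | cons c cs ih =>
    intro d h k hk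
    have h : (bif step1 l g d c then stepAll l g cs (d + 1) else false) = true := h
    cases h0 : step1 l g d c
    · simp [h0] at h
    · rw [h0, cond_true] at h
      cases k with
      | zero => exact step1_sound _ _ _ _ h0
      | succ k =>
        have := ih (d + 1) h k (by simpa using hk)
        rwa [show d + 1 + k = d + (k + 1) by ring] at this

/-- Permitted translations. -/
def TOK (l : XS) (γ : ℂ) : Prop := (∀ i, RX (TX l γ (pX i))) ∧ ∀ i, RX (TX l γ (lX i))

lemma stepAll_TOK (l g) (cs : List ℕ) (hl : cs.length = 26) (h : stepAll l g cs 0 = true) :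
    TOK (toXN l) (toC g / 3) := by
  have := stepAll_sound l g cs 0 h
  constructor
  · intro i
    have := this i (by omega)
    rwa [zero_add, toXN_dZ_pt] at this
  · intro i
    have := this (13 + i) (by omega)
    rwa [zero_add, toXN_dZ_ln] at this

def l0Z_0 : ℕ → ℤ × ℤ := lget [(1, 0), (0, 0), (0, 0), (0, -1), (0, -1), (0, 0), (0, -1), (1, 1), (0, 0), (0, 0), (0, 0), (-1, -1), (0, -1), (1, 1)]
def codes0 : List ℕ :=
  [620034040997040697449512425940066628030083257,
    1701052850340264732238476868215553907769814208533,
    31305724826279267852241979556520709,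
    31371574385226762860390381062172752,
    1701053110707319459777453176744801343770066964501,
    31476927111931959321427580413062739,
    677747912380935751815657083786724386178593336,
    629059271726188701898884121644530957867802540,
    618927480952117609787961939488571474024296377,
    619100231948021716112490709475102966891490730,
    12239965000866491788941857209412421923380848713745342164,
    31818210435621616936501521896746579,
    1832630351320750178843934697662526666943413927152,
    12580126128868878324265315099851800824922451084623621330884960556274,
    3223610932989450992549381860582415788825467916184478248682662329791,
    620104975043397646458444918340089848324683013,
    89476175315079907187997000831038723459919595733581734570330561,
    12580075107952547114162101442309619235711525365471183255256295828479,
    95456348943415294254363710551179168904415367168474,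
    21529121272783964804363402919344473220333872520155,
    1192163806580223976865500903879835216933497934299363584735142008,
    618933323306011711654150035350386865495144454,
    4793100351522445691975382044632386029614277570442849573230782112428156043275,
    622491263814332465351131696200325866424144889,
    619106492111734994895792930944112796428214265,
    12603940696322412428562077885457223114695721618455071836425005254385]
lemma tok0 : TOK (toXN l0Z_0) (toC (3, 0) / 3) :=
  stepAll_TOK _ _ codes0 (by decide +kernel) (by decide +kernel)

def l0Z_1 : ℕ → ℤ × ℤ := lget [(0, 1), (0, 0), (0, 0), (1, 1), (1, 1), (0, 0), (1, 1), (-1, 0), (0, 0), (0, 0), (0, 0), (1, 0), (1, 1), (-1, 0)]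
def codes1 : List ℕ :=
  [20574505158412279207191496226322930322369421687,
    38517223460873209544077391648042576663161968586,
    86722155021868863532489255204407404859107688393600,
    32971682286915523930089594568184064164984335322175125560772,
    38517223460873209797310773752012134999284510088,
    1714527472864559631483165226291919192002842837242841016976488,
    107095708487171399723586576427510860301051013021770781169934070,
    7605175407943880141501337538478639234686224,
    7605175407942782693147192335218342350263185,
    146253218398015726721165028972975125536244,
    1806405655803696076596417432845,
    1667380608378055760871860154354807231006599350513,
    154586769638281337736562218409219788894497774835685881483680119550,
    24287221719714687558124603710308953248159175103061447659149,
    26942540482650522736265599094588378532253767130166078785294,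
    89315859534478660442712489608466234088361984774004656530273565,
    5102124715323797608545760224765842853193789946022681913820,
    1969200184128023586416394115035029347071002734005328689877,
    12184176440600945198657431170690594563456511977868531572732588898,
    12235064962600440833887618547279307314372360592825178302208081482,
    2022618569926929720578860152629543319020449197781056276238,
    12890156283892783132128960443279588198707201830857885555970406247525163269776089,
    618840662303109582351530609974778095345289295170809516,
    247887627293079846228255004962612696060891271532630048511603805783302993003914,
    12890156796145263977617516363802591739098358723005346846861230620028550068391976,
    24278009195752584271262745139381305114196400139355327440089]
lemma tok1 : TOK (toXN l0Z_1) (toC (3, 0) / 3) :=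
  stepAll_TOK _ _ codes1 (by decide +kernel) (by decide +kernel)

def l0Z_2 : ℕ → ℤ × ℤ := lget [(-1, -1), (0, 0), (0, 0), (-1, 0), (-1, 0), (0, 0), (-1, 0), (0, -1), (0, 0), (0, 0), (0, 0), (0, 1), (-1, 0), (0, -1)]
def codes2 : List ℕ :=
  [14353806022875935451453374820921015093385488,
    7414431820542505496619052449720717044763419,
    30954262267610924318208233223821411670563400651894144716927419547643361890,
    3064015279529216542612543663334353437253728193368970175883216134130,
    7414431815557086158271268379624163769434463,
    437150030092098646006001989749282678061783675456841943303149746983529119,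
    33337102781541623542592,
    5236303609776881871557670914755563128279,
    5236303603197075484695832114549264493797,
    14180244942697154439939656265493821242118802,
    761998889208928481884232552212152123440009078558665279039,
    168820207696688552008413338756588959685833150099853403856152469022767,
    7416585296228663125519,
    2046757872623764238001140262169467364689972878063323496335651,
    289715194330540190846169596796092481843003054047433360261976753506,
    47256004667357710793687321716733444303941987668025117094728761,
    2964521135558904174054882650738937974560538693749666563202006365,
    1068297157377160200015407906177239800051711098936658856487311,
    85393739070621343717943040438034419485022825397389843380110086475,
    59865892430132493738897579044691906448167857186234355562135178744,
    154766047763540260993294038343541859688744944496165860681480868166,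
    21793960847322570837803793494694962635339757210096204203275282,
    8047938431989585428107538029656618458940624334769132673746470327528,
    98448582535733239259491524362920542001651141344016261503535813,
    97959359138548277921213439178665758363781721280480011009299474,
    5559876160127617526084712109847998282728902613074436645239843514]
lemma tok2 : TOK (toXN l0Z_2) (toC (3, 0) / 3) :=
  stepAll_TOK _ _ codes2 (by decide +kernel) (by decide +kernel)

def codes3 : List ℕ :=
  [710586710083781670338085481927,
    246837183944515456023980,
    385786096487394677230517,
    3999713401244082807969251525662,
    5097171582198434859065015159241,
    6113026088791121299790156038171,
    2696768966185133068213373073,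
    8243012441300382880665997322697,
    9340454582050118147520258640329,
    1427574718049847013103271,
    11725282259104715086539117324568,
    12845437805477807282100619467571,
    13752966107571051286636978667802,
    38263516633154267235275147227747893184336282890701063661726738,
    5976610906948663904321329310022687359679556796136416935848978,
    8544633948668463798065787685332052566199231434940385503962,
    31751890232459340224522342538793095752730850082711253511744530,
    97790547448485687958764316589920408254715866315279495053356050,
    89475822490069608303820277287177559268942824211131782960426002,
    30777121574022446242286146975518677071025416367085601434283026,
    89811243896659844712373150627120271039443029584345612021050386,
    98452161863847435991254410893407593313535653513430720217263122,
    57188980559977633663559503723487283448876336212991872762031122,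
    21787822309743284716426839412338225912128400676539732876241938,
    72664040960627973586277142327897001632874797217433009172950034,
    80822006108635634470272594896009843339514788786718125934947346]
lemma tok3 : TOK (toXN (fun _ => (0, 0))) (toC (-1, -2) / 3) :=
  stepAll_TOK _ _ codes3 (by decide +kernel) (by decide +kernel)

def codes4 : List ℕ :=
  [161861735749643297784841334085,
    21692028208435344915702,
    10544170260594492050175,
    158638580905114200096542491496,
    158646813191189506085817829703,
    77051371115599201704470413157,
    58668128040237046322776079,
    12137826288307292367335106887,
    12130018369765814115108129095,
    1655398388006309418481,
    202057798087809262920990222434,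
    224763395792624713376004070065,
    34841749217591972805874974820,
    527981322548227679299957502831168149190466081728833957116,
    10172790058138513790930605298681670176186824917054120287,
    11355480419357738929823741293916665269209319241169964422,
    12539472867463077620737195593097642920951745845275282056,
    24552949491573606854445021580607777752440609871033802274574,
    9101657088278804330962348104033650499917315188607991648,
    9123519566613624410507136613501022268281655048930312327,
    9147151809836168692494614305444299345625562055442498002,
    10332341252413801824483420197296453023030287936212486788,
    11510736194294537927484713694926508768395036800957045384,
    44589698105614729843561721787024027284554310245255088874362989307,
    8175310224130675874377469688761385167859093984056859312009152,
    4617663503960457576715169327157981534346820945060426593]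
lemma tok4 : TOK (toXN (fun _ => (0, 0))) (toC (1, 2) / 3) :=
  stepAll_TOK _ _ codes4 (by decide +kernel) (by decide +kernel)

end Bimonster

end

section
namespace Bimonster
open ComplexConjugate

def TL (l : XS) (γ : ℂ) : XS →ₗ[ℂ] XS where
  toFun := TX l γ
  map_add' x y := by
    simp only [TX, hX_add]
    module
  map_smul' c x := by
    simp only [TX, hX_smul, RingHom.id_apply]
    module

lemma hX_wr {l} (h : hX wX l = 0) : hX l wX = 0 := by rw [← hX_conj, h, map_zero]

lemma TX_iso {l γ} (h : hX wX l = 0) (hg : γ + conj γ = -hX l l / 3) (x y) :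
    hX (TX l γ x) (TX l γ y) = hX x y := by
  simp only [TX, hX_add, hX_smul, hX_add_left, hX_smul_left, h, hX_wr h, w_null]
  rw [← hX_conj wX x, ← hX_conj l x]
  simp only [map_add, map_sub, map_mul, map_div₀, map_ofNat, map_one, om_conj]
  linear_combination (conj (hX wX x) * hX wX y) * hg -
    (conj (hX wX x) * hX wX y * hX l l) / 9 * om_sq

def Good (l : XS) : Prop := hX wX l = 0 ∧ ∃ γ : ℂ, γ + conj γ = -hX l l / 3 ∧ ∀ x, RX x → RX (TX l γ x)

lemma good_of_tok {l γ} (h : hX wX l = 0) (hg : γ + conj γ = -hX l l / 3) (ht : TOK l γ) :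
    ∀ x, RX x → RX (TX l γ x) :=
  fun _ hx => RX_map (TL l γ) (TX_iso h hg) ht.1 ht.2 hx

lemma Good.add {l l'} (hl : Good l) (hl' : Good l') : Good (l + l') := by
  obtain ⟨h, γ, hg, hx⟩ := hl
  obtain ⟨h', γ', hg', hx'⟩ := hl'
  refine ⟨by rw [hX_add, h, h', add_zero], γ + γ' - hX l l' / 3, ?_, fun x r => ?_⟩
  · simp only [map_add, map_sub, map_div₀, map_ofNat, hX_conj, hX_add, hX_add_left]
    linear_combination hg + hg'
  · have := hx _ (hx' x r)
    convert this using 1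
    simp only [TX, hX_add, hX_smul, hX_add_left, h', w_null, hX_wr h]
    have e : (1 - ω) * (2 + ω) = 3 := by linear_combination -om_sq
    match_scalars
    · ring
    · ring
    · ring
    · linear_combination (hX wX x * hX l l' / 9) * e

lemma Good.addw {l} (hl : Good l) (c : ℂ) : Good (l + c • wX) := by
  obtain ⟨h, γ, hg, hx⟩ := hl
  refine ⟨by rw [hX_add, h, hX_smul, w_null]; ring, γ - (2 + ω) * c / 3 + (1 - ω) * conj c / 3, ?_, fun x r => ?_⟩
  · simp only [map_add, map_sub, map_mul, map_div₀, map_ofNat, map_one, om_conj, Complex.conj_conj,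
      hX_add, hX_smul, hX_add_left, hX_smul_left, h, hX_wr h, w_null]
    linear_combination hg
  · convert hx x r using 1
    simp only [TX, hX_add_left, hX_smul_left]
    module

lemma Good.zero : Good 0 := by
  have z (x : XS) : hX 0 x = 0 := by simp [hX]
  refine ⟨by rw [← hX_conj, z, map_zero], 0, by simp [z], fun x hx => ?_⟩
  simpa [TX, z] using hx

lemma Good.nsmul {l} (hl : Good l) (n : ℕ) : Good (n • l) := by
  induction n with
  | zero => simpa using Good.zero
  | succ n ih => rw [succ_nsmul]; exact ih.add hl

/-- Permuting the coordinates. -/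
def permX (τ : Fin 13 → Fin 13) : XS →ₗ[ℂ] XS where
  toFun x := (x.1, fun i => x.2 (τ i))
  map_add' _ _ := rfl
  map_smul' _ _ := rfl

lemma permX_apply (τ x) : permX τ x = (x.1, fun i => x.2 (τ i)) := rfl

structure PL (τ τ' : Fin 13 → Fin 13) : Prop where
  l : ∀ i, τ' (τ i) = i
  r : ∀ i, τ (τ' i) = i
  p : ∀ j, ∃ j', ∀ i, τ i ∈ LN j ↔ i ∈ LN j'
  q : ∀ j, ∃ j', ∀ i, τ' i ∈ LN j ↔ i ∈ LN j'

lemma PL.symm {τ τ'} (h : PL τ τ') : PL τ' τ := ⟨h.r, h.l, h.q, h.p⟩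

lemma PL.iso {τ τ'} (h : PL τ τ') (x y) : hX (permX τ x) (permX τ y) = hX x y := by
  simp only [hX, permX_apply]
  congr 1
  exact Equiv.sum_comp (⟨τ, τ', h.l, h.r⟩ : Fin 13 ≃ Fin 13) (fun i => conj (x.2 i) * y.2 i)

lemma PL.rx {τ τ'} (h : PL τ τ') {x} (hx : RX x) : RX (permX τ x) := by
  refine RX_map (permX τ) h.iso (fun i => ?_) (fun j => ?_) hx
  · have : permX τ (pX i) = pX (τ' i) := by
      rw [permX_apply, pX, pX]
      congr 1
      funext k
      by_cases hk : τ k = i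
      · subst hk; simp [h.l]
      · have : k ≠ τ' i := by rintro rfl; exact hk (h.r i)
        simp [hk, this]
    rw [this]; exact RX_pX _
  · obtain ⟨j', hj⟩ := h.p j
    have : permX τ (lX j) = lX j' := by
      rw [permX_apply, lX, lX]
      congr 1
      funext k
      simp only [hj]
    rw [this]; exact RX_lX _

lemma PL.good {τ τ'} (h : PL τ τ') {l} (hl : Good l) : Good (permX τ l) := by
  obtain ⟨h0, γ, hg, hx⟩ := hl
  have hw : permX τ wX = wX := rfl
  refine ⟨by rw [← hw, h.iso, h0], γ, by rw [h.iso, hg], fun x r => ?_⟩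
  have := h.rx (hx _ (h.symm.rx r))
  convert this using 1
  have hxx : x = permX τ (permX τ' x) := by
    simp only [permX_apply, h.l]
  set y := permX τ' x
  rw [hxx]
  simp only [TX, map_add, map_smul, hw]
  rw [h.iso, ← h.iso wX y, hw]

def tau : Fin 12 → Fin 13 → Fin 13 :=
  ![![11, 5, 8, 12, 6, 10, 3, 7, 2, 1, 9, 0, 4],
    ![9, 10, 2, 11, 0, 3, 12, 8, 6, 5, 4, 1, 7],
    ![9, 6, 4, 7, 3, 12, 0, 2, 8, 5, 1, 10, 11],
    ![2, 1, 12, 3, 0, 8, 11, 9, 5, 4, 6, 10, 7],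
    ![6, 7, 0, 2, 11, 3, 10, 8, 4, 1, 12, 5, 9],
    ![0, 10, 8, 5, 3, 12, 9, 1, 2, 4, 7, 11, 6],
    ![9, 10, 5, 1, 3, 0, 12, 8, 7, 2, 4, 11, 6],
    ![3, 4, 11, 8, 0, 9, 12, 2, 10, 1, 7, 6, 5],
    ![7, 6, 3, 1, 5, 9, 11, 8, 2, 10, 12, 4, 0],
    ![0, 8, 6, 10, 3, 9, 12, 11, 4, 7, 2, 5, 1],
    ![12, 11, 3, 7, 2, 5, 10, 4, 9, 6, 1, 0, 8],
    ![9, 1, 0, 4, 5, 11, 7, 6, 12, 10, 2, 3, 8]]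
def tau' : Fin 12 → Fin 13 → Fin 13 :=
  ![![11, 9, 8, 6, 12, 1, 4, 7, 2, 10, 5, 0, 3],
    ![4, 11, 2, 5, 10, 9, 8, 12, 7, 0, 1, 3, 6],
    ![6, 10, 7, 4, 2, 9, 1, 3, 8, 0, 11, 12, 5],
    ![4, 1, 0, 3, 9, 8, 10, 12, 5, 7, 11, 6, 2],
    ![2, 9, 3, 5, 8, 11, 0, 1, 7, 12, 6, 4, 10],
    ![0, 7, 8, 4, 9, 3, 12, 10, 2, 6, 1, 11, 5],
    ![5, 3, 9, 4, 10, 2, 12, 8, 7, 0, 1, 11, 6],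
    ![4, 9, 7, 0, 1, 12, 11, 10, 3, 5, 8, 2, 6],
    ![12, 3, 8, 2, 11, 4, 1, 0, 7, 5, 9, 6, 10],
    ![0, 12, 10, 4, 8, 11, 2, 9, 1, 5, 3, 7, 6],
    ![11, 10, 4, 2, 7, 5, 9, 3, 12, 8, 6, 1, 0],
    ![2, 1, 10, 11, 3, 4, 7, 6, 12, 0, 9, 5, 8]]

lemma tau_PL (n) : PL (tau n) (tau' n) := by
  have h1 : ∀ n i, tau' n (tau n i) = i := by decide +kernel
  have h2 : ∀ n i, tau n (tau' n i) = i := by decide +kernel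
  have h3 : ∀ n j, ∃ j', ∀ i, tau n i ∈ LN j ↔ i ∈ LN j' := by decide +kernel
  have h4 : ∀ n j, ∃ j', ∀ i, tau' n i ∈ LN j ↔ i ∈ LN j' := by decide +kernel
  exact ⟨h1 n, h2 n, h3 n, h4 n⟩

lemma tok_good {l : ℕ → ℤ × ℤ} {g : ℤ × ℤ} (h : TOK (toXN l) (toC g / 3)) (h1 : hN wN l = (0, 0))
    (h2 : eadd (eadd g (econj g)) (hN l l) = (0, 0)) :
    Good (toXN l) ∧ ∀ x, RX x → RX (TX (toXN l) (toC g / 3) x) := by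
  have e1 : hX wX (toXN l) = 0 := by rw [← toXN_wN, ← toC_hN, h1, toC_zero]
  have e2 : toC g / 3 + conj (toC g / 3) = -hX (toXN l) (toXN l) / 3 := by
    have := congrArg toC h2
    rw [toC_add, toC_add, toC_conj, toC_hN, toC_zero] at this
    rw [map_div₀, map_ofNat]
    linear_combination this / 3
  exact ⟨⟨e1, _, e2, good_of_tok e1 e2 h⟩, good_of_tok e1 e2 h⟩

def l0X : XS := toXN l0Z_0

lemma good_l0 : Good l0X := (tok_good tok0 (by decide +kernel) (by decide +kernel)).1
lemma good_l1 : Good (ω • l0X) := by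
  have := (tok_good tok1 (by decide +kernel) (by decide +kernel)).1
  have e : toXN l0Z_1 = ω • l0X := by
    have h : ∀ n < 14, l0Z_1 n = emul (0, 1) (l0Z_0 n) := by decide +kernel
    rw [toXN_congr h, toXN_mul]; simp [toC, l0X]
  rwa [e] at this
lemma good_l2 : Good (ω ^ 2 • l0X) := by
  have := (tok_good tok2 (by decide +kernel) (by decide +kernel)).1
  have e : toXN l0Z_2 = ω ^ 2 • l0X := by
    have h : ∀ n < 14, l0Z_2 n = emul (-1, -1) (l0Z_0 n) := by decide +kernel
    rw [toXN_congr h, toXN_mul, om_sq]; simp [toC, l0X]; congr 1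
  rwa [e] at this

lemma good_smul {c : ℂ} (hc : EisP c) : Good (c • l0X) := by
  obtain ⟨a, b, rfl⟩ := hc
  have e : ((a : ℂ) + b * ω) • l0X = (a + a.natAbs + b.natAbs : ℤ).toNat • l0X +
      (b + a.natAbs + b.natAbs : ℤ).toNat • (ω • l0X) + (a.natAbs + b.natAbs) • (ω ^ 2 • l0X) := by
    obtain ⟨m, hm⟩ := Int.eq_ofNat_of_zero_le (show 0 ≤ a + a.natAbs + b.natAbs by omega)
    obtain ⟨n, hn⟩ := Int.eq_ofNat_of_zero_le (show 0 ≤ b + a.natAbs + b.natAbs by omega)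
    rw [hm, hn, Int.toNat_natCast, Int.toNat_natCast]
    have hm' : (a : ℂ) = m - (a.natAbs + b.natAbs : ℕ) := by
      have : a = m - (a.natAbs + b.natAbs : ℕ) := by omega
      exact_mod_cast this
    have hn' : (b : ℂ) = n - (a.natAbs + b.natAbs : ℕ) := by
      have : b = n - (a.natAbs + b.natAbs : ℕ) := by omega
      exact_mod_cast this
    rw [hm', hn', om_sq]
    generalize a.natAbs + b.natAbs = N
    module
  rw [e]
  exact ((good_l0.nsmul _).add (good_l1.nsmul _)).add (good_l2.nsmul _)

def lM : Fin 14 → ℕ → ℤ × ℤ :=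
  ![lget [(1, 0), (0, -1), (0, -1), (0, 0), (1, 1), (1, 1), (-1, -1), (0, -1), (0, 0), (0, -1), (0, 0), (0, 0), (0, 0), (0, 0)],
    lget [(1, 0), (0, 0), (-1, -1), (0, -1), (0, -1), (0, 0), (0, -1), (1, 1), (0, 0), (1, 1), (0, -1), (0, 0), (0, 0), (0, 0)],
    lget [(1, 0), (0, 0), (1, 1), (0, 0), (0, 0), (0, -1), (1, 1), (0, 0), (0, -1), (0, 0), (0, -1), (0, 0), (-1, -1), (0, -1)],
    lget [(1, 0), (0, -1), (0, 0), (1, 1), (0, -1), (0, 0), (0, 0), (0, -1), (0, 0), (0, -1), (0, 0), (1, 1), (-1, -1), (0, 0)],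
    lget [(1, 0), (1, 1), (0, 0), (0, 0), (0, -1), (0, -1), (0, -1), (-1, -1), (0, 0), (0, 0), (0, 0), (1, 1), (0, -1), (0, 0)],
    lget [(1, 0), (0, 0), (-1, -1), (0, 0), (0, -1), (0, -1), (1, 1), (0, 0), (0, 0), (0, -1), (0, 0), (0, 0), (0, -1), (1, 1)],
    lget [(1, 0), (0, 0), (-1, -1), (0, -1), (0, 0), (0, -1), (0, 0), (1, 1), (0, 0), (0, 0), (0, -1), (0, 0), (0, -1), (1, 1)],
    lget [(1, 0), (0, -1), (0, 0), (0, -1), (0, 0), (0, 0), (0, 0), (1, 1), (0, -1), (-1, -1), (0, 0), (0, 0), (1, 1), (0, -1)],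
    lget [(1, 0), (0, 0), (1, 1), (0, -1), (0, 0), (0, -1), (0, 0), (0, -1), (0, 0), (0, -1), (-1, -1), (1, 1), (0, 0), (0, 0)],
    lget [(1, 0), (0, 0), (0, 0), (1, 1), (-1, -1), (0, -1), (0, 0), (1, 1), (0, -1), (0, 0), (0, 0), (0, -1), (0, -1), (0, 0)],
    lget [(1, 0), (1, 1), (0, -1), (0, -1), (0, 0), (0, -1), (0, -1), (-1, -1), (0, 0), (0, 0), (1, 1), (0, 0), (0, 0), (0, 0)],
    lget [(1, 0), (0, 0), (0, 0), (0, 0), (0, 0), (0, -1), (0, -1), (0, 0), (1, 1), (1, 1), (-1, -1), (0, -1), (0, -1), (0, 0)],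
    lget [(4, 3), (1, 0), (1, 0), (1, 0), (1, 0), (1, 0), (1, 0), (1, 0), (1, 0), (1, 0), (1, 0), (1, 0), (1, 0), (1, 0)],
    lget [(0, 0), (-1, 1), (0, 0), (0, 0), (0, 0), (0, 0), (0, 0), (0, 0), (0, 0), (0, 0), (0, 0), (0, 0), (0, 0), (0, 0)]]
def mM : Fin 14 → ℕ → ℤ × ℤ :=
  ![lget [(7, -8), (0, 0), (-5, -6), (0, -5), (0, -1), (-2, -2), (0, -2), (-1, -3), (0, -3), (-1, -7), (-1, -4), (2, -4), (-2, -7), (-7, -9)],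
    lget [(11, -13), (0, 0), (-7, -8), (0, -8), (2, -2), (-3, -4), (-1, -4), (-1, -4), (-1, -4), (-3, -12), (-1, -6), (2, -8), (-4, -11), (-11, -14)],
    lget [(-7, -17), (0, 0), (-6, -2), (-5, -6), (-2, -3), (-3, -1), (-3, -2), (-3, -3), (-2, -2), (-8, -7), (-4, -4), (-5, -7), (-7, -6), (-10, -4)],
    lget [(-3, -5), (0, 0), (0, 0), (-2, -1), (-1, -2), (-1, -1), (-2, -1), (0, 0), (-1, 1), (-3, -2), (-1, -1), (-3, -2), (-2, -1), (-2, -1)],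
    lget [(-8, -8), (0, 0), (-3, 0), (-3, -1), (-2, -1), (-2, 0), (-1, 0), (-2, -2), (0, -1), (-5, -1), (-3, -2), (-4, -2), (-3, 0), (-4, 2)],
    lget [(4, -3), (0, 0), (-3, -4), (1, -2), (0, 0), (-1, -1), (0, 0), (-1, -2), (0, -2), (1, -2), (-1, -2), (2, -1), (0, -3), (-3, -5)],
    lget [(-15, 7), (0, 0), (6, 9), (-2, 6), (-2, 1), (2, 4), (0, 3), (0, 4), (0, 4), (-1, 9), (0, 5), (-5, 5), (1, 9), (7, 14)],
    lget [(-4, -9), (0, 0), (-3, -2), (-2, -2), (-2, -2), (-2, -1), (-2, -1), (-2, -2), (-1, -1), (-4, -3), (-3, -3), (-3, -3), (-3, -2), (-4, -2)],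
    lget [(21, 11), (0, 0), (1, -5), (7, 0), (4, 2), (2, -2), (3, -1), (3, 0), (2, -1), (9, -2), (5, 0), (9, 2), (6, -3), (3, -9)],
    lget [(21, 6), (0, 0), (0, -7), (5, -2), (3, 0), (1, -3), (2, -2), (3, -1), (3, -1), (6, -5), (4, -2), (8, 0), (4, -5), (0, -11)],
    lget [(8, 7), (0, 0), (3, -1), (3, 1), (1, 0), (2, 0), (1, 0), (2, 1), (1, 1), (4, 1), (2, 1), (3, 2), (3, 0), (4, -2)],
    lget [(-5, -11), (0, 0), (-4, -2), (-3, -3), (-2, -2), (-2, -1), (-2, -1), (-2, -2), (-2, -1), (-5, -4), (-3, -3), (-3, -4), (-4, -3), (-6, -3)],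
    lget [(-19, -4), (0, 0), (0, 7), (-5, 2), (-2, 1), (0, 3), (-1, 2), (-2, 2), (-2, 1), (-5, 5), (-3, 3), (-6, 1), (-4, 5), (0, 11)],
    lget [(-1, -4), (-1, -1), (-1, -1), (-1, -1), (-1, -1), (-1, -1), (-1, -1), (-1, -1), (-1, -1), (-1, -1), (-1, -1), (-1, -1), (-1, -1), (-1, -1)]]
def sgn14 : Fin 14 → ℤ × ℤ := Fin.cons (1, 0) fun _ => (-1, 0)

set_option maxRecDepth 4000 in
lemma spanId : ∀ k k' : Fin 14, ∑ i : Fin 14, emul (emul (sgn14 k) (econj (mM i k))) (lM i k') =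
    if k = k' then (1, 2) else (0, 0) := by decide +kernel

lemma LX_toXN (s : ℕ → ℤ × ℤ) (h : ∀ j : Fin 13, (3 : ℤ) ∣
    (s 0 - ∑ i ∈ LN j, s (i + 1)).1 + (s 0 - ∑ i ∈ LN j, s (i + 1)).2) : LX (toXN s) := by
  refine ⟨fun i => EisP.toC _, fun j => ?_⟩
  have := (ThP_toC _).2 (h j)
  change ThP (toCh _) at this
  rw [map_sub, map_sum] at this
  exact this

lemma mM_LX (i) : LX (toXN (mM i)) := by
  apply LX_toXN
  revert i
  decide +kernel

lemma span_id (x : XS) : θ • x = ∑ i, hX (toXN (mM i)) x • toXN (lM i) := by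
  set xv : Fin 14 → ℂ := Fin.cons x.1 x.2 with hxv
  have hx (s : ℕ → ℤ × ℤ) : hX (toXN s) x = ∑ k : Fin 14, toC (sgn14 k) * conj (toC (s k)) * xv k := by
    rw [Fin.sum_univ_succ]
    have e0 : toC (1, 0) = 1 := by simp [toC]
    have e1 : toC (-1, 0) = -1 := by simp [toC]
    simp only [sgn14, hxv, Fin.cons_zero, Fin.cons_succ, e0, e1, hX, toXN, Fin.val_zero, Fin.val_succ, one_mul,
      neg_one_mul, neg_mul, Finset.sum_neg_distrib]
    ring
  have key (k' : Fin 14) : ∑ i, hX (toXN (mM i)) x * toC (lM i k') = θ * xv k' := by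
    simp only [hx, Finset.sum_mul]
    rw [Finset.sum_comm]
    have : ∀ k, ∑ i, toC (sgn14 k) * conj (toC (mM i k)) * xv k * toC (lM i k') =
        (if k = k' then θ else 0) * xv k := by
      intro k
      have h := congrArg toCh (spanId k k')
      rw [map_sum] at h
      have e : toCh (if k = k' then (1, 2) else (0, 0)) = if k = k' then θ else 0 := by
        change toC _ = _
        split_ifs
        · simp [toC, th_eq]
        · exact toC_zero
      rw [← e, ← h, Finset.sum_mul]
      refine Finset.sum_congr rfl fun i _ => ?_
      change _ = toC _ * _
      rw [toC_mul, toC_mul, toC_conj]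
      ring
    simp only [this]
    simp
  refine Prod.ext ?_ (funext fun k => ?_)
  · have := key 0
    simp only [Prod.smul_fst, smul_eq_mul, Prod.fst_sum]
    rw [show θ * x.1 = θ * xv 0 from rfl, ← this]
    rfl
  · have := key k.succ
    simp only [Prod.smul_snd, Prod.snd_sum, Finset.sum_apply, Pi.smul_apply, smul_eq_mul]
    rw [show θ * x.2 k = θ * xv k.succ from rfl, ← this]
    rfl

lemma good_sum {ι : Type*} (s : Finset ι) (f : ι → XS) (h : ∀ i ∈ s, Good (f i)) : Good (∑ i ∈ s, f i) := by
  classical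
  induction s using Finset.induction_on with
  | empty => simpa using Good.zero
  | insert a s ha ih =>
    rw [Finset.sum_insert ha]
    exact (h a (by simp)).add (ih fun i hi => h i (by simp [hi]))

lemma good_all {x : XS} (hx : LX x) (hw : hX wX x = 0) : Good x := by
  have key : ∀ i, ∃ c, EisP c ∧ hX (toXN (mM i)) x = θ * c := fun i => (mM_LX i).pair hx
  choose c hc he using key
  have e13 : c 13 = 0 := by
    have h : ∀ n < 14, mM 13 n = emul (-1, -1) (wN n) := by decide +kernel
    have := he 13
    rw [toXN_congr h, toXN_mul, toXN_wN, hX_smul_left, hw, mul_zero] at this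
    have h2 := this.symm
    simpa [th_ne] using h2
  have e12 : toXN (lM 12) = wX := by
    have h : ∀ n < 14, lM 12 n = wN n := by decide +kernel
    rw [toXN_congr h, toXN_wN]
  have hl (i : Fin 12) : toXN (lM (i.castLE (by norm_num))) = permX (tau i) l0X := by
    have h0 : ∀ i : Fin 12, lM (i.castLE (by norm_num)) 0 = l0Z_0 0 := by decide +kernel
    have h1 : ∀ (i : Fin 12) (k : Fin 13), lM (i.castLE (by norm_num)) (k + 1) = l0Z_0 (tau i k + 1) := by
      decide +kernel
    rw [permX_apply, l0X, toXN, h0]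
    simp only [h1]
    rfl
  have hxx : x = ∑ i, c i • toXN (lM i) := by
    have h : θ • x = θ • ∑ i, c i • toXN (lM i) := by
      rw [span_id x, Finset.smul_sum]
      exact Finset.sum_congr rfl fun i _ => by rw [he i, smul_smul]
    exact smul_right_injective _ th_ne h
  rw [Fin.sum_univ_castSucc, Fin.sum_univ_castSucc] at hxx
  have e1 : (Fin.last 13 : Fin 14) = 13 := rfl
  have e2 : ((Fin.last 12).castSucc : Fin 14) = 12 := rfl
  rw [e1, e2, e13, e12, zero_smul, add_zero] at hxx
  rw [hxx]
  apply Good.addw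
  apply good_sum
  intro i _
  have h := (tau_PL i).good (good_smul (hc (i.castLE (by norm_num))))
  rw [map_smul, ← hl] at h
  exact h

end Bimonster

end

section
namespace Bimonster
open ComplexConjugate

lemma kk : (1 - ω) * (2 + ω) = 3 := by linear_combination -om_sq
lemma kconj : conj (1 - ω) = 2 + ω := by rw [map_sub, map_one, om_conj]; ring
lemma k_ne : (1 - ω) ≠ 0 := by
  intro h
  have := kk
  rw [h] at this; simp at this
lemma kc_ne : (2 + ω) ≠ 0 := by
  intro h
  have := kk
  rw [h] at this; simp at this

lemma toXN_zero : toXN (fun _ => (0, 0)) = 0 := by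
  simp only [toXN, toC_zero]; rfl
lemma hX_zero_left (x : XS) : hX 0 x = 0 := by simp [hX]
lemma hX_zero (x : XS) : hX x 0 = 0 := by simp [hX]

lemma shift1 {x} (hx : RX x) (hw : hX wX x = 1 - ω) : RX (x + ω ^ 2 • wX) := by
  have := (tok_good tok3 (by decide +kernel) (by decide +kernel)).2 x hx
  convert this using 1
  rw [toXN_zero, TX, hX_zero_left, hw, smul_zero, add_zero, mul_zero, zero_div, sub_zero]
  congr 2
  simp only [toC]; push_cast
  linear_combination (1 / 3 : ℂ) * om_sq
lemma shift2 {x} (hx : RX x) (hw : hX wX x = 1 - ω) : RX (x - ω ^ 2 • wX) := by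
  have := (tok_good tok4 (by decide +kernel) (by decide +kernel)).2 x hx
  convert this using 1
  rw [toXN_zero, TX, hX_zero_left, hw, smul_zero, add_zero, mul_zero, zero_div, sub_zero, sub_eq_add_neg,
    ← neg_smul]
  congr 2
  simp only [toC]; push_cast
  linear_combination (-1 / 3 : ℂ) * om_sq

lemma hX_w_shift (x : XS) (c : ℂ) : hX wX (x + c • wX) = hX wX x := by
  rw [hX_add, hX_smul, w_null, mul_zero, add_zero]

lemma shiftn (n : ℕ) : ∀ {x}, RX x → hX wX x = 1 - ω →
    RX (x + ((n : ℂ) * ω ^ 2) • wX) ∧ RX (x - ((n : ℂ) * ω ^ 2) • wX) := by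
  induction n with
  | zero => intro x hx hw; simpa using hx
  | succ n ih =>
    intro x hx hw
    have h1 := shift1 (ih hx hw).1 (by rw [hX_w_shift, hw])
    have h2 := shift2 (ih hx hw).2 (by rw [sub_eq_add_neg, ← neg_smul, hX_w_shift, hw])
    constructor
    · convert h1 using 1; push_cast; module
    · convert h2 using 1; push_cast; module

lemma shiftz (n : ℤ) {x} (hx : RX x) (hw : hX wX x = 1 - ω) : RX (x + ((n : ℂ) * ω ^ 2) • wX) := by
  obtain ⟨m, rfl | rfl⟩ := n.eq_nat_or_neg
  · simpa using (shiftn m hx hw).1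
  · have := (shiftn m hx hw).2
    convert this using 1; push_cast; module

lemma w_pX (i) : hX wX (pX i) = 1 - ω := by
  rw [hX_w, pX, Finset.sum_eq_single i]
  · simp [qc_eq]; ring
  · intro j _ hj
    simp [hj]
  · simp
lemma p_norm (i) : hX (pX i) (pX i) = -3 := by
  rw [← Fm_iso, Fm_pX, pt_norm]

lemma om_lin {a b : ℤ} (h : (a : ℂ) + b * ω = 0) : a = 0 ∧ b = 0 := by
  have : toC (a, b) = toC (0, 0) := by rw [toC_zero]; exact h
  have := toC_inj this
  simpa using this

/-- Leech roots lie in the radical. -/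
lemma leech {s} (hs : LX s) (hn : hX s s = -3) (hw : hX wX s = 1 - ω) : RX s := by
  have hl : LX (s - pX 0) := hs.sub (LX_pX 0)
  have hl0 : hX wX (s - pX 0) = 0 := by rw [hX_sub, hw, w_pX, sub_self]
  obtain ⟨_, γ, hg, hR⟩ := good_all hl hl0
  have h1 := hR _ (RX_pX 0)
  obtain ⟨b, hb⟩ : ∃ b : ℂ, TX (s - pX 0) γ (pX 0) = s + b • wX := by
    refine ⟨γ * (1 - ω) - (1 - ω) * hX (s - pX 0) (pX 0) / 3, ?_⟩
    rw [TX, w_pX, mul_comm (2 + ω), kk]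
    simp
  rw [hb] at h1
  have hbe : EisP b := by
    have := (h1.lx.sub hs).1 0
    simpa [wX] using this
  obtain ⟨m, n, rfl⟩ := hbe
  have hsw : hX s wX = 2 + ω := by rw [← hX_conj, hw, kconj]
  have e := h1.norm
  simp only [hX_add, hX_add_left, hX_smul, hX_smul_left, hn, hw, hsw, w_null, map_add, map_mul, om_conj] at e
  have e2 : ((3 * m - 3 * n : ℤ) : ℂ) + (0 : ℤ) * ω = 0 := by
    simp at e
    push_cast
    linear_combination e - 2 * n * om_sq
  have := (om_lin e2).1
  have hmn : m = n := by omega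
  subst hmn
  have h2 := shiftz m h1 (by rw [hX_w_shift, hw])
  convert h2 using 1
  rw [om_sq]
  module

end Bimonster

end

section
namespace Bimonster
open ComplexConjugate
open scoped RealInnerProductSpace

def onesE : EuclideanSpace ℂ (Fin 13) := WithLp.toLp 2 fun _ => 1

def EK : Type := ↥(Submodule.span ℂ {onesE})ᗮ
instance : NormedAddCommGroup EK := inferInstanceAs (NormedAddCommGroup ↥(Submodule.span ℂ {onesE})ᗮ)
instance : InnerProductSpace ℂ EK := inferInstanceAs (InnerProductSpace ℂ ↥(Submodule.span ℂ {onesE})ᗮ)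
instance : InnerProductSpace ℝ EK := InnerProductSpace.complexToReal

lemma EK_sum (v : EK) : ∑ i, v.1 i = 0 := by
  have := (Submodule.mem_orthogonal_singleton_iff_inner_right).1 v.2
  rw [PiLp.inner_apply] at this
  simpa [onesE] using this

lemma EK_mk (f : Fin 13 → ℂ) (h : ∑ i, f i = 0) : ∃ v : EK, ∀ i, v.1 i = f i := by
  refine ⟨⟨WithLp.toLp 2 f, ?_⟩, fun i => rfl⟩
  rw [Submodule.mem_orthogonal_singleton_iff_inner_right, PiLp.inner_apply]
  simpa [onesE] using h

lemma EK_rank : Module.finrank ℝ EK = 24 := by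
  haveI : Fact (Module.finrank ℂ (EuclideanSpace ℂ (Fin 13)) = 12 + 1) := ⟨by simp⟩
  have h : Module.finrank ℂ EK = 12 := by
    apply Submodule.finrank_orthogonal_span_singleton (𝕜 := ℂ) (n := 12)
    intro h
    have := congrArg (fun x : EuclideanSpace ℂ (Fin 13) => x 0) h
    simp [onesE] at this
  have h2 := finrank_real_of_complex EK
  rw [h] at h2
  exact h2

def sc : ℝ := Real.sqrt (3 / 2)
lemma sc_sq : sc * sc = 3 / 2 := Real.mul_self_sqrt (by norm_num)
lemma sc_ne : (sc : ℂ) ≠ 0 := by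
  intro h
  have h : sc = 0 := by exact_mod_cast h
  have := sc_sq
  rw [h] at this; norm_num at this

def cE : EK →ₗ[ℂ] XS where
  toFun v := (0, fun i => sc * v.1 i)
  map_add' u v := by
    refine Prod.ext (by simp) (funext fun i => ?_)
    exact mul_add _ _ _
  map_smul' c v := by
    refine Prod.ext (by simp) (funext fun i => ?_)
    exact mul_left_comm _ _ _

lemma cE_w (v) : hX wX (cE v) = 0 := by
  rw [hX_w]
  simp only [cE, LinearMap.coe_mk, AddHom.coe_mk, ← Finset.mul_sum, EK_sum]
  simp

lemma cE_inner (u v : EK) : hX (cE u) (cE v) = -(3 / 2) * inner ℂ u v := by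
  have h : inner ℂ u v = ∑ i, inner ℂ (u.1 i) (v.1 i) := rfl
  rw [h, hX]
  simp only [cE, LinearMap.coe_mk, AddHom.coe_mk, map_mul, Complex.conj_ofReal, RCLike.inner_apply]
  rw [Finset.mul_sum, map_zero, zero_mul, zero_sub, ← Finset.sum_neg_distrib]
  refine Finset.sum_congr rfl fun i _ => ?_
  have : (sc : ℂ) * sc = 3 / 2 := by
    have := congrArg (fun x : ℝ => (x : ℂ)) sc_sq
    push_cast at this
    exact this
  linear_combination (-conj (u.1 i) * v.1 i) * this

lemma cE_lift (z : XS) (hz : hX wX z = 0) : ∃ v : EK, z = cE v + (z.1 / al) • wX := by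
  have ha : al ≠ 0 := by
    intro h
    have := al_norm
    rw [h] at this; simp at this
  obtain ⟨v, hv⟩ := EK_mk (fun i => (sc : ℂ)⁻¹ * (z.2 i - z.1 / al)) (by
    rw [← Finset.mul_sum, Finset.sum_sub_distrib]
    rw [hX_w] at hz
    have : ∑ i, z.2 i = conj al * z.1 := by linear_combination -hz
    rw [this]
    have e : conj al * z.1 = 13 * (z.1 / al) := by
      rw [← al_norm]; field_simp
    rw [e]; simp)
  refine ⟨v, Prod.ext ?_ (funext fun i => ?_)⟩
  · simp [cE, wX, ha]
  · have := sc_ne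
    simp [cE, wX, hv]
    field_simp; ring

lemma hX_cw (u v : EK) (k k' : ℂ) : hX (cE u + k • wX) (cE v + k' • wX) = hX (cE u) (cE v) := by
  simp only [hX_add, hX_add_left, hX_smul, hX_smul_left, w_null, cE_w, hX_wr (cE_w _)]
  ring
lemma w_cw (u : EK) (k : ℂ) : hX wX (cE u + k • wX) = 0 := by
  rw [hX_w_shift, cE_w]

/-- The (real form of the) Leech lattice. -/
def LamE : Submodule ℤ EK where
  carrier := {v | ∃ k : ℂ, LX (cE v + k • wX)}
  add_mem' := by
    rintro u v ⟨k, hk⟩ ⟨k', hk'⟩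
    refine ⟨k + k', ?_⟩
    convert hk.add hk' using 1
    rw [map_add]; module
  zero_mem' := ⟨0, by
    have := (LX_w).smul EisP.zero
    simpa using this⟩
  smul_mem' := by
    rintro n v ⟨k, hk⟩
    refine ⟨n * k, ?_⟩
    have := hk.smul (EisP.int n)
    convert this using 1
    rw [map_zsmul, ← Int.cast_smul_eq_zsmul ℂ]; module

lemma mem_LamE (v) : v ∈ LamE ↔ ∃ k : ℂ, LX (cE v + k • wX) := Iff.rfl

lemma EK_real (u v : EK) : ⟪u, v⟫ = (inner ℂ u v : ℂ).re := rfl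
lemma EK_norm (v : EK) : (‖v‖ : ℂ) ^ 2 = inner ℂ v v := (inner_self_eq_norm_sq_to_K v).symm
lemma EK_norm' (v : EK) : hX (cE v) (cE v) = -(3 / 2) * (‖v‖ : ℂ) ^ 2 := by
  rw [cE_inner, EK_norm]

lemma LamE_even : ∀ v ∈ LamE, ∃ n : ℤ, ‖v‖ ^ 2 = 2 * n := by
  rintro v ⟨k, hk⟩
  obtain ⟨n, hn⟩ := ThP_real (hk.pair hk) (hX_conj _ _)
  rw [hX_cw, EK_norm'] at hn
  refine ⟨-n, ?_⟩
  have : (‖v‖ : ℂ) ^ 2 = 2 * (-n : ℤ) := by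
    push_cast
    linear_combination (-2 / 3 : ℂ) * hn
  exact_mod_cast this

lemma re_om {z : ℂ} {a b : ℝ} (h1 : z.re = a) (h2 : (ω * z).re = b) :
    θ * z = 2 * (b - a * conj ω) := by
  have e1 : z + conj z = 2 * a := by rw [Complex.add_conj, h1]; push_cast; ring
  have e2 : ω * z + conj (ω * z) = 2 * b := by rw [Complex.add_conj, h2]; push_cast; ring
  rw [map_mul, om_conj] at e2
  rw [th_eq, om_conj]
  linear_combination e2 + (1 + ω) * e1

lemma re_zero {z : ℂ} (h1 : z.re = 0) (h2 : (ω * z).re = 0) : z = 0 := by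
  have := re_om h1 h2
  simpa [th_ne] using this

lemma LX_of {y} (hp : ∀ i, ThP (hX (pX i) y)) (hl : ∀ j, ThP (hX (lX j) y)) : LX y := by
  refine ⟨fun i => ?_, fun j => ?_⟩
  · have := (hp i).neg
    rw [hX_pX, neg_neg] at this
    exact qc_div this
  · have := hl j
    rwa [hX_lX] at this

lemma LX_lift {x} (hx : LX x) (hw : hX wX x = 0) : ∃ v ∈ LamE, ∃ k : ℂ, x = cE v + k • wX := by
  obtain ⟨v, hv⟩ := cE_lift x hw
  exact ⟨v, ⟨_, hv ▸ hx⟩, _, hv⟩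

lemma cE_re (u v : EK) (k : ℂ) : (hX (cE u) (cE v + k • wX)).re = -(3 / 2) * ⟪u, v⟫ := by
  rw [hX_add, hX_smul, hX_wr (cE_w u), mul_zero, add_zero, cE_inner, EK_real]
  have : (-(3 / 2) : ℂ) = ((-(3 / 2) : ℝ) : ℂ) := by push_cast; ring
  rw [this, Complex.re_ofReal_mul]

lemma LamE_dual (u : EK) (h : ∀ v ∈ LamE, ∃ n : ℤ, ⟪u, v⟫ = n) : u ∈ LamE := by
  have key (x) (hx : LX x) (hw : hX wX x = 0) : ThP (hX (cE u) x) := by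
    have R (x) (hx : LX x) (hw : hX wX x = 0) : ∃ n : ℤ, (hX (cE u) x).re = -(3 / 2) * n := by
      obtain ⟨v, hv, k, rfl⟩ := LX_lift hx hw
      obtain ⟨n, hn⟩ := h v hv
      exact ⟨n, by rw [cE_re, hn]⟩
    obtain ⟨a, ha⟩ := R x hx hw
    obtain ⟨b, hb⟩ := R (ω • x) (hx.smul EisP.om) (by rw [hX_smul, hw, mul_zero])
    rw [hX_smul] at hb
    have e := re_om ha hb
    refine ⟨(b : ℂ) - a * conj ω, (EisP.int b).sub ((EisP.int a).mul EisP.om.conj), ?_⟩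
    apply mul_left_cancel₀ th_ne
    rw [e]
    push_cast
    linear_combination (-((b : ℂ) - a * conj ω)) * th_sq
  refine ⟨conj (-hX (cE u) (pX 0) / (1 - ω)), ?_⟩
  set k := conj (-hX (cE u) (pX 0) / (1 - ω)) with hk
  set y := cE u + k • wX with hy
  have y0 : hX y (pX 0) = 0 := by
    rw [hy, hX_add_left, hX_smul_left, w_pX, hk, Complex.conj_conj]
    have := k_ne
    field_simp; ring
  have hd (d) (hd : LX d) (c : ℂ) (hc : EisP c) (hdc : hX wX d = c * (1 - ω)) : ThP (hX d y) := by
    have h1 := key (d - c • pX 0) (hd.sub ((LX_pX 0).smul hc)) (by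
      rw [hX_sub, hX_smul, w_pX, hdc, sub_self])
    have h2 : hX y d = hX (cE u) (d - c • pX 0) := by
      have : hX y d = hX y (d - c • pX 0) := by rw [hX_sub, hX_smul, y0]; ring
      rw [this, hy, hX_add_left, hX_smul_left, hX_sub wX, hX_smul, w_pX, hdc]
      ring
    rw [← h2] at h1
    rw [← hX_conj]
    exact h1.conj
  apply LX_of
  · intro i
    exact hd _ (LX_pX i) 1 EisP.one (by rw [w_pX, one_mul])
  · intro j
    refine hd _ (LX_lX j) (toC (-1, -2)) (EisP.toC _) ?_
    have h : ∀ j, (LN j).card = 4 := by decide +kernel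
    rw [← hX_conj, hX_lX]
    simp only [wX, Finset.sum_const, h, toC, map_sub, al_conj]
    simp [map_ofNat]
    linear_combination (-2 : ℂ) * om_sq

lemma LamE_span : Submodule.span ℝ (LamE : Set EK) = ⊤ := by
  haveI : FiniteDimensional ℝ EK := FiniteDimensional.of_finrank_pos (by rw [EK_rank]; norm_num)
  rw [← Submodule.orthogonal_eq_bot_iff, Submodule.eq_bot_iff]
  intro u hu
  have h0 (v) (hv : v ∈ LamE) : ⟪u, v⟫ = 0 := by
    rw [real_inner_comm]
    exact hu v (Submodule.subset_span hv)
  have key (x) (hx : LX x) (hw : hX wX x = 0) : hX (cE u) x = 0 := by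
    have R (x) (hx : LX x) (hw : hX wX x = 0) : (hX (cE u) x).re = 0 := by
      obtain ⟨v, hv, k, rfl⟩ := LX_lift hx hw
      rw [cE_re, h0 v hv, mul_zero]
    refine re_zero (R x hx hw) ?_
    have := R (ω • x) (hx.smul EisP.om) (by rw [hX_smul, hw, mul_zero])
    rwa [hX_smul] at this
  have e (i) : (cE u).2 i = (cE u).2 0 := by
    have := key (pX i - pX 0) ((LX_pX i).sub (LX_pX 0)) (by rw [hX_sub, w_pX, w_pX, sub_self])
    rw [hX_sub, ← hX_conj, ← hX_conj (pX 0), ← map_sub, hX_pX, hX_pX, map_eq_zero] at this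
    have h2 : conj qc * ((cE u).2 i - (cE u).2 0) = 0 := by linear_combination -this
    have hq : conj qc ≠ 0 := by simpa using qc_ne
    have := (mul_eq_zero.1 h2).resolve_left hq
    linear_combination this
  have e2 (i) : u.1 i = u.1 0 := mul_left_cancel₀ sc_ne (e i)
  have e3 := EK_sum u
  simp only [e2] at e3
  have e4 : u.1 0 = 0 := by simpa using e3
  apply Subtype.ext
  ext i
  rw [e2, e4]; rfl

lemma LamE_EU : Cov.EU LamE := ⟨Cov.disc_of_even LamE_even, LamE_span, LamE_even, LamE_dual⟩

lemma covX (z : XS) (hz : hX wX z = 0) : ∃ l, LX l ∧ hX wX l = 0 ∧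
    ∃ D : ℝ, 0 ≤ D ∧ D ≤ 3 ∧ hX (z - l) (z - l) = -D := by
  haveI : FiniteDimensional ℝ EK := FiniteDimensional.of_finrank_pos (by rw [EK_rank]; norm_num)
  obtain ⟨v, hv⟩ := cE_lift z hz
  obtain ⟨v', ⟨k', hk'⟩, hd⟩ := Cov.cov EK_rank LamE_EU (by
    rintro v ⟨k, hk⟩ h2
    refine noRoots hk (w_cw _ _) ?_
    have : (‖v‖ : ℂ) ^ 2 = 2 := by exact_mod_cast h2
    rw [hX_cw, EK_norm', this]; norm_num) v
  refine ⟨_, hk', w_cw _ _, 3 / 2 * ‖v - v'‖ ^ 2, by positivity, by linarith, ?_⟩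
  have e : z - (cE v' + k' • wX) = cE (v - v') + (z.1 / al - k') • wX := by
    rw [map_sub]
    nth_rewrite 1 [hv]
    module
  rw [e, hX_cw, EK_norm']
  push_cast; ring

end Bimonster

end

section
namespace Bimonster
open ComplexConjugate

lemma s3 : Real.sqrt 3 * Real.sqrt 3 = 3 := Real.mul_self_sqrt (by norm_num)
lemma s3_pos : 0 < Real.sqrt 3 := Real.sqrt_pos.2 (by norm_num)

lemma normSq_toC (z) : Complex.normSq (toC z) = eN z := by
  have h := toC_norm z
  rw [← Complex.normSq_eq_conj_mul_self] at h
  exact_mod_cast h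

lemma ratio {q : ℂ} (h1 : -3 < q.re) (h2 : q.re < 0) (h3 : |q.im| ≤ Real.sqrt 3 / 2) :
    ∃ μ, (μ = ω ∨ μ = conj ω) ∧ Complex.normSq (1 + (1 - μ) * q / 3) < 1 := by
  have hs := s3
  have hp := s3_pos
  have h3 := abs_le.1 h3
  have hR : q.re * (q.re + 3) < 0 := mul_neg_of_neg_of_pos h2 (by linarith)
  have e3 (z : ℂ) : z / 3 = ((1 / 3 : ℝ) : ℂ) * z := by push_cast; ring
  rcases le_total q.im 0 with hi | hi
  · refine ⟨ω, Or.inl rfl, ?_⟩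
    rw [e3, Complex.normSq_apply]
    simp only [Complex.add_re, Complex.add_im, Complex.one_re, Complex.one_im, Complex.re_ofReal_mul,
      Complex.im_ofReal_mul, Complex.mul_re, Complex.mul_im, Complex.sub_re, Complex.sub_im, om_re, om_im,
      Complex.ofReal_re, Complex.ofReal_im]
    have : q.im * (q.im + Real.sqrt 3) ≤ 0 := mul_nonpos_of_nonpos_of_nonneg hi (by linarith)
    linear_combination (q.re ^ 2 + q.im ^ 2) / 36 * hs + hR / 3 + this / 3
  · refine ⟨conj ω, Or.inr rfl, ?_⟩
    rw [e3, Complex.normSq_apply]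
    simp only [Complex.add_re, Complex.add_im, Complex.one_re, Complex.one_im, Complex.re_ofReal_mul,
      Complex.im_ofReal_mul, Complex.mul_re, Complex.mul_im, Complex.sub_re, Complex.sub_im, Complex.conj_re,
      Complex.conj_im, om_re, om_im,
      Complex.ofReal_re, Complex.ofReal_im]
    have : q.im * (q.im - Real.sqrt 3) ≤ 0 := mul_nonpos_of_nonneg_of_nonpos hi (by linarith)
    linear_combination (q.re ^ 2 + q.im ^ 2) / 36 * hs + hR / 3 + this / 3

lemma th_k : θ = (1 - ω) * ω := by rw [th_eq]; linear_combination om_sq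

lemma mu_th {μ} (h : μ = ω ∨ μ = conj ω) : ThP (1 - μ) := by
  rcases h with rfl | rfl
  · have : ThP (toC (1, -1)) := (ThP_toC _).2 (by norm_num)
    convert this using 1
    simp [toC]; ring
  · have : ThP (toC (2, 1)) := (ThP_toC _).2 (by norm_num)
    convert this using 1
    simp [toC, om_conj]; ring

lemma mu_norm {μ} (h : μ = ω ∨ μ = conj ω) : conj μ * μ = 1 := by
  rcases h with rfl | rfl
  · exact om_conj_mul
  · rw [Complex.conj_conj, mul_comm]; exact om_conj_mul

lemma LX_refl {μ s x} (h : μ = ω ∨ μ = conj ω) (hs : LX s) (hn : hX s s = -3) (hx : LX x) :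
    LX (reflX μ s x) := by
  obtain ⟨a, ha, ea⟩ := mu_th h
  obtain ⟨b, hb, eb⟩ := hs.pair hx
  rw [reflX, hn, ea, eb]
  have : θ * a * (θ * b) / -3 = a * b := by linear_combination (-(a * b) / 3) * th_sq
  rw [this]
  exact hx.sub (hs.smul (ha.mul hb))

lemma refl_norm {μ s x} (h : μ = ω ∨ μ = conj ω) (hn : hX s s = -3) :
    hX (reflX μ s x) (reflX μ s x) = hX x x := by
  have e := mu_norm h
  rw [reflX, hn]
  simp only [hX_sub, hX_sub_left, hX_smul, hX_smul_left, hn]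
  rw [← hX_conj s x]
  simp only [map_sub, map_mul, map_div₀, map_neg, map_ofNat, map_one]
  linear_combination (-(conj (hX s x) * hX s x) / 3) * e

lemma refl_refl {μ s x} (h : μ = ω ∨ μ = conj ω) (hn : hX s s = -3) :
    reflX (conj μ) s (reflX μ s x) = x := by
  have e := mu_norm h
  simp only [reflX, hn, hX_sub, hX_smul]
  match_scalars
  · ring
  · linear_combination (-(hX s x) / 3) * e

/-- A Leech root close to `y`. -/
lemma exists_leech {y : XS} (hw : hX wX y = 1 - ω) {N : ℝ} (hN : 2 ≤ N) (hy : hX y y = ((-3 / N : ℝ) : ℂ)) :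
    ∃ s, LX s ∧ hX s s = -3 ∧ hX wX s = 1 - ω ∧ -3 < (hX s y).re ∧ (hX s y).re < 0 ∧
      |(hX s y).im| ≤ Real.sqrt 3 / 2 := by
  obtain ⟨l, hl, hlw, D, hD0, hD3, hD⟩ := covX (y - pX 0) (by rw [hX_sub, hw, w_pX, sub_self])
  set s1 := pX 0 + l with hs1
  have L1 : LX s1 := (LX_pX 0).add hl
  have w1 : hX wX s1 = 1 - ω := by rw [hs1, hX_add, w_pX, hlw, add_zero]
  obtain ⟨n, hn⟩ := ThP_real (L1.pair L1) (hX_conj _ _)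
  have hD : hX (y - s1) (y - s1) = -D := by
    rw [← hD, hs1]; congr 1 <;> abel
  -- all candidates
  have gen (a : ℤ) : ∃ s, LX s ∧ hX s s = -3 ∧ hX wX s = 1 - ω ∧
      hX s y = hX s1 y + (-1 - n : ℤ) * (1 - ω) + a * θ := by
    have w1' : hX s1 wX = 2 + ω := by rw [← hX_conj, w1, kconj]
    refine ⟨s1 + ((-1 - n : ℤ) + (a : ℂ) * ω ^ 2) • wX, ?_, ?_, ?_, ?_⟩
    · exact L1.add (LX_w.smul ((EisP.int _).add ((EisP.int _).mul (by rw [sq]; exact EisP.om.mul EisP.om))))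
    · simp only [hX_add, hX_add_left, hX_smul, hX_smul_left, hn, w1, w1', w_null, om_sq, map_add, map_mul, map_sub,
        map_neg, map_one, om_conj, map_intCast]
      push_cast
      linear_combination (-2 * a : ℂ) * om_sq
    · rw [hX_w_shift, w1]
    · simp only [hX_add_left, hX_smul_left, hw, map_add, map_mul, map_pow, om_conj, map_intCast, th_eq]
      linear_combination (-a * ω : ℂ) * om_sq
  set q0 := hX s1 y + (-1 - n : ℤ) * (1 - ω) with hq0
  obtain ⟨s, Ls, ns, ws, es⟩ := gen (-round (q0.im / Real.sqrt 3))
  have him : (hX s y).im = q0.im - round (q0.im / Real.sqrt 3) * Real.sqrt 3 := by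
    rw [es, th_eq]
    simp [Complex.add_im, Complex.mul_im, om_im, om_re]
    ring
  have hsy : hX (y - s) (y - s) = -D := by
    have hys : hX s1 s1 - hX s1 y - hX y s1 = hX s s - hX s y - hX y s := by
      rw [← hX_conj s1 y, ← hX_conj s y, es, hn, ns, hq0]
      simp only [map_add, map_mul, map_intCast, map_sub, map_one, om_conj, th_conj]
      push_cast
      ring
    rw [← hD]
    simp only [hX_sub, hX_sub_left]
    linear_combination -hys
  have hre : (hX s y).re = (D - 3 - 3 / N) / 2 := by
    simp only [hX_sub, hX_sub_left] at hsy
    rw [← hX_conj s y, hy, ns] at hsy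
    have := congrArg Complex.re hsy
    simp at this
    linear_combination (-1 / 2) * this
  have hN0 : 0 < 3 / N := by positivity
  have hN1 : 3 / N ≤ 3 / 2 := by gcongr
  refine ⟨s, Ls, ns, ws, by rw [hre]; linarith, by rw [hre]; linarith, ?_⟩
  rw [him]
  have hp := s3_pos
  have h := abs_sub_round (q0.im / Real.sqrt 3)
  have e : q0.im - round (q0.im / Real.sqrt 3) * Real.sqrt 3 =
      (q0.im / Real.sqrt 3 - round (q0.im / Real.sqrt 3)) * Real.sqrt 3 := by field_simp
  rw [e, abs_mul, abs_of_pos hp]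
  nlinarith

lemma all_roots (n : ℕ) : ∀ x, LX x → hX x x = -3 → ∀ m, hX wX x = (1 - ω) * toC m → eN m = n → RX x := by
  induction n using Nat.strong_induction_on with
  | _ n ih =>
    intro x hx hn m hm hmn
    rcases lt_trichotomy n 1 with h | h | h
    · exfalso
      have : eN m = 0 := by rw [hmn]; simpa using h
      rw [eN_eq_zero this, toC_zero, mul_zero] at hm
      exact noRoots hx hm hn
    · have hu : EisUnit (toC m) := eN_one (by rw [hmn, h]; rfl)
      have h1 : RX (conj (toC m) • x) := by
        apply leech (hx.smul hu.conj.eis)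
        · rw [hX_smul, hX_smul_left, hn, Complex.conj_conj]
          linear_combination (-3 : ℂ) * hu.mulconj
        · rw [hX_smul, hm]
          linear_combination (1 - ω) * hu.mulconj
      have h2 := h1.unit hu
      rwa [smul_smul, mul_comm, hu.mulconj, one_smul] at h2
    · set M := toC m with hM
      have hMn : conj M * M = (n : ℂ) := by rw [hM, toC_norm, hmn]; simp
      have hn0 : (n : ℂ) ≠ 0 := by
        have : n ≠ 0 := by omega
        exact_mod_cast this
      have hM0 : M ≠ 0 := by
        intro h0
        rw [h0, mul_zero] at hMn
        exact hn0 hMn.symm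
      have hMc : conj M ≠ 0 := by simpa using hM0
      obtain ⟨y, rfl⟩ : ∃ y, x = M • y := ⟨M⁻¹ • x, by rw [smul_smul, mul_inv_cancel₀ hM0, one_smul]⟩
      have wy : hX wX y = 1 - ω := by
        rw [hX_smul] at hm
        apply mul_left_cancel₀ hM0
        linear_combination hm
      have ny : hX y y = ((-3 / (n : ℝ) : ℝ) : ℂ) := by
        rw [hX_smul, hX_smul_left] at hn
        push_cast
        rw [eq_div_iff hn0, ← hMn]
        linear_combination hn
      obtain ⟨s, Ls, ns, ws, r1, r2, i1⟩ := exists_leech wy (N := n) (by exact_mod_cast h) ny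
      obtain ⟨μ, hμ, hr⟩ := ratio r1 r2 i1
      have Rs := leech Ls ns ws
      have hx' := LX_refl hμ Ls ns hx
      have ew : hX wX (reflX μ s (M • y)) = (1 - ω) * (M * (1 + (1 - μ) * hX s y / 3)) := by
        rw [reflX, ns, hX_sub, hX_smul, hX_smul, hX_smul, ws, wy]; ring
      obtain ⟨c, hc, ec⟩ := LX_w.pair hx'
      obtain ⟨m', em'⟩ := (EisP_iff _).1 (EisP.om.mul hc)
      rw [th_k, mul_assoc, em'] at ec
      have eM : toC m' = M * (1 + (1 - μ) * hX s y / 3) := by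
        apply mul_left_cancel₀ k_ne
        rw [← ec, ← ew]
      have hlt : eN m' < n := by
        have h1 := congrArg Complex.normSq eM
        rw [Complex.normSq_mul, normSq_toC, hM, normSq_toC, hmn] at h1
        have hnp : (0 : ℝ) < n := by exact_mod_cast (by omega : 0 < n)
        have : (eN m' : ℝ) < n := by
          rw [h1]; push_cast
          nlinarith
        exact_mod_cast this
      obtain ⟨k, hk⟩ := Int.eq_ofNat_of_zero_le (eN_nonneg m')
      have R' : RX (reflX μ s (M • y)) :=
        ih k (by rw [hk] at hlt; exact_mod_cast hlt) _ hx' (by rw [refl_norm hμ ns, hn]) m' ec hk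
      have e := refl_refl (x := M • y) hμ ns
      rw [← e]
      rcases hμ with rfl | rfl
      · exact Rs.inv R'
      · rw [Complex.conj_conj] at *
        exact Rs.refl R'

lemma main : Subgroup.closure (ReflAutos D26) = RL := by
  apply reductionX
  intro x hx hn
  obtain ⟨c, hc, ec⟩ := LX_w.pair hx
  obtain ⟨m, em⟩ := (EisP_iff _).1 (EisP.om.mul hc)
  rw [th_k, mul_assoc, em] at ec
  obtain ⟨k, hk⟩ := Int.eq_ofNat_of_zero_le (eN_nonneg m)
  exact all_roots k x hx hn m ec hk

end Bimonster

end

namespace Bimonster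

/-- The 26 `ω`-reflections in the roots of the diagram `D` generate the reflection
group `R(L)` of the Lorentzian complex Leech lattice `L`. -/
theorem stmt1 : Subgroup.closure (ReflAutos D26) = RL :=
  main

end Bimonster
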